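/- There exist positive constants N0, a1, a2, c1, c2 depending only on d such that the following holds. Suppose the tasks are drawn from the ReLU task distribution D(F^+_L), the noise variance satisfies a1·n^{-d/2} ≤ σ² ≤ a2·n·L², and n ≥ N0 as well as n ≥ N0·(L·log n/σ)^d. Then every minimizer M* of the softmax-attention ICL pretraining loss L(·) over all of ℝ^{d×d} has the form M* = w·I_d for a scalar w satisfying c1·Λ^{1/(d+2)} ≤ |w| ≤ c2·Λ^{2/(d+2)}. -/

import Mathlib

open MeasureTheory Real

noncomputable section

/-- Uniform probability measure on the unit sphere `S^{d-1} ⊆ ℝ^d`, defined as the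
normalized `(d-1)`-dimensional Hausdorff measure restricted to the sphere. -/
def sphereUniform (d : ℕ) : Measure (EuclideanSpace ℝ (Fin d)) :=
  ((μH[(d : ℝ) - 1]) (Metric.sphere (0 : EuclideanSpace ℝ (Fin d)) 1))⁻¹ •
    (μH[(d : ℝ) - 1]).restrict (Metric.sphere (0 : EuclideanSpace ℝ (Fin d)) 1)

/-- Uniform probability measure on the interval `[-L, L]`. -/
def unifIcc (L : ℝ) : Measure ℝ :=
  (ENNReal.ofReal (2 * L))⁻¹ • (volume.restrict (Set.Icc (-L) L))

/-- The bilinear form `x ↦ x ⬝ M y`. -/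
def quadForm {d : ℕ} (M : Matrix (Fin d) (Fin d) ℝ)
    (x y : EuclideanSpace ℝ (Fin d)) : ℝ :=
  ∑ a, ∑ b, x a * M a b * y b

/-- The softmax-attention prediction of the label of the query `x (Fin.last n)` given
the context points `x i` with labels `y i`, `i = 1, …, n`. -/
def softmaxPred {d n : ℕ} (M : Matrix (Fin d) (Fin d) ℝ)
    (x : Fin (n + 1) → EuclideanSpace ℝ (Fin d)) (y : Fin n → ℝ) : ℝ :=
  (∑ i : Fin n, y i * Real.exp (quadForm M (x i.castSucc) (x (Fin.last n)))) /
    ∑ i : Fin n, Real.exp (quadForm M (x i.castSucc) (x (Fin.last n)))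

/-- The softmax-attention ICL pretraining population loss: the task parameter `θ` is drawn
from `τ`, the covariates `x_1, …, x_{n+1}` are i.i.d. `sphereUniform d`, and the label
noises `e_1, …, e_n` are i.i.d. with law `ν`; the loss is the expected squared error of the
softmax-attention prediction of the clean label `F θ (x_{n+1})` of the query from the noisy
labelled context `{(x_i, F θ x_i + e_i)}_{i=1}^n`. -/
def iclLoss (d n : ℕ) {Θ : Type*} [MeasurableSpace Θ] (τ : Measure Θ) (ν : Measure ℝ)
    (F : Θ → EuclideanSpace ℝ (Fin d) → ℝ) (M : Matrix (Fin d) (Fin d) ℝ) : ℝ :=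
  ∫ θ, ∫ x : Fin (n + 1) → EuclideanSpace ℝ (Fin d), ∫ e : Fin n → ℝ,
      (softmaxPred M x (fun i => F θ (x i.castSucc) + e i) - F θ (x (Fin.last n))) ^ 2
        ∂(Measure.pi fun _ : Fin n => ν)
      ∂(Measure.pi fun _ : Fin (n + 1) => sphereUniform d) ∂τ

/-- The parameter distribution of the affine task class `D(F^aff_L)`:
`v` uniform on the sphere, `l, b` i.i.d. uniform on `[-L, L]`. -/
def affineTask (d : ℕ) (L : ℝ) : Measure (EuclideanSpace ℝ (Fin d) × ℝ × ℝ) :=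
  (sphereUniform d).prod ((unifIcc L).prod (unifIcc L))

/-- The affine task function `f(x) = l ⬝ vᵀx + b` with parameter `θ = (v, l, b)`. -/
def affineF {d : ℕ} (θ : EuclideanSpace ℝ (Fin d) × ℝ × ℝ)
    (x : EuclideanSpace ℝ (Fin d)) : ℝ :=
  θ.2.1 * (∑ a, θ.1 a * x a) + θ.2.2


/-- The parameter distribution of the ReLU task class `D(F^+_L)`:
`v` uniform on the sphere, `l₁, l₂, b` i.i.d. uniform on `[-L, L]`. -/
def reluTask (d : ℕ) (L : ℝ) : Measure (EuclideanSpace ℝ (Fin d) × ℝ × ℝ × ℝ) :=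
  (sphereUniform d).prod ((unifIcc L).prod ((unifIcc L).prod (unifIcc L)))

/-- The ReLU task function `f(x) = l₁ max(vᵀx, 0) + l₂ max(-vᵀx, 0) + b`
with parameter `θ = (v, l₁, l₂, b)`. -/
def reluF {d : ℕ} (θ : EuclideanSpace ℝ (Fin d) × ℝ × ℝ × ℝ)
    (x : EuclideanSpace ℝ (Fin d)) : ℝ :=
  θ.2.1 * max (∑ a, θ.1 a * x a) 0 + θ.2.2.1 * max (-(∑ a, θ.1 a * x a)) 0 + θ.2.2.2

open scoped ENNReal NNReal

/-- The point of the unit sphere obtained by normalizing the vector whose `j`-th coordinate is `s`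
and whose other coordinates are given by `z`. -/
def sphereChart {m : ℕ} (j : Fin (m + 1)) (s : ℝ) (z : Fin m → ℝ) :
    EuclideanSpace ℝ (Fin (m + 1)) :=
  ‖WithLp.toLp 2 (j.insertNth s z : Fin (m + 1) → ℝ)‖⁻¹ •
    WithLp.toLp 2 (j.insertNth s z : Fin (m + 1) → ℝ)

lemma norm_normalize_sub_normalize_le {V : Type*} [NormedAddCommGroup V] [NormedSpace ℝ V]
    {a b : V} (ha : 1 ≤ ‖a‖) (hb : 1 ≤ ‖b‖) :
    ‖‖a‖⁻¹ • a - ‖b‖⁻¹ • b‖ ≤ 2 * ‖a - b‖ := by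
  have e : ‖a‖⁻¹ • a - ‖b‖⁻¹ • b = ‖a‖⁻¹ • (a - b) + (‖a‖⁻¹ - ‖b‖⁻¹) • b := by
    rw [smul_sub, sub_smul]; abel
  have h1 : ‖‖a‖⁻¹ • (a - b)‖ ≤ ‖a - b‖ := by
    rw [norm_smul, norm_inv, norm_norm]
    exact mul_le_of_le_one_left (norm_nonneg _) (inv_le_one_of_one_le₀ ha)
  have h2 : ‖(‖a‖⁻¹ - ‖b‖⁻¹) • b‖ ≤ ‖a - b‖ := by
    have ha' : 0 < ‖a‖ := by linarith
    have hb' : 0 < ‖b‖ := by linarith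
    have e2 : (‖a‖⁻¹ - ‖b‖⁻¹) = (‖b‖ - ‖a‖) * ‖a‖⁻¹ * ‖b‖⁻¹ := by field_simp
    rw [norm_smul, e2, norm_mul, norm_mul, norm_inv, norm_inv, norm_norm, norm_norm,
      mul_assoc, inv_mul_cancel₀ hb'.ne', mul_one]
    calc ‖‖b‖ - ‖a‖‖ * ‖a‖⁻¹ ≤ ‖b - a‖ * 1 :=
          mul_le_mul (abs_norm_sub_norm_le b a) (inv_le_one_of_one_le₀ ha) (by positivity)
            (norm_nonneg _)
      _ = ‖a - b‖ := by rw [mul_one, norm_sub_rev]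
  rw [e]
  linarith [norm_add_le (‖a‖⁻¹ • (a - b)) ((‖a‖⁻¹ - ‖b‖⁻¹) • b)]

lemma one_le_norm_insertNth {m : ℕ} (j : Fin (m + 1)) {s : ℝ} (hs : |s| = 1) (z : Fin m → ℝ) :
    1 ≤ ‖WithLp.toLp 2 (j.insertNth s z : Fin (m + 1) → ℝ)‖ := by
  have := PiLp.norm_apply_le (WithLp.toLp 2 (j.insertNth s z : Fin (m + 1) → ℝ)) j
  simpa [hs] using this

lemma exists_lipschitzWith_sphereChart (m : ℕ) :
    ∃ K : ℝ≥0, ∀ (j : Fin (m + 1)) (s : ℝ), |s| = 1 → LipschitzWith K (sphereChart j s) := by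
  have h := PiLp.lipschitzWith_toLp 2 (fun _ : Fin (m + 1) => ℝ)
  refine ⟨2 * (Fintype.card (Fin (m + 1)) : ℝ≥0) ^ (1 / (2 : ℝ≥0∞)).toReal,
    fun j s hs => LipschitzWith.of_dist_le_mul fun z z' => ?_⟩
  have h1 := h.dist_le_mul (j.insertNth s z) (j.insertNth s z')
  rw [Fin.dist_insertNth_insertNth, dist_self, max_eq_right dist_nonneg] at h1
  rw [dist_eq_norm] at h1
  rw [dist_eq_norm]
  have h2 := norm_normalize_sub_normalize_le (one_le_norm_insertNth j hs z)
    (one_le_norm_insertNth j hs z')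
  refine h2.trans ?_
  rw [NNReal.coe_mul, mul_assoc]
  exact mul_le_mul_of_nonneg_left h1 zero_le_two

lemma sphereChart_coords {m : ℕ} {x : EuclideanSpace ℝ (Fin (m + 1))} (hx : ‖x‖ = 1)
    {j : Fin (m + 1)} (hj : x j ≠ 0) :
    sphereChart j (x j / |x j|) (fun k => x (j.succAbove k) / |x j|) = x := by
  have e : (WithLp.toLp 2 (j.insertNth (x j / |x j|) (fun k => x (j.succAbove k) / |x j|) :
      Fin (m + 1) → ℝ) : EuclideanSpace ℝ (Fin (m + 1))) = |x j|⁻¹ • x := by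
    ext i
    refine Fin.succAboveCases j ?_ (fun k => ?_) i
    · simp [div_eq_inv_mul]
    · simp [div_eq_inv_mul]
  have hj' : |x j| ≠ 0 := abs_ne_zero.2 hj
  rw [sphereChart, e, norm_smul, hx, norm_inv, norm_eq_abs, abs_abs, mul_one, inv_inv, smul_smul,
    mul_inv_cancel₀ hj', one_smul]

/-- Hausdorff measure of a piece of the sphere is controlled by the volume of its projective
coordinates. -/
lemma exists_hausdorff_le_volume (m : ℕ) :
    ∃ K : ℝ≥0∞, K ≠ ⊤ ∧ ∀ (j : Fin (m + 1)) (B : Set (Fin m → ℝ))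
      (A : Set (EuclideanSpace ℝ (Fin (m + 1)))),
      (∀ x ∈ A, ‖x‖ = 1 ∧ x j ≠ 0 ∧ (fun k => x (j.succAbove k) / |x j|) ∈ B) →
      μH[(m : ℝ)] A ≤ K * volume B := by
  obtain ⟨K, hK⟩ := exists_lipschitzWith_sphereChart m
  refine ⟨2 * (K : ℝ≥0∞) ^ (m : ℝ), ?_, fun j B A hA => ?_⟩
  · exact ENNReal.mul_ne_top (by simp) (ENNReal.rpow_ne_top_of_nonneg (by positivity) (by simp))
  have hsub : A ⊆ sphereChart j 1 '' B ∪ sphereChart j (-1) '' B := by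
    intro x hx
    obtain ⟨h1, h2, h3⟩ := hA x hx
    rcases lt_or_gt_of_ne h2 with h | h
    · right
      refine ⟨_, h3, ?_⟩
      conv_rhs => rw [← sphereChart_coords h1 h2]
      rw [show x j / |x j| = -1 by rw [abs_of_neg h, div_neg, div_self h2]]
    · left
      refine ⟨_, h3, ?_⟩
      conv_rhs => rw [← sphereChart_coords h1 h2]
      rw [show x j / |x j| = 1 by rw [abs_of_pos h, div_self h2]]
  have hv : (μH[(m : ℝ)] : Measure (Fin m → ℝ)) = volume := by
    have := hausdorffMeasure_pi_real (ι := Fin m)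
    rwa [Fintype.card_fin] at this
  have key : ∀ s : ℝ, |s| = 1 → μH[(m : ℝ)] (sphereChart j s '' B) ≤
      (K : ℝ≥0∞) ^ (m : ℝ) * volume B := fun s hs => by
    have := (hK j s hs).hausdorffMeasure_image_le (d := m) (by positivity) B
    rwa [hv] at this
  calc μH[(m : ℝ)] A ≤ _ := measure_mono hsub
    _ ≤ _ := measure_union_le _ _
    _ ≤ _ := add_le_add (key 1 (by simp)) (key (-1) (by simp))
    _ = _ := by rw [mul_assoc, two_mul]

lemma exists_abs_coord_ge {m : ℕ} {x : EuclideanSpace ℝ (Fin (m + 1))} (hx : ‖x‖ = 1) :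
    ∃ j, 1 / ((m : ℝ) + 1) ≤ |x j| := by
  by_contra! h
  have h1 : ∑ j, x j ^ 2 = 1 := by
    rw [← EuclideanSpace.real_norm_sq_eq, hx, one_pow]
  have h2 : ∑ j, x j ^ 2 < ∑ _j : Fin (m + 1), 1 / ((m : ℝ) + 1) := by
    refine Finset.sum_lt_sum_of_nonempty (by simp) fun j _ => ?_
    have hj := h j
    have : (1 : ℝ) / (m + 1) ≤ 1 := by
      rw [div_le_one (by positivity)]; linarith [(Nat.cast_nonneg m : (0 : ℝ) ≤ m)]
    rw [← sq_abs]
    nlinarith [abs_nonneg (x j)]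
  rw [h1] at h2
  simp at h2
  rw [mul_inv_cancel₀ (by positivity)] at h2
  exact lt_irrefl _ h2

lemma abs_coord_le {d : ℕ} {x : EuclideanSpace ℝ (Fin d)} (hx : ‖x‖ = 1) (j : Fin d) :
    |x j| ≤ 1 := by
  have := PiLp.norm_apply_le x j
  rwa [hx] at this

lemma abs_div_abs_le {m : ℕ} {a b t : ℝ} (ha : |a| ≤ t) (hb : 1 / ((m : ℝ) + 1) ≤ |b|) :
    |a / (|b|)| ≤ (m + 1) * t := by
  have hb0 : 0 < |b| := lt_of_lt_of_le (by positivity) hb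
  rw [abs_div, abs_abs, div_le_iff₀ hb0]
  have h1 : 1 ≤ ((m : ℝ) + 1) * |b| := by
    rw [div_le_iff₀ (by positivity)] at hb; linarith
  nlinarith [abs_nonneg a]

lemma hausdorff_sphere_lt_top (m : ℕ) :
    μH[(m : ℝ)] (Metric.sphere (0 : EuclideanSpace ℝ (Fin (m + 1))) 1) < ⊤ := by
  obtain ⟨K, hK, h⟩ := exists_hausdorff_le_volume m
  have hsub : Metric.sphere (0 : EuclideanSpace ℝ (Fin (m + 1))) 1 ⊆
      ⋃ j : Fin (m + 1), {x | ‖x‖ = 1 ∧ 1 / ((m : ℝ) + 1) ≤ |x j|} := by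
    intro x hx
    rw [mem_sphere_zero_iff_norm] at hx
    obtain ⟨j, hj⟩ := exists_abs_coord_ge hx
    exact Set.mem_iUnion.2 ⟨j, hx, hj⟩
  refine (measure_mono hsub).trans_lt ((measure_iUnion_fintype_le _ _).trans_lt ?_)
  refine ENNReal.sum_lt_top.2 fun j _ => ?_
  refine (h j (Metric.closedBall 0 ((m + 1) * 1)) _ fun x hx => ⟨hx.1, ?_, ?_⟩).trans_lt ?_
  · exact abs_pos.1 (lt_of_lt_of_le (by positivity) hx.2)
  · rw [mem_closedBall_zero_iff, pi_norm_le_iff_of_nonneg (by positivity)]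
    exact fun k => abs_div_abs_le (abs_coord_le hx.1 _) hx.2
  · rw [Real.volume_pi_closedBall _ (by positivity)]
    exact ENNReal.mul_lt_top hK.lt_top ENNReal.ofReal_lt_top

lemma exists_hausdorff_cap_le (m : ℕ) :
    ∃ C : ℝ≥0∞, C ≠ ⊤ ∧ ∀ r : ℝ, 0 ≤ r → r ≤ 1 / 2 →
      μH[(m : ℝ)] {x : EuclideanSpace ℝ (Fin (m + 1)) | ‖x‖ = 1 ∧
        dist x (EuclideanSpace.single 0 1) ≤ r} ≤ C * ENNReal.ofReal (r ^ m) := by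
  obtain ⟨K, hK, h⟩ := exists_hausdorff_le_volume m
  refine ⟨K * ENNReal.ofReal (4 ^ m), ENNReal.mul_ne_top hK (by simp), fun r hr hr2 => ?_⟩
  refine (h 0 (Metric.closedBall 0 (2 * r)) _ fun x hx => ?_).trans ?_
  · have hd : ∀ k, |x k - (EuclideanSpace.single 0 1 : EuclideanSpace ℝ (Fin (m + 1))) k| ≤ r := by
      intro k
      have := PiLp.norm_apply_le (x - EuclideanSpace.single 0 1) k
      rw [← dist_eq_norm] at this
      exact this.trans hx.2
    have h0 : 1 / 2 ≤ |x 0| := by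
      have := hd 0
      simp only [PiLp.single_apply, if_true] at this
      have h3 := abs_sub_abs_le_abs_sub 1 (x 0)
      rw [abs_sub_comm 1 (x 0), abs_one] at h3
      linarith
    refine ⟨hx.1, abs_pos.1 (lt_of_lt_of_le (by positivity) h0), ?_⟩
    rw [mem_closedBall_zero_iff, pi_norm_le_iff_of_nonneg (by positivity)]
    intro k
    have := hd ((0 : Fin (m + 1)).succAbove k)
    rw [PiLp.single_apply, if_neg (Fin.succAbove_ne _ _), sub_zero] at this
    have := abs_div_abs_le (m := 1) this (b := x 0) (by norm_num; linarith)
    rw [norm_eq_abs]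
    convert this using 2
    norm_num
  · rw [Real.volume_pi_closedBall _ (by positivity), mul_assoc,
      ← ENNReal.ofReal_mul (by positivity), Fintype.card_fin, ← mul_pow, ← mul_assoc]
    norm_num

lemma exists_le_hausdorff_cap (m : ℕ) :
    ∃ c : ℝ, 0 < c ∧ ∀ r : ℝ, 0 ≤ r → r ≤ 1 → ENNReal.ofReal (c * r ^ m) ≤
      μH[(m : ℝ)] {x : EuclideanSpace ℝ (Fin (m + 1)) | ‖x‖ = 1 ∧
        dist x (EuclideanSpace.single 0 1) ≤ r} := by
  refine ⟨(1 / ((m : ℝ) + 1)) ^ m, by positivity, fun r hr hr1 => ?_⟩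
  set A := {x : EuclideanSpace ℝ (Fin (m + 1)) | ‖x‖ = 1 ∧
        dist x (EuclideanSpace.single 0 1) ≤ r}
  let P : EuclideanSpace ℝ (Fin (m + 1)) → (Fin m → ℝ) := fun x k => x k.succ
  have hP : LipschitzWith 1 P := by
    refine LipschitzWith.of_dist_le_mul fun x y => ?_
    rw [NNReal.coe_one, one_mul, dist_pi_le_iff dist_nonneg]
    intro k
    have := PiLp.norm_apply_le (x - y) k.succ
    rw [dist_eq_norm]
    exact this
  have hv : (μH[(m : ℝ)] : Measure (Fin m → ℝ)) = volume := by
    have := hausdorffMeasure_pi_real (ι := Fin m)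
    rwa [Fintype.card_fin] at this
  have h1 := hP.hausdorffMeasure_image_le (d := m) (by positivity) A
  rw [hv, ENNReal.coe_one, ENNReal.one_rpow, one_mul] at h1
  refine le_trans ?_ h1
  have hsub : Metric.closedBall (0 : Fin m → ℝ) (r / (2 * ((m : ℝ) + 1))) ⊆ P '' A := by
    intro z hz
    rw [mem_closedBall_zero_iff, pi_norm_le_iff_of_nonneg (by positivity)] at hz
    set q := ∑ k, z k ^ 2 with hq
    have hq0 : 0 ≤ q := Finset.sum_nonneg fun k _ => sq_nonneg _
    have hq1 : q ≤ r ^ 2 / 4 := by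
      have : q ≤ ∑ _k : Fin m, (r / (2 * ((m : ℝ) + 1))) ^ 2 :=
        Finset.sum_le_sum fun k _ => by
          have := hz k
          rw [norm_eq_abs] at this
          rw [← sq_abs]
          exact pow_le_pow_left₀ (abs_nonneg _) this 2
      refine this.trans ?_
      simp only [Finset.sum_const, Finset.card_univ, Fintype.card_fin, nsmul_eq_mul]
      rw [div_pow, mul_pow, ← mul_div_assoc, div_le_div_iff₀ (by positivity) (by positivity)]
      nlinarith [sq_nonneg r, (Nat.cast_nonneg m : (0 : ℝ) ≤ m), mul_nonneg (sq_nonneg r)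
        (Nat.cast_nonneg m : (0 : ℝ) ≤ m), mul_nonneg (sq_nonneg r) (sq_nonneg (m : ℝ))]
    have hs : √(1 - q) ^ 2 = 1 - q := Real.sq_sqrt (by nlinarith)
    have hs0 := Real.sqrt_nonneg (1 - q)
    have hsle : 1 - q ≤ √(1 - q) := by
      have : √(1 - q) ≤ 1 := Real.sqrt_le_one.2 (by linarith)
      nlinarith
    refine ⟨WithLp.toLp 2 (Fin.cons (√(1 - q)) z), ⟨?_, ?_⟩, ?_⟩
    · rw [← sq_eq_sq₀ (norm_nonneg _) zero_le_one, EuclideanSpace.real_norm_sq_eq,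
        Fin.sum_univ_succ]
      simp [hs, ← hq]
    · rw [dist_eq_norm, ← sq_le_sq₀ (norm_nonneg _) hr, EuclideanSpace.real_norm_sq_eq,
        Fin.sum_univ_succ]
      simp [← hq]
      nlinarith
    · ext k; simp [P]
  refine le_trans (le_of_eq ?_) (measure_mono hsub)
  rw [Real.volume_pi_closedBall _ (by positivity), Fintype.card_fin, ← mul_pow]
  congr 2
  field_simp

lemma exists_hausdorff_slab_le (m : ℕ) (hm : 1 ≤ m) :
    ∃ C : ℝ≥0∞, C ≠ ⊤ ∧ ∀ r : ℝ, 0 ≤ r → 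
      μH[(m : ℝ)] {x : EuclideanSpace ℝ (Fin (m + 1)) | ‖x‖ = 1 ∧ |x 0| ≤ r} ≤
        C * ENNReal.ofReal r := by
  obtain ⟨K, hK, h⟩ := exists_hausdorff_le_volume m
  have hfin := hausdorff_sphere_lt_top m
  set T := μH[(m : ℝ)] (Metric.sphere (0 : EuclideanSpace ℝ (Fin (m + 1))) 1)
  have hm1 : (0 : ℝ) < m + 1 := by positivity
  refine ⟨T * ENNReal.ofReal (m + 1) + (m + 1) * (K * ENNReal.ofReal ((2 * (m + 1)) ^ m)), ?_,
    fun r hr => ?_⟩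
  · refine ENNReal.add_ne_top.2 ⟨ENNReal.mul_ne_top hfin.ne (by simp), ENNReal.mul_ne_top ?_
      (ENNReal.mul_ne_top hK (by simp))⟩
    exact ENNReal.add_ne_top.2 ⟨by simp, by simp⟩
  rcases le_or_gt (1 / ((m : ℝ) + 1)) r with hr1 | hr1
  · calc _ ≤ T := measure_mono fun x hx => by simpa using hx.1
      _ ≤ T * ENNReal.ofReal (m + 1) * ENNReal.ofReal r := by
        rw [mul_assoc, ← ENNReal.ofReal_mul hm1.le]
        refine le_mul_of_one_le_right' ?_
        rw [ENNReal.one_le_ofReal]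
        rw [div_le_iff₀ hm1] at hr1; linarith
      _ ≤ _ := by gcongr; exact le_self_add
  have hsub : {x : EuclideanSpace ℝ (Fin (m + 1)) | ‖x‖ = 1 ∧ |x 0| ≤ r} ⊆
      ⋃ j : Fin (m + 1), {x | (‖x‖ = 1 ∧ |x 0| ≤ r) ∧ 1 / ((m : ℝ) + 1) ≤ |x j|} := by
    intro x hx
    obtain ⟨j, hj⟩ := exists_abs_coord_ge hx.1
    exact Set.mem_iUnion.2 ⟨j, hx, hj⟩
  have hpiece : ∀ j : Fin (m + 1), μH[(m : ℝ)] {x : EuclideanSpace ℝ (Fin (m + 1)) |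
      (‖x‖ = 1 ∧ |x 0| ≤ r) ∧ 1 / ((m : ℝ) + 1) ≤ |x j|} ≤
      K * ENNReal.ofReal ((2 * (m + 1)) ^ m) * ENNReal.ofReal r := by
    intro j
    by_cases hj : j = 0
    · subst hj
      rw [show {x : EuclideanSpace ℝ (Fin (m + 1)) |
        (‖x‖ = 1 ∧ |x 0| ≤ r) ∧ 1 / ((m : ℝ) + 1) ≤ |x 0|} = ∅ from ?_]
      · simp
      · ext x
        simp only [Set.mem_ofPred_eq, Set.mem_empty_iff_false, iff_false]
        rintro ⟨⟨_, h1⟩, h2⟩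
        linarith
    obtain ⟨k, hk⟩ := Fin.exists_succAbove_eq (x := 0) (y := j) (fun h0 => hj h0.symm)
    refine (h j (Set.pi Set.univ (fun i => Set.Icc (-((m + 1) * (if i = k then r else 1)))
      ((m + 1) * (if i = k then r else 1)))) _ fun x hx => ⟨hx.1.1, ?_, ?_⟩).trans ?_
    · exact abs_pos.1 (lt_of_lt_of_le (by positivity) hx.2)
    · intro i _
      refine abs_le.1 (abs_div_abs_le ?_ hx.2)
      by_cases hi : i = k
      · rw [if_pos hi, hi, hk]; exact hx.1.2
      · rw [if_neg hi]; exact abs_coord_le hx.1.1 _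
    · rw [mul_assoc]
      gcongr
      rw [volume_pi_pi]
      simp only [Real.volume_Icc]
      rw [← ENNReal.ofReal_prod_of_nonneg, ← ENNReal.ofReal_mul (by positivity)]
      · refine ENNReal.ofReal_le_ofReal (le_of_eq ?_)
        have e : ∀ i : Fin m, ((m : ℝ) + 1) * (if i = k then r else 1) -
          -((m + 1) * (if i = k then r else 1)) = (2 * (m + 1)) * (if i = k then r else 1) :=
          fun i => by ring
        simp only [e, Finset.prod_mul_distrib, Finset.prod_const, Finset.prod_ite_eq',
          Finset.mem_univ, if_true, Finset.card_univ, Fintype.card_fin, mul_pow]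
      · intro i _
        split_ifs <;> nlinarith
  calc _ ≤ _ := measure_mono hsub
    _ ≤ _ := measure_iUnion_fintype_le _ _
    _ ≤ ∑ _j : Fin (m + 1), K * ENNReal.ofReal ((2 * (m + 1)) ^ m) * ENNReal.ofReal r :=
      Finset.sum_le_sum fun j _ => hpiece j
    _ = (m + 1) * (K * ENNReal.ofReal ((2 * (m + 1)) ^ m)) * ENNReal.ofReal r := by
      simp [mul_assoc]
    _ ≤ _ := by gcongr; exact le_add_self

lemma sphereUniform_succ_apply (m : ℕ) {A : Set (EuclideanSpace ℝ (Fin (m + 1)))}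
    (hA : MeasurableSet A) :
    sphereUniform (m + 1) A =
      (μH[(m : ℝ)] (Metric.sphere (0 : EuclideanSpace ℝ (Fin (m + 1))) 1))⁻¹ *
        μH[(m : ℝ)] {x | ‖x‖ = 1 ∧ x ∈ A} := by
  have e : ((m + 1 : ℕ) : ℝ) - 1 = m := by push_cast; ring
  rw [sphereUniform, e, Measure.smul_apply, smul_eq_mul, Measure.restrict_apply hA]
  congr 2
  ext x
  simp [and_comm]

lemma hausdorff_sphere_pos (m : ℕ) :
    0 < μH[(m : ℝ)] (Metric.sphere (0 : EuclideanSpace ℝ (Fin (m + 1))) 1) := by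
  obtain ⟨c, hc, h⟩ := exists_le_hausdorff_cap m
  refine lt_of_lt_of_le ?_ ((h 1 zero_le_one le_rfl).trans (measure_mono fun x hx => ?_))
  · rw [one_pow, mul_one]; exact ENNReal.ofReal_pos.2 hc
  · simpa using hx.1

instance isProbabilityMeasure_sphereUniform (m : ℕ) :
    IsProbabilityMeasure (sphereUniform (m + 1)) := by
  constructor
  rw [sphereUniform_succ_apply m MeasurableSet.univ]
  have : {x : EuclideanSpace ℝ (Fin (m + 1)) | ‖x‖ = 1 ∧ x ∈ Set.univ} = Metric.sphere 0 1 := by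
    ext x; simp
  rw [this]
  exact ENNReal.inv_mul_cancel (hausdorff_sphere_pos m).ne' (hausdorff_sphere_lt_top m).ne

lemma sphereUniform_restrict (d : ℕ) :
    (sphereUniform d).restrict (Metric.sphere (0 : EuclideanSpace ℝ (Fin d)) 1) =
      sphereUniform d := by
  rw [sphereUniform, Measure.restrict_smul, Measure.restrict_restrict Metric.isClosed_sphere.measurableSet,
    Set.inter_self]

lemma ae_norm_eq_one (d : ℕ) : ∀ᵐ x ∂sphereUniform d, ‖x‖ = 1 := by
  rw [← sphereUniform_restrict]
  filter_upwards [ae_restrict_mem Metric.isClosed_sphere.measurableSet] with x hx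
  simpa using hx

lemma measurePreserving_sphereUniform {d : ℕ}
    (T : EuclideanSpace ℝ (Fin d) ≃ₗᵢ[ℝ] EuclideanSpace ℝ (Fin d)) :
    MeasurePreserving T (sphereUniform d) (sphereUniform d) := by
  have h := T.toIsometryEquiv.measurePreserving_hausdorffMeasure ((d : ℝ) - 1)
  have h2 := h.restrict_preimage
    (s := Metric.sphere (0 : EuclideanSpace ℝ (Fin d)) 1) Metric.isClosed_sphere.measurableSet
  have e : T.toIsometryEquiv ⁻¹' (Metric.sphere (0 : EuclideanSpace ℝ (Fin d)) 1) =
      Metric.sphere 0 1 := by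
    ext x; simp
  rw [e] at h2
  exact h2.smul_measure _

lemma exists_linearIsometryEquiv_swap {V : Type*} [NormedAddCommGroup V] [InnerProductSpace ℝ V]
    {y z : V} (h : ‖y‖ = ‖z‖) :
    ∃ T : V ≃ₗᵢ[ℝ] V, T y = z ∧ T z = y ∧ (∀ x, T (T x) = x) ∧
      (∀ x, inner ℝ x y = inner ℝ x z → T x = x) ∧ (∀ x, inner ℝ (T x) y = inner ℝ x z) ∧
      (∀ x, inner ℝ (T x) z = inner ℝ x y) ∧
      ∀ x, ∃ c : ℝ, (inner ℝ x y ≤ inner ℝ x z → 0 ≤ c) ∧ T x = x + c • (y - z) := by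
  obtain ⟨T, hT⟩ : ∃ T : V ≃ₗᵢ[ℝ] V, T = (ℝ ∙ (y - z))ᗮ.reflection := ⟨_, rfl⟩
  have h1 : T y = z := hT ▸ Submodule.reflection_sub h
  have h2 : ∀ x, T (T x) = x := hT ▸ Submodule.reflection_reflection _
  have h3 : T z = y := by rw [← h1, h2]
  refine ⟨T, h1, h3, h2, fun x hx => ?_, fun x => ?_, fun x => ?_, fun x => ?_⟩
  · rw [hT]
    refine Submodule.reflection_mem_subspace_eq_self ?_
    rw [Submodule.mem_orthogonal_singleton_iff_inner_left, inner_sub_right, hx, sub_self]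
  · rw [← h3, LinearIsometryEquiv.inner_map_map]
  · rw [← h1, LinearIsometryEquiv.inner_map_map]
  · refine ⟨-(2 * (inner ℝ (y - z) x / ‖y - z‖ ^ 2)), fun hx => ?_, ?_⟩
    · rw [real_inner_comm, inner_sub_right, neg_nonneg]
      exact mul_nonpos_of_nonneg_of_nonpos zero_le_two
        (div_nonpos_of_nonpos_of_nonneg (by linarith) (by positivity))
    · rw [hT, Submodule.reflection_orthogonal_apply, Submodule.reflection_singleton_apply]
      simp only [RCLike.ofReal_real_eq_id, id_eq]
      module

lemma sphereUniform_cap_eq (m : ℕ) {y z : EuclideanSpace ℝ (Fin (m + 1))} (hyz : ‖y‖ = ‖z‖)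
    (r : ℝ) : sphereUniform (m + 1) {x | dist x y ≤ r} = sphereUniform (m + 1) {x | dist x z ≤ r} := by
  obtain ⟨T, hT, hT', -⟩ := exists_linearIsometryEquiv_swap hyz
  have hm : MeasurableSet {x : EuclideanSpace ℝ (Fin (m + 1)) | dist x z ≤ r} :=
    measurableSet_le (by fun_prop) (by fun_prop)
  rw [← (measurePreserving_sphereUniform T).measure_preimage hm.nullMeasurableSet]
  congr 1
  ext x
  simp [← hT]

lemma exists_sphereUniform_cap_bounds (m : ℕ) :
    ∃ c C : ℝ, 0 < c ∧ 0 < C ∧ ∀ y : EuclideanSpace ℝ (Fin (m + 1)), ‖y‖ = 1 →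
      (∀ r, 0 ≤ r → (sphereUniform (m + 1)).real {x | dist x y ≤ r} ≤ C * r ^ m) ∧
      (∀ r, 0 ≤ r → r ≤ 1 → c * r ^ m ≤ (sphereUniform (m + 1)).real {x | dist x y ≤ r}) := by
  obtain ⟨c, hc, h⟩ := exists_le_hausdorff_cap m
  obtain ⟨C, hC, h'⟩ := exists_hausdorff_cap_le m
  have hT0 := hausdorff_sphere_pos m
  have hT1 := hausdorff_sphere_lt_top m
  set T := μH[(m : ℝ)] (Metric.sphere (0 : EuclideanSpace ℝ (Fin (m + 1))) 1)
  have hTr : 0 < T.toReal := ENNReal.toReal_pos hT0.ne' hT1.ne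
  have hms : ∀ (y : EuclideanSpace ℝ (Fin (m + 1))) (r : ℝ), MeasurableSet {x | dist x y ≤ r} :=
    fun y r => measurableSet_le (by fun_prop) (by fun_prop)
  have he : ‖(EuclideanSpace.single 0 1 : EuclideanSpace ℝ (Fin (m + 1)))‖ = 1 := by simp
  refine ⟨T.toReal⁻¹ * c, T.toReal⁻¹ * C.toReal + 2 ^ m, by positivity, by positivity,
    fun y hy => ⟨fun r hr => ?_, fun r hr hr1 => ?_⟩⟩
  · rcases le_or_gt r (1 / 2) with hr2 | hr2
    · rw [measureReal_def, sphereUniform_cap_eq m (hy.trans he.symm),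
        sphereUniform_succ_apply m (hms _ _), ENNReal.toReal_mul, ENNReal.toReal_inv]
      have h1 := ENNReal.toReal_mono (ENNReal.mul_ne_top hC ENNReal.ofReal_ne_top) (h' r hr hr2)
      rw [ENNReal.toReal_mul, ENNReal.toReal_ofReal (by positivity)] at h1
      have h2 : 0 ≤ (2 : ℝ) ^ m * r ^ m := by positivity
      have := mul_le_mul_of_nonneg_left h1 (inv_nonneg.2 hTr.le)
      simp only [Set.mem_ofPred_eq]
      nlinarith
    · have h1 : (1 : ℝ) ≤ 2 ^ m * r ^ m := by
        rw [← mul_pow]; exact one_le_pow₀ (by linarith)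
      have h2 : 0 ≤ T.toReal⁻¹ * C.toReal * r ^ m := by positivity
      have := measureReal_le_one (μ := sphereUniform (m + 1)) (s := {x | dist x y ≤ r})
      nlinarith
  · rw [measureReal_def, sphereUniform_cap_eq m (hy.trans he.symm),
      sphereUniform_succ_apply m (hms _ _), ENNReal.toReal_mul, ENNReal.toReal_inv, mul_assoc]
    refine mul_le_mul_of_nonneg_left ?_ (inv_nonneg.2 hTr.le)
    refine (ENNReal.ofReal_le_iff_le_toReal ?_).1 (h r hr hr1)
    exact ((measure_mono (fun x hx => by simpa using hx.1)).trans_lt hT1).ne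

lemma exists_sphereUniform_slab_le (m : ℕ) (hm : 1 ≤ m) :
    ∃ C : ℝ, 0 < C ∧ ∀ y : EuclideanSpace ℝ (Fin (m + 1)), ‖y‖ = 1 →
      ∀ r, 0 ≤ r → (sphereUniform (m + 1)).real {v | |inner ℝ v y| ≤ r} ≤ C * r := by
  obtain ⟨C, hC, h'⟩ := exists_hausdorff_slab_le m hm
  have hT0 := hausdorff_sphere_pos m
  have hT1 := hausdorff_sphere_lt_top m
  set T := μH[(m : ℝ)] (Metric.sphere (0 : EuclideanSpace ℝ (Fin (m + 1))) 1)
  have hTr : 0 < T.toReal := ENNReal.toReal_pos hT0.ne' hT1.ne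
  have he : ‖(EuclideanSpace.single 0 1 : EuclideanSpace ℝ (Fin (m + 1)))‖ = 1 := by simp
  refine ⟨T.toReal⁻¹ * C.toReal + 1, by positivity, fun y hy r hr => ?_⟩
  have hms : MeasurableSet {v : EuclideanSpace ℝ (Fin (m + 1)) |
      |inner ℝ v (EuclideanSpace.single 0 1)| ≤ r} :=
    measurableSet_le (by fun_prop) (by fun_prop)
  obtain ⟨S, hS, -⟩ := exists_linearIsometryEquiv_swap (hy.trans he.symm)
  have hS'' : ∀ x, inner ℝ (S x) (EuclideanSpace.single 0 1) = inner ℝ x y := fun x => by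
    rw [← hS, LinearIsometryEquiv.inner_map_map]
  have e : {v : EuclideanSpace ℝ (Fin (m + 1)) | |inner ℝ v y| ≤ r} =
      S ⁻¹' {v | |inner ℝ v (EuclideanSpace.single 0 1)| ≤ r} := by
    ext v
    simp only [Set.mem_preimage, Set.mem_ofPred_eq, hS'']
  rw [e, measureReal_def, (measurePreserving_sphereUniform S).measure_preimage
    hms.nullMeasurableSet, sphereUniform_succ_apply m hms, ENNReal.toReal_mul, ENNReal.toReal_inv]
  have h1 := ENNReal.toReal_mono (ENNReal.mul_ne_top hC ENNReal.ofReal_ne_top) (h' r hr)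
  rw [ENNReal.toReal_mul, ENNReal.toReal_ofReal hr] at h1
  have := mul_le_mul_of_nonneg_left h1 (inv_nonneg.2 hTr.le)
  have e2 : ∀ x : EuclideanSpace ℝ (Fin (m + 1)), inner ℝ x (EuclideanSpace.single 0 1) = x 0 :=
    fun x => by simp [EuclideanSpace.inner_single_right]
  simp only [Set.mem_ofPred_eq, e2]
  nlinarith

lemma sphereUniform_pos_of_isOpen (m : ℕ) {U : Set (EuclideanSpace ℝ (Fin (m + 1)))}
    (hU : IsOpen U) {y : EuclideanSpace ℝ (Fin (m + 1))} (hy : ‖y‖ = 1) (hyU : y ∈ U) :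
    0 < sphereUniform (m + 1) U := by
  obtain ⟨c, C, hc, -, h⟩ := exists_sphereUniform_cap_bounds m
  obtain ⟨ε, hε, hb⟩ := Metric.isOpen_iff.1 hU y hyU
  have hr : 0 < min (ε / 2) 1 := by positivity
  have h1 := (h y hy).2 (min (ε / 2) 1) hr.le (min_le_right _ _)
  have h2 : 0 < (sphereUniform (m + 1)).real {x | dist x y ≤ min (ε / 2) 1} :=
    lt_of_lt_of_le (by positivity) h1
  refine lt_of_lt_of_le ((ENNReal.toReal_pos_iff.1 h2).1) (measure_mono fun x hx => hb ?_)
  rw [Set.mem_ofPred_eq] at hx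
  exact lt_of_le_of_lt (le_trans hx (min_le_left _ _)) (by linarith)

/-- A measure that is concentrated on a compact set. -/
class IsCompactlyCarried {X : Type*} [TopologicalSpace X] [MeasurableSpace X] (μ : Measure X) :
    Prop where
  exists_compact : ∃ K : Set X, IsCompact K ∧ μ.restrict K = μ

instance (m : ℕ) : IsCompactlyCarried (sphereUniform m) :=
  ⟨⟨_, isCompact_sphere _ _, sphereUniform_restrict _⟩⟩

instance (L : ℝ) : IsCompactlyCarried (unifIcc L) :=
  ⟨⟨Set.Icc (-L) L, isCompact_Icc, by
    rw [unifIcc, Measure.restrict_smul, Measure.restrict_restrict measurableSet_Icc,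
      Set.inter_self]⟩⟩

instance {X Y : Type*} [TopologicalSpace X] [MeasurableSpace X] [TopologicalSpace Y]
    [MeasurableSpace Y] (μ : Measure X) (ν : Measure Y) [IsProbabilityMeasure μ]
    [IsProbabilityMeasure ν]
    [hμ : IsCompactlyCarried μ] [hν : IsCompactlyCarried ν] : IsCompactlyCarried (μ.prod ν) := by
  obtain ⟨K, hK, hK'⟩ := hμ.exists_compact
  obtain ⟨K₂, hK₂, hK₂'⟩ := hν.exists_compact
  exact ⟨⟨K ×ˢ K₂, hK.prod hK₂, by rw [← Measure.prod_restrict, hK', hK₂']⟩⟩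

instance {X ι : Type*} [Fintype ι] [TopologicalSpace X] [MeasurableSpace X] (μ : Measure X)
    [IsProbabilityMeasure μ] [hμ : IsCompactlyCarried μ] :
    IsCompactlyCarried (Measure.pi fun _ : ι => μ) := by
  obtain ⟨K, hK, hK'⟩ := hμ.exists_compact
  exact ⟨⟨Set.univ.pi fun _ => K, isCompact_univ_pi fun _ => hK, by
    rw [Measure.restrict_pi_pi]; simp_rw [hK']⟩⟩

lemma Continuous.integrable_of_carried {X : Type*} [TopologicalSpace X] [MeasurableSpace X]
    [OpensMeasurableSpace X] [T2Space X] [TopologicalSpace.PseudoMetrizableSpace X] {μ : Measure X}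
    [IsFiniteMeasure μ] [hμ : IsCompactlyCarried μ] {f : X → ℝ} (hf : Continuous f) :
    Integrable f μ := by
  obtain ⟨K, hK, hK'⟩ := hμ.exists_compact
  rw [← hK']
  exact hf.continuousOn.integrableOn_compact' hK (hK.measurableSet)

lemma Continuous.integral_of_carried {X Y : Type*} [TopologicalSpace X] [TopologicalSpace Y]
    [MeasurableSpace Y] [OpensMeasurableSpace Y] [SecondCountableTopology Y]
    [FirstCountableTopology X] [LocallyCompactSpace X] {μ : Measure Y}
    [IsFiniteMeasure μ] [hμ : IsCompactlyCarried μ] {f : X → Y → ℝ}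
    (hf : Continuous (Function.uncurry f)) : Continuous fun x => ∫ y, f x y ∂μ := by
  obtain ⟨K, hK, hK'⟩ := hμ.exists_compact
  have := continuous_parametric_integral_of_continuous (μ := μ) hf hK
  rwa [hK'] at this

lemma isProbabilityMeasure_unifIcc {L : ℝ} (hL : 0 < L) : IsProbabilityMeasure (unifIcc L) := by
  constructor
  rw [unifIcc, Measure.smul_apply, Measure.restrict_apply_univ, Real.volume_Icc, smul_eq_mul,
    sub_neg_eq_add, ← two_mul]
  exact ENNReal.inv_mul_cancel (by simpa using hL) ENNReal.ofReal_ne_top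

lemma integral_unifIcc {L : ℝ} (hL : 0 < L) (f : ℝ → ℝ) :
    ∫ t, f t ∂unifIcc L = (2 * L)⁻¹ * ∫ t in (-L)..L, f t := by
  rw [unifIcc, integral_smul_measure, ENNReal.toReal_inv, ENNReal.toReal_ofReal (by positivity),
    intervalIntegral.integral_of_le (by linarith), integral_Icc_eq_integral_Ioc, smul_eq_mul]

lemma integral_id_unifIcc {L : ℝ} (hL : 0 < L) : ∫ t, t ∂unifIcc L = 0 := by
  rw [integral_unifIcc hL, integral_id]; ring

lemma integral_sq_unifIcc {L : ℝ} (hL : 0 < L) : ∫ t, t ^ 2 ∂unifIcc L = L ^ 2 / 3 := by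
  rw [integral_unifIcc hL, integral_pow]
  push_cast
  field_simp
  ring

section PiMoments

variable {X ι : Type*} [Fintype ι] [MeasurableSpace X] {ρ : Measure X} [IsProbabilityMeasure ρ]

lemma integral_pi_eval {g : X → ℝ} (hg : Integrable g ρ) (i : ι) :
    ∫ x, g (x i) ∂(Measure.pi fun _ : ι => ρ) = ∫ t, g t ∂ρ :=
  integral_comp_eval (μ := fun _ : ι => ρ) hg.1

lemma indepFun_pi_eval {g h : X → ℝ} (hg : Measurable g) (hh : Measurable h) {i j : ι}
    (hij : i ≠ j) :
    ProbabilityTheory.IndepFun (fun x : ι → X => g (x i)) (fun x => h (x j))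
      (Measure.pi fun _ => ρ) := by
  have := (ProbabilityTheory.iIndepFun_pi (μ := fun _ : ι => ρ) (X := fun _ => id)
    (fun _ => aemeasurable_id)).indepFun hij
  exact this.comp hg hh

lemma integrable_pi_eval_mul {g h : X → ℝ} (hg : Measurable g) (hh : Measurable h)
    (hgi : Integrable g ρ) (hhi : Integrable h ρ) (hgh : Integrable (fun t => g t * h t) ρ)
    (i j : ι) :
    Integrable (fun x : ι → X => g (x i) * h (x j)) (Measure.pi fun _ => ρ) := by
  by_cases hij : i = j
  · subst hij
    exact integrable_comp_eval (μ := fun _ : ι => ρ) hgh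
  · exact (indepFun_pi_eval hg hh hij).integrable_mul
      (integrable_comp_eval (μ := fun _ : ι => ρ) hgi)
      (integrable_comp_eval (μ := fun _ : ι => ρ) hhi)

lemma integral_pi_eval_mul [DecidableEq ι] {g h : X → ℝ} (hg : Measurable g) (hh : Measurable h)
    (hgi : Integrable g ρ) (hhi : Integrable h ρ) (hgh : Integrable (fun t => g t * h t) ρ)
    (i j : ι) :
    ∫ x : ι → X, g (x i) * h (x j) ∂(Measure.pi fun _ => ρ) =
      if i = j then ∫ t, g t * h t ∂ρ else (∫ t, g t ∂ρ) * ∫ t, h t ∂ρ := by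
  split_ifs with hij
  · subst hij
    exact integral_pi_eval hgh i
  · rw [(indepFun_pi_eval hg hh hij).integral_fun_mul_eq_mul_integral
      (integrable_comp_eval (μ := fun _ : ι => ρ) hgi).1
      (integrable_comp_eval (μ := fun _ : ι => ρ) hhi).1, integral_pi_eval hgi,
      integral_pi_eval hhi]

lemma integral_pi_sum_mul_sum {g h : X → ℝ} (hg : Measurable g) (hh : Measurable h)
    (hgi : Integrable g ρ) (hhi : Integrable h ρ) (hgh : Integrable (fun t => g t * h t) ρ) :
    ∫ x : ι → X, (∑ i, g (x i)) * (∑ i, h (x i)) ∂(Measure.pi fun _ => ρ) =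
      Fintype.card ι * (∫ t, g t * h t ∂ρ) +
        Fintype.card ι * (Fintype.card ι - 1) * ((∫ t, g t ∂ρ) * ∫ t, h t ∂ρ) := by
  classical
  simp_rw [Finset.sum_mul_sum]
  rw [integral_finsetSum _ fun i _ => integrable_finsetSum _ fun j _ =>
    integrable_pi_eval_mul hg hh hgi hhi hgh i j]
  simp_rw [integral_finsetSum _ fun j _ => integrable_pi_eval_mul hg hh hgi hhi hgh _ j,
    integral_pi_eval_mul hg hh hgi hhi hgh]
  set a := ∫ t, g t * h t ∂ρ
  set b := (∫ t, g t ∂ρ) * ∫ t, h t ∂ρ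
  have e : ∀ i j : ι, (if i = j then a else b) = (if i = j then a - b else 0) + b := by
    intro i j; split_ifs <;> ring
  simp only [e, Finset.sum_add_distrib, Finset.sum_ite_eq, Finset.mem_univ, if_true,
    Finset.sum_const, Finset.card_univ, nsmul_eq_mul]
  ring

/-- Bias–variance decomposition for a linear combination of centred i.i.d. noises. -/
lemma integral_pi_const_add_sum_sq {ν : Measure ℝ} [IsProbabilityMeasure ν]
    (h2 : Integrable (fun t : ℝ => t ^ 2) ν) (h0 : ∫ t, t ∂ν = 0) (c : ℝ) (p : ι → ℝ) :
    ∫ e : ι → ℝ, (c + ∑ i, p i * e i) ^ 2 ∂(Measure.pi fun _ => ν) =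
      c ^ 2 + (∫ t, t ^ 2 ∂ν) * ∑ i, p i ^ 2 := by
  classical
  have h1 : Integrable (fun t : ℝ => t) ν := by
    have : MemLp (fun t : ℝ => t) 2 ν := (memLp_two_iff_integrable_sq (by fun_prop)).2 h2
    exact this.integrable (by norm_num)
  have h2' : Integrable (fun t : ℝ => t * t) ν := by simpa [sq] using h2
  have hi : ∀ i, Integrable (fun e : ι → ℝ => e i) (Measure.pi fun _ => ν) := fun i =>
    integrable_comp_eval (μ := fun _ : ι => ν) (f := fun t => t) h1
  have hm := integrable_pi_eval_mul (ι := ι) measurable_id measurable_id h1 h1 h2'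
  have hE := integral_pi_eval_mul (ι := ι) measurable_id measurable_id h1 h1 h2'
  simp only [id] at hm hE
  have e : ∀ e : ι → ℝ, (c + ∑ i, p i * e i) ^ 2 =
      c ^ 2 + (2 * c * ∑ i, p i * e i + ∑ i, ∑ j, p i * p j * (e i * e j)) := by
    intro e
    have : (∑ i, p i * e i) ^ 2 = ∑ i, ∑ j, p i * p j * (e i * e j) := by
      rw [sq, Finset.sum_mul_sum]
      exact Finset.sum_congr rfl fun i _ => Finset.sum_congr rfl fun j _ => by ring
    rw [← this]; ring
  simp_rw [e]
  have i1 : Integrable (fun e : ι → ℝ => 2 * c * ∑ i, p i * e i) (Measure.pi fun _ => ν) :=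
    (integrable_finsetSum _ fun i _ => (hi i).const_mul _).const_mul _
  have i2 : ∀ i j, Integrable (fun e : ι → ℝ => p i * p j * (e i * e j))
    (Measure.pi fun _ => ν) := fun i j => (hm i j).const_mul _
  have i3 : Integrable (fun e : ι → ℝ => ∑ i, ∑ j, p i * p j * (e i * e j))
    (Measure.pi fun _ => ν) := integrable_finsetSum _ fun i _ => integrable_finsetSum _ fun j _ => i2 i j
  have i13 : Integrable (fun e : ι → ℝ =>
      2 * c * ∑ i, p i * e i + ∑ i, ∑ j, p i * p j * (e i * e j)) (Measure.pi fun _ => ν) :=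
    i1.add i3
  rw [integral_add (integrable_const _) i13, integral_add i1 i3, integral_const,
    integral_const_mul, integral_finsetSum _ fun i _ => (hi i).const_mul _,
    integral_finsetSum _ fun i _ => integrable_finsetSum _ fun j _ => i2 i j]
  simp_rw [integral_finsetSum _ fun j _ => i2 _ j, integral_const_mul, hE,
    integral_pi_eval (g := fun t : ℝ => t) h1, h0]
  simp [sq, mul_comm, Finset.sum_mul]
end PiMoments

section Attention

section SoftmaxWeight

variable {V ι : Type*} [NormedAddCommGroup V] [InnerProductSpace ℝ V] [Fintype ι]

/-- The softmax weight of the key `x i` for the query direction `u`. -/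
def softmaxWeight (u : V) (x : ι → V) (i : ι) : ℝ :=
  exp (inner ℝ (x i) u) / ∑ j, exp (inner ℝ (x j) u)

lemma sum_exp_pos [Nonempty ι] (f : ι → ℝ) : 0 < ∑ j, exp (f j) :=
  Finset.sum_pos (fun _ _ => exp_pos _) Finset.univ_nonempty

lemma sum_softmaxWeight [Nonempty ι] (u : V) (x : ι → V) : ∑ i, softmaxWeight u x i = 1 := by
  simp_rw [softmaxWeight, ← Finset.sum_div]
  exact div_self (sum_exp_pos _).ne'

lemma continuous_softmaxWeight [Nonempty ι] {Y : Type*} [TopologicalSpace Y] {u : Y → V}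
    {x : Y → ι → V} (hu : Continuous u) (hx : Continuous x) (i : ι) :
    Continuous fun y => softmaxWeight (u y) (x y) i := by
  have : ∀ i, Continuous fun y => x y i := fun i => (continuous_apply i).comp hx
  unfold softmaxWeight
  exact Continuous.div (by fun_prop) (by fun_prop) fun y => (sum_exp_pos _).ne.symm

/-- The prediction error of softmax attention on the function `t ↦ g (v ⬝ t)`. -/
def softmaxGap (g : ℝ → ℝ) (y u : V) (x : ι → V) (v : V) : ℝ :=
  ∑ i, softmaxWeight u x i * g (inner ℝ v (x i)) - g (inner ℝ v y)

/-- The sum of the squared prediction errors on the two ReLU branches. -/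
def reluGap (y u : V) (x : ι → V) (v : V) : ℝ :=
  softmaxGap (fun t => max t 0) y u x v ^ 2 + softmaxGap (fun t => max (-t) 0) y u x v ^ 2

lemma continuous_softmaxGap [Nonempty ι] {Y : Type*} [TopologicalSpace Y] {g : ℝ → ℝ}
    (hg : Continuous g) {y u v : Y → V} {x : Y → ι → V} (hy : Continuous y) (hu : Continuous u)
    (hx : Continuous x) (hv : Continuous v) :
    Continuous fun t => softmaxGap g (y t) (u t) (x t) (v t) := by
  have h1 : ∀ i, Continuous fun y => x y i := fun i => (continuous_apply i).comp hx
  have h2 := fun i => continuous_softmaxWeight hu hx i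
  unfold softmaxGap
  fun_prop

lemma continuous_reluGap [Nonempty ι] {Y : Type*} [TopologicalSpace Y]
    {y u v : Y → V} {x : Y → ι → V} (hy : Continuous y) (hu : Continuous u)
    (hx : Continuous x) (hv : Continuous v) :
    Continuous fun t => reluGap (y t) (u t) (x t) (v t) :=
  ((continuous_softmaxGap (by fun_prop) hy hu hx hv).pow 2).add
    ((continuous_softmaxGap (by fun_prop) hy hu hx hv).pow 2)

lemma reluGap_nonneg (y u : V) (x : ι → V) (v : V) : 0 ≤ reluGap y u x v := by
  unfold reluGap; positivity

end SoftmaxWeight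

/-- Expected squared ReLU prediction error at the query `y` with query direction `u`. -/
def attnBias (m n : ℕ) (y u : EuclideanSpace ℝ (Fin (m + 1))) : ℝ :=
  ∫ x : Fin n → EuclideanSpace ℝ (Fin (m + 1)),
    ∫ v, reluGap y u x v ∂sphereUniform (m + 1) ∂(Measure.pi fun _ => sphereUniform (m + 1))

/-- Expected sum of squared softmax weights with query direction `u`. -/
def attnNoise (m n : ℕ) (u : EuclideanSpace ℝ (Fin (m + 1))) : ℝ :=
  ∫ x : Fin n → EuclideanSpace ℝ (Fin (m + 1)),
    ∑ i, softmaxWeight u x i ^ 2 ∂(Measure.pi fun _ => sphereUniform (m + 1))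

/-- The conditional risk at the query `y` with query direction `u`. -/
def attnRisk (m n : ℕ) (κ s : ℝ) (y u : EuclideanSpace ℝ (Fin (m + 1))) : ℝ :=
  κ * attnBias m n y u + s * attnNoise m n u

variable {m n : ℕ}

local notation "𝔼" => EuclideanSpace ℝ (Fin (m + 1))

lemma continuous_attnBias [NeZero n] {Y : Type*} [TopologicalSpace Y] [FirstCountableTopology Y]
    [LocallyCompactSpace Y] {y u : Y → 𝔼} (hy : Continuous y) (hu : Continuous u) :
    Continuous fun t => attnBias m n (y t) (u t) := by
  refine Continuous.integral_of_carried (f := fun t (x : Fin n → 𝔼) =>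
    ∫ v, reluGap (y t) (u t) x v ∂sphereUniform (m + 1)) ?_
  refine Continuous.integral_of_carried (f := fun (p : Y × (Fin n → 𝔼)) (v : 𝔼) =>
    reluGap (y p.1) (u p.1) p.2 v) ?_
  exact continuous_reluGap (by fun_prop) (by fun_prop) (by fun_prop) (by fun_prop)

lemma continuous_attnNoise [NeZero n] {Y : Type*} [TopologicalSpace Y] [FirstCountableTopology Y]
    [LocallyCompactSpace Y] {u : Y → 𝔼} (hu : Continuous u) :
    Continuous fun t => attnNoise m n (u t) := by
  refine Continuous.integral_of_carried (f := fun t (x : Fin n → 𝔼) =>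
    ∑ i, softmaxWeight (u t) x i ^ 2) ?_
  exact continuous_finsetSum _ fun i _ =>
    (continuous_softmaxWeight (by fun_prop) (by fun_prop) i).pow 2

lemma continuous_attnRisk [NeZero n] {Y : Type*} [TopologicalSpace Y] [FirstCountableTopology Y]
    [LocallyCompactSpace Y] (κ s : ℝ) {y u : Y → 𝔼} (hy : Continuous y) (hu : Continuous u) :
    Continuous fun t => attnRisk m n κ s (y t) (u t) :=
  ((continuous_attnBias hy hu).const_mul _).add ((continuous_attnNoise hu).const_mul _)

lemma sum_mul_eq_inner {d : ℕ} (v x : EuclideanSpace ℝ (Fin d)) :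
    ∑ a, v a * x a = inner ℝ v x := by
  simp [PiLp.inner_apply, mul_comm]

lemma quadForm_eq_inner {d : ℕ} (M : Matrix (Fin d) (Fin d) ℝ) (x y : EuclideanSpace ℝ (Fin d)) :
    quadForm M x y = inner ℝ x (M.toEuclideanLin y) := by
  rw [← sum_mul_eq_inner]
  simp [quadForm, Matrix.toLpLin_apply, Matrix.mulVec, dotProduct, Finset.mul_sum, mul_assoc]

lemma integral_reluTask_sq {L : ℝ} (hL : 0 < L) {f g : 𝔼 → ℝ} (hf : Continuous f)
    (hg : Continuous g) :
    ∫ θ, (θ.2.1 * f θ.1 + θ.2.2.1 * g θ.1) ^ 2 ∂reluTask (m + 1) L =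
      L ^ 2 / 3 * ∫ v, (f v ^ 2 + g v ^ 2) ∂sphereUniform (m + 1) := by
  have := isProbabilityMeasure_unifIcc hL
  rw [reluTask, integral_prod _ (Continuous.integrable_of_carried (by fun_prop)),
    ← integral_const_mul]
  refine integral_congr_ae (Filter.Eventually.of_forall fun v => ?_)
  dsimp only
  rw [integral_prod _ (Continuous.integrable_of_carried (by fun_prop))]
  dsimp only
  have h1 : ∀ a : ℝ, ∫ z : ℝ × ℝ, (a * f v + z.1 * g v) ^ 2 ∂(unifIcc L).prod (unifIcc L) =
      a ^ 2 * f v ^ 2 + L ^ 2 / 3 * g v ^ 2 := by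
    intro a
    rw [integral_prod _ (Continuous.integrable_of_carried (by fun_prop))]
    have e : ∀ t : ℝ, (a * f v + t * g v) ^ 2 =
        a ^ 2 * f v ^ 2 + (2 * a * f v * g v * t + g v ^ 2 * t ^ 2) := fun t => by ring
    simp only [e]
    have e3 : ∀ t : ℝ, ∫ z : ℝ, (a ^ 2 * f v ^ 2 + (2 * a * f v * g v * t + g v ^ 2 * t ^ 2))
        ∂unifIcc L = a ^ 2 * f v ^ 2 + (2 * a * f v * g v * t + g v ^ 2 * t ^ 2) := by simp
    simp_rw [e3]
    rw [integral_add (Continuous.integrable_of_carried (by fun_prop))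
      (Continuous.integrable_of_carried (by fun_prop)),
      integral_add (Continuous.integrable_of_carried (by fun_prop))
      (Continuous.integrable_of_carried (by fun_prop)), integral_const, integral_const_mul,
      integral_const_mul,
      integral_id_unifIcc hL, integral_sq_unifIcc hL]
    simp [mul_comm]
  simp_rw [h1]
  rw [integral_add (Continuous.integrable_of_carried (by fun_prop))
      (Continuous.integrable_of_carried (by fun_prop)), integral_mul_const,
      integral_sq_unifIcc hL]
  simp
  ring

/-- The pretraining loss is the average of the conditional risk over the query. -/
lemma iclLoss_eq_integral_attnRisk [NeZero n] {L : ℝ} (hL : 0 < L) {ν : Measure ℝ}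
    [IsProbabilityMeasure ν] (h2 : Integrable (fun t : ℝ => t ^ 2) ν) (h0 : ∫ t, t ∂ν = 0)
    (M : Matrix (Fin (m + 1)) (Fin (m + 1)) ℝ) :
    iclLoss (m + 1) n (reluTask (m + 1) L) ν reluF M =
      ∫ y, attnRisk m n (L ^ 2 / 3) (∫ t, t ^ 2 ∂ν) y (M.toEuclideanLin y)
        ∂sphereUniform (m + 1) := by
  have := isProbabilityMeasure_unifIcc hL
  have hM : Continuous M.toEuclideanLin := LinearMap.continuous_of_finiteDimensional _
  set s := ∫ t, t ^ 2 ∂ν with hs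
  have hpi : IsProbabilityMeasure (reluTask (m + 1) L) := by unfold reluTask; infer_instance
  have hpc : IsCompactlyCarried (reluTask (m + 1) L) := by unfold reluTask; infer_instance
  let G : (𝔼 × ℝ × ℝ × ℝ) → (Fin (n + 1) → 𝔼) → ℝ := fun θ x =>
    (θ.2.1 * softmaxGap (fun t => max t 0) (x (Fin.last n)) (M.toEuclideanLin (x (Fin.last n)))
        (fun i : Fin n => x i.castSucc) θ.1 +
      θ.2.2.1 * softmaxGap (fun t => max (-t) 0) (x (Fin.last n))
        (M.toEuclideanLin (x (Fin.last n))) (fun i : Fin n => x i.castSucc) θ.1) ^ 2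
  let N : (Fin (n + 1) → 𝔼) → ℝ := fun x => ∑ i, softmaxWeight (M.toEuclideanLin (x (Fin.last n)))
        (fun i : Fin n => x i.castSucc) i ^ 2
  have h1 : ∀ θ x, ∫ e : Fin n → ℝ,
      (softmaxPred M x (fun i => reluF θ (x i.castSucc) + e i) - reluF θ (x (Fin.last n))) ^ 2
        ∂(Measure.pi fun _ : Fin n => ν) = G θ x + s * N x := by
    intro θ x
    rw [← integral_pi_const_add_sum_sq h2 h0]
    refine integral_congr_ae (Filter.Eventually.of_forall fun e => ?_)
    dsimp only
    congr 1
    have hsum := sum_softmaxWeight (M.toEuclideanLin (x (Fin.last n)))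
        (fun i : Fin n => x i.castSucc)
    have e1 : softmaxPred M x (fun i => reluF θ (x i.castSucc) + e i) =
        ∑ i, softmaxWeight (M.toEuclideanLin (x (Fin.last n)))
        (fun i : Fin n => x i.castSucc) i * (reluF θ (x i.castSucc) + e i) := by
      simp only [softmaxPred, softmaxWeight, quadForm_eq_inner]
      rw [Finset.sum_div]
      exact Finset.sum_congr rfl fun i _ => by ring
    rw [e1]
    set p := softmaxWeight (M.toEuclideanLin (x (Fin.last n))) (fun i : Fin n => x i.castSucc)
    have e2 : ∑ i, p i * (reluF θ (x i.castSucc) + e i) =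
      θ.2.1 * ∑ i, p i * max (inner ℝ θ.1 (x i.castSucc)) 0 +
        θ.2.2.1 * ∑ i, p i * max (-inner ℝ θ.1 (x i.castSucc)) 0 + θ.2.2.2 * ∑ i, p i +
          ∑ i, p i * e i := by
      simp only [reluF, sum_mul_eq_inner θ.1]
      simp only [Finset.mul_sum, ← Finset.sum_add_distrib]
      exact Finset.sum_congr rfl fun i _ => by ring
    rw [e2, hsum]
    simp only [reluF, sum_mul_eq_inner, softmaxGap]
    ring
  have hGc : Continuous (Function.uncurry G) := by
    have hx : Continuous fun t : (𝔼 × ℝ × ℝ × ℝ) × (Fin (n + 1) → 𝔼) =>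
      fun i : Fin n => t.2 i.castSucc := by fun_prop
    have c1 := fun (g : ℝ → ℝ) (hg : Continuous g) =>
      continuous_softmaxGap hg (y := fun t : (𝔼 × ℝ × ℝ × ℝ) × (Fin (n + 1) → 𝔼) =>
        t.2 (Fin.last n)) (u := fun t => M.toEuclideanLin (t.2 (Fin.last n)))
        (x := fun t => fun i : Fin n => t.2 i.castSucc) (v := fun t => t.1.1)
        (by fun_prop) (by fun_prop) hx (by fun_prop)
    have c2 := c1 (fun t => max t 0) (by fun_prop)
    have c3 := c1 (fun t => max (-t) 0) (by fun_prop)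
    simp only [Function.uncurry_def, G]
    fun_prop
  have hNc : Continuous N := continuous_finsetSum _ fun i _ =>
    (continuous_softmaxWeight (by fun_prop) (by fun_prop) i).pow 2
  have hGN : Continuous (Function.uncurry fun θ x => G θ x + s * N x) :=
    hGc.add (continuous_const.mul (hNc.comp continuous_snd))
  unfold iclLoss
  simp_rw [h1]
  rw [integral_integral_swap hGN.integrable_of_carried]
  have h3 : ∀ x : Fin (n + 1) → 𝔼, ∫ θ, (G θ x + s * N x) ∂reluTask (m + 1) L =
      L ^ 2 / 3 * (∫ v, reluGap (x (Fin.last n)) (M.toEuclideanLin (x (Fin.last n)))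
        (fun i : Fin n => x i.castSucc) v ∂sphereUniform (m + 1)) + s * N x := by
    intro x
    have hGx : Integrable (fun θ => G θ x) (reluTask (m + 1) L) :=
      Continuous.integrable_of_carried (hGc.comp (continuous_id.prodMk continuous_const))
    rw [integral_add hGx (integrable_const _)]
    congr 1
    · exact integral_reluTask_sq hL
        (continuous_softmaxGap (by fun_prop) (by fun_prop) (by fun_prop) (by fun_prop) (by fun_prop))
        (continuous_softmaxGap (by fun_prop) (by fun_prop) (by fun_prop) (by fun_prop) (by fun_prop))
    · simp
  simp_rw [h3]
  let Φ : 𝔼 × (Fin n → 𝔼) → ℝ := fun q =>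
    L ^ 2 / 3 * (∫ v, reluGap q.1 (M.toEuclideanLin q.1) q.2 v ∂sphereUniform (m + 1)) +
      s * ∑ i, softmaxWeight (M.toEuclideanLin q.1) q.2 i ^ 2
  have hB : Continuous fun q : 𝔼 × (Fin n → 𝔼) =>
      ∫ v, reluGap q.1 (M.toEuclideanLin q.1) q.2 v ∂sphereUniform (m + 1) :=
    Continuous.integral_of_carried (f := fun (q : 𝔼 × (Fin n → 𝔼)) v =>
      reluGap q.1 (M.toEuclideanLin q.1) q.2 v)
      (continuous_reluGap (by fun_prop) (by fun_prop) (by fun_prop) (by fun_prop))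
  have hN : Continuous fun q : 𝔼 × (Fin n → 𝔼) =>
      ∑ i, softmaxWeight (M.toEuclideanLin q.1) q.2 i ^ 2 :=
    continuous_finsetSum _ fun i _ =>
      (continuous_softmaxWeight (by fun_prop) (by fun_prop) i).pow 2
  have hΦ : Continuous Φ := (hB.const_mul _).add (hN.const_mul _)
  have h4 := (measurePreserving_piFinSuccAbove (α := fun _ => 𝔼) (fun _ : Fin (n + 1) => sphereUniform (m + 1))
    (Fin.last n)).integral_comp' Φ
  have h5 : ∀ x : Fin (n + 1) → 𝔼,
      Φ (MeasurableEquiv.piFinSuccAbove (fun _ => 𝔼) (Fin.last n) x) =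
      L ^ 2 / 3 * (∫ v, reluGap (x (Fin.last n)) (M.toEuclideanLin (x (Fin.last n)))
        (fun i : Fin n => x i.castSucc) v ∂sphereUniform (m + 1)) + s * N x := by
    intro x
    have e : MeasurableEquiv.piFinSuccAbove (fun _ => 𝔼) (Fin.last n) x =
      (x (Fin.last n), fun i : Fin n => x i.castSucc) := by
      ext1
      · rfl
      · funext i; simp [MeasurableEquiv.piFinSuccAbove, Fin.insertNthEquiv, Fin.init]
    rw [e]
  simp_rw [h5] at h4
  rw [h4, integral_prod _ hΦ.integrable_of_carried]
  refine integral_congr_ae (Filter.Eventually.of_forall fun y => ?_)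
  simp only [Φ, attnRisk, attnBias, attnNoise]
  rw [integral_add, integral_const_mul, integral_const_mul]
  · exact Continuous.integrable_of_carried
      ((hB.comp (continuous_const.prodMk continuous_id)).const_mul _)
  · exact Continuous.integrable_of_carried
      ((hN.comp (continuous_const.prodMk continuous_id)).const_mul _)

section Support

open Topology

lemma integral_pos_of_mem_support {X : Type*} [TopologicalSpace X] [MeasurableSpace X]
    {ρ : Measure X} {f : X → ℝ} (hf : Continuous f) (hi : Integrable f ρ) (h0 : 0 ≤ᵐ[ρ] f) {a : X}
    (ha : a ∈ ρ.support) (hpos : 0 < f a) : 0 < ∫ x, f x ∂ρ := by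
  rw [integral_pos_iff_support_of_nonneg_ae h0 hi]
  exact (Measure.mem_support_iff_forall a).1 ha _
    (hf.isOpen_support.mem_nhds (Function.mem_support.2 hpos.ne'))

lemma mem_support_sphereUniform {y : 𝔼} (hy : ‖y‖ = 1) :
    y ∈ (sphereUniform (m + 1)).support := by
  refine (Measure.mem_support_iff_forall y).2 fun U hU => ?_
  obtain ⟨V, hVU, hV, hyV⟩ := mem_nhds_iff.1 hU
  exact (sphereUniform_pos_of_isOpen m hV hy hyV).trans_le (measure_mono hVU)

lemma mem_support_pi {X ι : Type*} [Fintype ι] [TopologicalSpace X] [MeasurableSpace X]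
    {ρ : Measure X} [SigmaFinite ρ] {a : ι → X} (ha : ∀ i, a i ∈ ρ.support) :
    a ∈ (Measure.pi fun _ : ι => ρ).support := by
  refine (Measure.mem_support_iff_forall a).2 fun U hU => ?_
  rw [nhds_pi, Filter.mem_pi'] at hU
  obtain ⟨I, t, ht, hU⟩ := hU
  refine lt_of_lt_of_le ?_ (measure_mono ((Set.pi_mono' (fun _ _ => subset_rfl)
    (Set.subset_univ _)).trans hU))
  rw [Measure.pi_pi]
  exact CanonicallyOrderedAdd.prod_pos.2 fun i _ =>
    (Measure.mem_support_iff_forall _).1 (ha i) _ (ht i)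

end Support

lemma max_mul_zero_eq (a b : ℝ) :
    max (a * b) 0 = max a 0 * max b 0 + max (-a) 0 * max (-b) 0 := by
  rcases le_total a 0 with ha | ha <;> rcases le_total b 0 with hb | hb <;>
    simp [ha, hb, mul_nonneg_of_nonpos_of_nonpos, mul_nonneg, mul_nonpos_of_nonpos_of_nonneg,
      mul_nonpos_of_nonneg_of_nonpos]

lemma max_mul_zero_supermodular {p q a b : ℝ} (h : 0 ≤ (p - q) * (a - b)) :
    0 ≤ max (p * a) 0 - max (p * b) 0 + max (q * b) 0 - max (q * a) 0 := by
  have e : max (p * a) 0 - max (p * b) 0 + max (q * b) 0 - max (q * a) 0 =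
      (max p 0 - max q 0) * (max a 0 - max b 0) +
        (max (-p) 0 - max (-q) 0) * (max (-a) 0 - max (-b) 0) := by
    simp only [max_mul_zero_eq]; ring
  rw [e]
  have key : ∀ {p q a b : ℝ}, q ≤ p → b ≤ a → 0 ≤ (max p 0 - max q 0) * (max a 0 - max b 0) +
        (max (-p) 0 - max (-q) 0) * (max (-a) 0 - max (-b) 0) := by
    intro p q a b h1 h2
    refine add_nonneg (mul_nonneg ?_ ?_) (mul_nonneg_of_nonpos_of_nonpos ?_ ?_)
    · exact sub_nonneg.2 (max_le_max_right 0 h1)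
    · exact sub_nonneg.2 (max_le_max_right 0 h2)
    · exact sub_nonpos.2 (max_le_max_right 0 (neg_le_neg h1))
    · exact sub_nonpos.2 (max_le_max_right 0 (neg_le_neg h2))
  rcases lt_trichotomy a b with hab | hab | hab
  · have hpq : p ≤ q := by nlinarith
    have := key hpq hab.le
    linarith
  · simp [hab]
  · exact key (by nlinarith) hab.le

/-- The degree one arc-cosine type kernel generated by the two ReLU branches. -/
def reluKer (m : ℕ) (x y : EuclideanSpace ℝ (Fin (m + 1))) : ℝ :=
  ∫ v, max (inner ℝ v x * inner ℝ v y) 0 ∂sphereUniform (m + 1)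

lemma continuous_reluKer_left (y : 𝔼) : Continuous fun x => reluKer m x y :=
  Continuous.integral_of_carried (f := fun (x : 𝔼) (v : 𝔼) =>
    max (inner ℝ v x * inner ℝ v y) 0) (by fun_prop)

lemma reluKer_map (T : 𝔼 ≃ₗᵢ[ℝ] 𝔼) (x y : 𝔼) : reluKer m (T x) (T y) = reluKer m x y := by
  rw [reluKer, ← (measurePreserving_sphereUniform T).integral_comp
    T.toHomeomorph.measurableEmbedding]
  simp [reluKer]

lemma reluKer_mono {x y z : 𝔼} (h : ‖y‖ = ‖z‖) (hx : inner ℝ x y ≤ (inner ℝ x z : ℝ)) :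
    reluKer m x y ≤ reluKer m x z := by
  obtain ⟨T, hy, hz, hT, -, -, -, hc⟩ := exists_linearIsometryEquiv_swap h
  obtain ⟨c, hc0, hc⟩ := hc x
  have e1 : reluKer m (T x) z = reluKer m x y := by rw [← hy, reluKer_map]
  have e2 : reluKer m (T x) y = reluKer m x z := by rw [← hz, reluKer_map]
  have i : ∀ x y : 𝔼, Integrable (fun v => max (inner ℝ v x * inner ℝ v y) 0)
      (sphereUniform (m + 1)) := fun x y => Continuous.integrable_of_carried (by fun_prop)
  have e3 : reluKer m x z - reluKer m x y + reluKer m (T x) y - reluKer m (T x) z =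
      ∫ v, (max (inner ℝ v x * inner ℝ v z) 0 - max (inner ℝ v x * inner ℝ v y) 0 +
        max (inner ℝ v (T x) * inner ℝ v y) 0 - max (inner ℝ v (T x) * inner ℝ v z) 0)
          ∂sphereUniform (m + 1) := by
    rw [integral_sub (Continuous.integrable_of_carried (by fun_prop)) (i (T x) z),
      integral_add (Continuous.integrable_of_carried (by fun_prop)) (i (T x) y),
      integral_sub (i x z) (i x y)]
    rfl
  have e4 : 0 ≤ reluKer m x z - reluKer m x y + reluKer m (T x) y - reluKer m (T x) z := by
    rw [e3]
    refine integral_nonneg fun v => max_mul_zero_supermodular ?_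
    rw [hc, inner_add_right, inner_smul_right, inner_sub_right]
    have := mul_nonneg (hc0 hx) (sq_nonneg (inner ℝ v z - inner ℝ v y : ℝ))
    nlinarith
  linarith

lemma integral_inner_sq_eq {y z : 𝔼} (h : ‖y‖ = ‖z‖) :
    ∫ v, inner ℝ v y ^ 2 ∂sphereUniform (m + 1) =
      ∫ v, inner ℝ v z ^ 2 ∂sphereUniform (m + 1) := by
  obtain ⟨T, hy, -⟩ := exists_linearIsometryEquiv_swap h
  rw [← hy, ← (measurePreserving_sphereUniform T).integral_comp
    T.toHomeomorph.measurableEmbedding (fun v => inner ℝ v (T y) ^ 2)]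
  simp only [LinearIsometryEquiv.inner_map_map]

lemma reluKer_lt_self {y z : 𝔼} (hy : ‖y‖ = 1) (hz : ‖z‖ = 1) (hyz : y ≠ z) :
    reluKer m z y < reluKer m z z := by
  have i : ∀ x y : 𝔼, Integrable (fun v => max (inner ℝ v x * inner ℝ v y) 0)
      (sphereUniform (m + 1)) := fun x y => Continuous.integrable_of_carried (by fun_prop)
  have i2 : ∀ x : 𝔼, Integrable (fun v => inner ℝ v x ^ 2)
      (sphereUniform (m + 1)) := fun x => Continuous.integrable_of_carried (by fun_prop)
  have h1 : 0 < ∫ v, ((inner ℝ v z ^ 2 + inner ℝ v y ^ 2) -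
      2 * max (inner ℝ v z * inner ℝ v y) 0) ∂sphereUniform (m + 1) := by
    refine integral_pos_of_mem_support (by fun_prop)
      (((i2 z).add (i2 y)).sub ((i z y).const_mul 2))
      (Filter.Eventually.of_forall fun v => ?_) (mem_support_sphereUniform hz) ?_
    · have : max (inner ℝ v z * inner ℝ v y : ℝ) 0 ≤ (inner ℝ v z ^ 2 + inner ℝ v y ^ 2) / 2 :=
        max_le (by nlinarith [sq_nonneg (inner ℝ v z - inner ℝ v y : ℝ)]) (by positivity)
      simp only [Pi.zero_apply]
      linarith
    · have hne : inner ℝ z y ≠ (1 : ℝ) := fun h =>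
        hyz ((inner_eq_one_iff_of_norm_eq_one hz hy).1 h).symm
      have hp := sq_pos_of_ne_zero (sub_ne_zero.2 hne)
      have hzz : inner ℝ z z = (1 : ℝ) := by rw [real_inner_self_eq_norm_sq, hz]; norm_num
      rw [hzz]
      have : max (1 * inner ℝ z y : ℝ) 0 < (1 ^ 2 + inner ℝ z y ^ 2) / 2 :=
        max_lt (by nlinarith) (by positivity)
      linarith
  rw [integral_sub (Continuous.integrable_of_carried (by fun_prop)) ((i z y).const_mul 2), integral_const_mul,
    integral_add (i2 z) (i2 y), integral_inner_sq_eq (hy.trans hz.symm)] at h1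
  have h2 : reluKer m z z = ∫ v, inner ℝ v z ^ 2 ∂sphereUniform (m + 1) := by
    refine integral_congr_ae (Filter.Eventually.of_forall fun v => ?_)
    dsimp only
    rw [max_eq_left (mul_self_nonneg _), sq]
  rw [h2]
  change 0 < _ - 2 * reluKer m z y at h1
  linarith

lemma reluGap_sub_reluGap {V ι : Type*} [NormedAddCommGroup V] [InnerProductSpace ℝ V] [Fintype ι]
    (y z u : V) (x : ι → V) (v : V) :
    reluGap y u x v - reluGap z u x v =
      2 * ∑ i, softmaxWeight u x i * (max (inner ℝ v (x i) * inner ℝ v z) 0 -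
        max (inner ℝ v (x i) * inner ℝ v y) 0) + (inner ℝ v y ^ 2 - inner ℝ v z ^ 2) := by
  have e : ∀ w : V, reluGap w u x v =
      (∑ i, softmaxWeight u x i * max (inner ℝ v (x i)) 0) ^ 2 +
      (∑ i, softmaxWeight u x i * max (-inner ℝ v (x i)) 0) ^ 2 -
      2 * ∑ i, softmaxWeight u x i * max (inner ℝ v (x i) * inner ℝ v w) 0 +
      inner ℝ v w ^ 2 := by
    intro w
    have e1 : (inner ℝ v w : ℝ) ^ 2 = max (inner ℝ v w) 0 ^ 2 + max (-inner ℝ v w) 0 ^ 2 := by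
      rcases le_total (inner ℝ v w : ℝ) 0 with h | h <;> simp [h]
    have e2 : ∑ i, softmaxWeight u x i * max (inner ℝ v (x i) * inner ℝ v w) 0 =
        (∑ i, softmaxWeight u x i * max (inner ℝ v (x i)) 0) * max (inner ℝ v w) 0 +
        (∑ i, softmaxWeight u x i * max (-inner ℝ v (x i)) 0) * max (-inner ℝ v w) 0 := by
      simp only [max_mul_zero_eq, Finset.sum_mul, ← Finset.sum_add_distrib]
      exact Finset.sum_congr rfl fun i _ => by ring
    rw [e1, e2, reluGap, softmaxGap, softmaxGap]
    ring
  rw [e, e]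
  simp only [mul_sub, Finset.sum_sub_distrib]
  ring

lemma integral_reluGap_sub {ι : Type*} [Fintype ι] [Nonempty ι] {y z : 𝔼} (h : ‖y‖ = ‖z‖) (u : 𝔼)
    (x : ι → 𝔼) :
    ∫ v, reluGap y u x v ∂sphereUniform (m + 1) - ∫ v, reluGap z u x v ∂sphereUniform (m + 1) =
      2 * ∑ i, softmaxWeight u x i * (reluKer m (x i) z - reluKer m (x i) y) := by
  have i1 : ∀ y : 𝔼, Integrable (fun v => reluGap y u x v) (sphereUniform (m + 1)) := fun y =>
    Continuous.integrable_of_carried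
      (continuous_reluGap (by fun_prop) (by fun_prop) (by fun_prop) (by fun_prop))
  have i2 : ∀ x y : 𝔼, Integrable (fun v => max (inner ℝ v x * inner ℝ v y) 0)
      (sphereUniform (m + 1)) := fun x y => Continuous.integrable_of_carried (by fun_prop)
  have i3 : ∀ x : 𝔼, Integrable (fun v => inner ℝ v x ^ 2)
      (sphereUniform (m + 1)) := fun x => Continuous.integrable_of_carried (by fun_prop)
  have i4 : ∀ i, Integrable (fun v => softmaxWeight u x i *
      (max (inner ℝ v (x i) * inner ℝ v z) 0 - max (inner ℝ v (x i) * inner ℝ v y) 0))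
      (sphereUniform (m + 1)) := fun i => ((i2 _ _).sub (i2 _ _)).const_mul _
  have i5 : Integrable (fun v => 2 * ∑ i, softmaxWeight u x i *
      (max (inner ℝ v (x i) * inner ℝ v z) 0 - max (inner ℝ v (x i) * inner ℝ v y) 0))
      (sphereUniform (m + 1)) := (integrable_finsetSum _ fun i _ => i4 i).const_mul 2
  have i6 : Integrable (fun v => inner ℝ v y ^ 2 - inner ℝ v z ^ 2)
      (sphereUniform (m + 1)) := (i3 y).sub (i3 z)
  rw [← integral_sub (i1 y) (i1 z)]
  simp_rw [reluGap_sub_reluGap]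
  rw [integral_add i5 i6, integral_sub (i3 y) (i3 z), integral_inner_sq_eq h, sub_self, add_zero,
    integral_const_mul, integral_finsetSum _ fun i _ => i4 i]
  congr 1
  refine Finset.sum_congr rfl fun i _ => ?_
  rw [integral_const_mul, integral_sub (i2 _ _) (i2 _ _)]
  rfl

lemma continuous_weight_mul_reluKer [NeZero n] (y z u : 𝔼) (i : Fin n) :
    Continuous fun x : Fin n → 𝔼 => softmaxWeight u x i *
        (reluKer m (x i) z - reluKer m (x i) y) :=
  (continuous_softmaxWeight continuous_const continuous_id i).mul
    (((continuous_reluKer_left z).comp (continuous_apply i)).sub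
      ((continuous_reluKer_left y).comp (continuous_apply i)))

lemma attnBias_sub_attnBias [NeZero n] {y z : 𝔼} (h : ‖y‖ = ‖z‖) (u : 𝔼) :
    attnBias m n y u - attnBias m n z u =
      2 * ∑ i, ∫ x : Fin n → 𝔼, softmaxWeight u x i *
        (reluKer m (x i) z - reluKer m (x i) y) ∂(Measure.pi fun _ => sphereUniform (m + 1)) := by
  have c2 : ∀ y : 𝔼, Continuous fun x : Fin n → 𝔼 =>
      ∫ v, reluGap y u x v ∂sphereUniform (m + 1) := fun y =>
    Continuous.integral_of_carried (f := fun x v => reluGap y u x v)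
      (continuous_reluGap (by fun_prop) (by fun_prop) (by fun_prop) (by fun_prop))
  rw [attnBias, attnBias, ← integral_sub (c2 y).integrable_of_carried
    (c2 z).integrable_of_carried, ← integral_finsetSum _ fun i _ =>
      (continuous_weight_mul_reluKer y z u i).integrable_of_carried, ← integral_const_mul]
  simp_rw [integral_reluGap_sub h]

/-- Reflecting a single context point towards the query direction decreases the risk. -/
lemma integral_weight_mul_reluKer_pos [NeZero n] (hn : 2 ≤ n) {y z : 𝔼} (hy : ‖y‖ = 1) (hz : ‖z‖ = 1)
    (hyz : y ≠ z) {r : ℝ} (hr : 0 < r) (i : Fin n) :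
    0 < ∫ x : Fin n → 𝔼, softmaxWeight (r • z) x i *
        (reluKer m (x i) z - reluKer m (x i) y) ∂(Measure.pi fun _ => sphereUniform (m + 1)) := by
  obtain ⟨T, hTy, hTz, hT, -, hTy', hTz', -⟩ := exists_linearIsometryEquiv_swap (hy.trans hz.symm)
  let R : (Fin n → 𝔼) ≃ₜ (Fin n → 𝔼) :=
    Homeomorph.piCongrRight fun j => if j = i then T.toHomeomorph else Homeomorph.refl 𝔼
  have hR : MeasurePreserving R (Measure.pi fun _ : Fin n => sphereUniform (m + 1))
      (Measure.pi fun _ => sphereUniform (m + 1)) := by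
    refine measurePreserving_pi (fun _ : Fin n => sphereUniform (m + 1))
      (fun _ => sphereUniform (m + 1))
      (f := fun j => ⇑(if j = i then T.toHomeomorph else Homeomorph.refl 𝔼)) fun j => ?_
    split_ifs
    · exact measurePreserving_sphereUniform T
    · exact MeasurePreserving.id _
  have hRi : ∀ x, R x i = T (x i) := fun x => by simp [R]
  have hRj : ∀ x j, j ≠ i → R x j = x j := fun x j hj => by simp [R, hj]
  have hc := continuous_weight_mul_reluKer y z (r • z) i
  have hcR : Continuous fun x => softmaxWeight (r • z) (R x) i *
      (reluKer m (R x i) z - reluKer m (R x i) y) := hc.comp R.continuous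
  have e1 := hR.integral_comp R.measurableEmbedding
    (fun x => softmaxWeight (r • z) x i * (reluKer m (x i) z - reluKer m (x i) y))
  have e2 : ∀ x, reluKer m (R x i) z - reluKer m (R x i) y =
      -(reluKer m (x i) z - reluKer m (x i) y) := by
    intro x
    have h1 : reluKer m (T (x i)) z = reluKer m (x i) y := by rw [← hTy, reluKer_map]
    have h2 : reluKer m (T (x i)) y = reluKer m (x i) z := by rw [← hTz, reluKer_map]
    rw [hRi, h1, h2]; ring
  have e3 : ∀ x : Fin n → 𝔼, softmaxWeight (r • z) x i =
      exp (r * inner ℝ (x i) z) / (exp (r * inner ℝ (x i) z) +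
        ∑ j ∈ Finset.univ.erase i, exp (r * inner ℝ (x j) z)) := by
    intro x
    rw [softmaxWeight, Finset.add_sum_erase _ (fun j => exp (r * inner ℝ (x j) z))
      (Finset.mem_univ i)]
    simp only [inner_smul_right]
  have e4 : ∀ x : Fin n → 𝔼, softmaxWeight (r • z) (R x) i =
      exp (r * inner ℝ (x i) y) / (exp (r * inner ℝ (x i) y) +
        ∑ j ∈ Finset.univ.erase i, exp (r * inner ℝ (x j) z)) := by
    intro x
    rw [e3, hRi, hTz']
    congr 2
    exact Finset.sum_congr rfl fun j hj => by rw [hRj x j (Finset.ne_of_mem_erase hj)]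
  have hS : ∀ x : Fin n → 𝔼, 0 < ∑ j ∈ Finset.univ.erase i, exp (r * inner ℝ (x j) z) := by
    intro x
    refine Finset.sum_pos (fun _ _ => exp_pos _) ?_
    rw [← Finset.card_pos, Finset.card_erase_of_mem (Finset.mem_univ i), Finset.card_univ,
      Fintype.card_fin]
    omega
  have hmono : ∀ {a b S : ℝ}, 0 < S → a < b →
      exp (r * a) / (exp (r * a) + S) < exp (r * b) / (exp (r * b) + S) := by
    intro a b S hS hab
    have := exp_lt_exp.2 (mul_lt_mul_of_pos_left hab hr)
    rw [div_lt_div_iff₀ (by positivity) (by positivity)]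
    nlinarith
  have hpos : 0 < ∫ x : Fin n → 𝔼, (softmaxWeight (r • z) x i *
      (reluKer m (x i) z - reluKer m (x i) y) + softmaxWeight (r • z) (R x) i *
      (reluKer m (R x i) z - reluKer m (R x i) y)) ∂(Measure.pi fun _ => sphereUniform (m + 1)) := by
    refine integral_pos_of_mem_support (a := fun _ => z) (hc.add hcR)
      (hc.integrable_of_carried.add hcR.integrable_of_carried)
      (Filter.Eventually.of_forall fun x => ?_)
      (mem_support_pi fun _ => mem_support_sphereUniform hz) ?_
    · simp only [Pi.zero_apply]
      rw [e2, e4, e3, mul_neg, ← sub_eq_add_neg, ← sub_mul]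
      rcases lt_trichotomy (inner ℝ (x i) y : ℝ) (inner ℝ (x i) z) with h | h | h
      · exact mul_nonneg (sub_nonneg.2 (hmono (hS x) h).le)
          (sub_nonneg.2 (reluKer_mono (hy.trans hz.symm) h.le))
      · simp [h]
      · exact mul_nonneg_of_nonpos_of_nonpos (sub_nonpos.2 (hmono (hS x) h).le)
          (sub_nonpos.2 (reluKer_mono (hz.trans hy.symm) h.le))
    · rw [e2, e4, e3, mul_neg, ← sub_eq_add_neg, ← sub_mul]
      refine mul_pos (sub_pos.2 (hmono (hS _) ?_)) (sub_pos.2 (reluKer_lt_self hy hz hyz))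
      rw [real_inner_self_eq_norm_sq, hz, one_pow]
      exact lt_of_le_of_ne ((real_inner_le_norm _ _).trans (by rw [hy, hz, one_mul]))
        fun h => hyz ((inner_eq_one_iff_of_norm_eq_one hz hy).1 h).symm
  rw [integral_add hc.integrable_of_carried hcR.integrable_of_carried, e1] at hpos
  linarith

lemma attnBias_map (T : 𝔼 ≃ₗᵢ[ℝ] 𝔼) (y u : 𝔼) :
    attnBias m n (T y) (T u) = attnBias m n y u := by
  let R : (Fin n → 𝔼) ≃ₜ (Fin n → 𝔼) := Homeomorph.piCongrRight fun _ => T.toHomeomorph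
  have hR : MeasurePreserving R (Measure.pi fun _ : Fin n => sphereUniform (m + 1))
      (Measure.pi fun _ => sphereUniform (m + 1)) :=
    measurePreserving_pi (fun _ : Fin n => sphereUniform (m + 1)) (fun _ => sphereUniform (m + 1))
      fun _ => measurePreserving_sphereUniform T
  have hRi : ∀ x i, R x i = T (x i) := fun _ _ => rfl
  rw [attnBias, ← hR.integral_comp R.measurableEmbedding
    (fun x => ∫ v, reluGap (T y) (T u) x v ∂sphereUniform (m + 1)), attnBias]
  refine integral_congr_ae (Filter.Eventually.of_forall fun x => ?_)
  dsimp only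
  rw [← (measurePreserving_sphereUniform T).integral_comp T.toHomeomorph.measurableEmbedding
    (fun v => reluGap (T y) (T u) (R x) v)]
  simp only [reluGap, softmaxGap, softmaxWeight, hRi, LinearIsometryEquiv.inner_map_map]

lemma attnNoise_map (T : 𝔼 ≃ₗᵢ[ℝ] 𝔼) (u : 𝔼) : attnNoise m n (T u) = attnNoise m n u := by
  let R : (Fin n → 𝔼) ≃ₜ (Fin n → 𝔼) := Homeomorph.piCongrRight fun _ => T.toHomeomorph
  have hR : MeasurePreserving R (Measure.pi fun _ : Fin n => sphereUniform (m + 1))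
      (Measure.pi fun _ => sphereUniform (m + 1)) :=
    measurePreserving_pi (fun _ : Fin n => sphereUniform (m + 1)) (fun _ => sphereUniform (m + 1))
      fun _ => measurePreserving_sphereUniform T
  have hRi : ∀ x i, R x i = T (x i) := fun _ _ => rfl
  rw [attnNoise, ← hR.integral_comp R.measurableEmbedding
    (fun x => ∑ i, softmaxWeight (T u) x i ^ 2), attnNoise]
  simp only [softmaxWeight, hRi, LinearIsometryEquiv.inner_map_map]

lemma attnRisk_map (κ s : ℝ) (T : 𝔼 ≃ₗᵢ[ℝ] 𝔼) (y u : 𝔼) :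
    attnRisk m n κ s (T y) (T u) = attnRisk m n κ s y u := by
  rw [attnRisk, attnBias_map, attnNoise_map, attnRisk]

lemma attnRisk_smul_eq (κ s r : ℝ) {y z : 𝔼} (h : ‖y‖ = ‖z‖) :
    attnRisk m n κ s y (r • y) = attnRisk m n κ s z (r • z) := by
  obtain ⟨T, hT, -⟩ := exists_linearIsometryEquiv_swap h
  rw [← hT, ← map_smul, attnRisk_map]

/-- Among all query directions of a given length, the one aligned with the query is the unique
minimizer of the conditional risk. -/
lemma attnRisk_lt [NeZero n] (hn : 2 ≤ n) {κ : ℝ} (hκ : 0 < κ) (s : ℝ) {y u e : 𝔼} (hy : ‖y‖ = 1)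
    (he : ‖e‖ = 1) (hu : u ≠ ‖u‖ • y) :
    attnRisk m n κ s e (‖u‖ • e) < attnRisk m n κ s y u := by
  have hu0 : u ≠ 0 := by rintro rfl; simp at hu
  have hr : 0 < ‖u‖ := norm_pos_iff.2 hu0
  have hz : ‖‖u‖⁻¹ • u‖ = 1 := by rw [norm_smul, norm_inv, norm_norm, inv_mul_cancel₀ hr.ne']
  obtain ⟨z, hzu⟩ : ∃ z, z = ‖u‖⁻¹ • u := ⟨_, rfl⟩
  rw [← hzu] at hz
  have hzu' : u = ‖u‖ • z := by rw [hzu, smul_smul, mul_inv_cancel₀ hr.ne', one_smul]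
  have hyz : y ≠ z := by rintro rfl; exact hu hzu'
  rw [attnRisk_smul_eq κ s ‖u‖ (he.trans hz.symm), ← hzu', attnRisk, attnRisk]
  have h1 := attnBias_sub_attnBias (n := n) (hy.trans hz.symm) u
  have h2 : 0 < ∑ i, ∫ x : Fin n → 𝔼, softmaxWeight u x i *
        (reluKer m (x i) z - reluKer m (x i) y) ∂(Measure.pi fun _ => sphereUniform (m + 1)) := by
    refine Finset.sum_pos (fun i _ => ?_) Finset.univ_nonempty
    have := integral_weight_mul_reluKer_pos hn hy hz hyz hr i
    rwa [← hzu'] at this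
  have h3 : attnBias m n z u < attnBias m n y u := by linarith
  have := mul_lt_mul_of_pos_left h3 hκ
  linarith

lemma attnRisk_le [NeZero n] (hn : 2 ≤ n) {κ : ℝ} (hκ : 0 < κ) (s : ℝ) {y u e : 𝔼} (hy : ‖y‖ = 1)
    (he : ‖e‖ = 1) : attnRisk m n κ s e (‖u‖ • e) ≤ attnRisk m n κ s y u := by
  by_cases hu : u = ‖u‖ • y
  · rw [attnRisk_smul_eq κ s ‖u‖ (he.trans hy.symm), ← hu]
  · exact (attnRisk_lt hn hκ s hy he hu).le

lemma exists_eq_smul_one_of_forall_apply_eq_norm_smul {M : Matrix (Fin (m + 1)) (Fin (m + 1)) ℝ}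
    (h : ∀ y : 𝔼, ‖y‖ = 1 → M.toEuclideanLin y = ‖M.toEuclideanLin y‖ • y) :
    ∃ w : ℝ, 0 ≤ w ∧ M = w • (1 : Matrix (Fin (m + 1)) (Fin (m + 1)) ℝ) := by
  obtain ⟨w, hw⟩ := LinearMap.exists_eq_smul_id_of_forall_notLinearIndependent
    (f := M.toEuclideanLin) fun v => by
      intro hli
      have hv : v ≠ 0 := hli.ne_zero 0
      have hv' : 0 < ‖v‖ := norm_pos_iff.2 hv
      have h1 := h (‖v‖⁻¹ • v) (by rw [norm_smul, norm_inv, norm_norm, inv_mul_cancel₀ hv'.ne'])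
      rw [map_smul, smul_comm] at h1
      have h2 := smul_right_injective 𝔼 (inv_ne_zero hv'.ne') h1
      rw [LinearIndependent.pair_iff] at hli
      have h3 := hli ‖M.toEuclideanLin (‖v‖⁻¹ • v)‖ (-1) (by
        rw [neg_one_smul, ← sub_eq_add_neg, sub_eq_zero, map_smul]; exact h2.symm)
      norm_num at h3
  have hM : M = w • (1 : Matrix (Fin (m + 1)) (Fin (m + 1)) ℝ) := by
    apply Matrix.toEuclideanLin.injective
    rw [hw]
    ext1 x
    simp
  refine ⟨w, ?_, hM⟩
  have he : ‖(EuclideanSpace.single 0 1 : 𝔼)‖ = 1 := by simp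
  have h1 := h _ he
  have he0 : (EuclideanSpace.single 0 1 : 𝔼) ≠ 0 := by
    rw [← norm_pos_iff, he]; exact one_pos
  have h2 : M.toEuclideanLin (EuclideanSpace.single 0 1) = w • EuclideanSpace.single 0 1 := by
    rw [hw]; rfl
  have h3 := smul_left_injective ℝ he0 (h2.symm.trans h1)
  rw [h3]
  exact norm_nonneg _

/-- Every minimizer of the pretraining loss is a nonnegative multiple of the identity, whose
factor minimizes the conditional risk. -/
lemma exists_eq_smul_one_of_forall_iclLoss_le (hn : 2 ≤ n) {L : ℝ} (hL : 0 < L) {ν : Measure ℝ}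
    [IsProbabilityMeasure ν] (h2 : Integrable (fun t : ℝ => t ^ 2) ν) (h0 : ∫ t, t ∂ν = 0)
    {M : Matrix (Fin (m + 1)) (Fin (m + 1)) ℝ}
    (hM : ∀ M' : Matrix (Fin (m + 1)) (Fin (m + 1)) ℝ,
      iclLoss (m + 1) n (reluTask (m + 1) L) ν reluF M ≤
        iclLoss (m + 1) n (reluTask (m + 1) L) ν reluF M') {e : 𝔼} (he : ‖e‖ = 1) :
    ∃ w : ℝ, 0 ≤ w ∧ M = w • (1 : Matrix (Fin (m + 1)) (Fin (m + 1)) ℝ) ∧ ∀ r : ℝ, 0 ≤ r →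
      attnRisk m n (L ^ 2 / 3) (∫ t, t ^ 2 ∂ν) e (w • e) ≤
        attnRisk m n (L ^ 2 / 3) (∫ t, t ^ 2 ∂ν) e (r • e) := by
  have : NeZero n := ⟨by omega⟩
  have hκ : 0 < L ^ 2 / 3 := by positivity
  set κ := L ^ 2 / 3
  set s := ∫ t, t ^ 2 ∂ν
  have hloss : ∀ w : ℝ, iclLoss (m + 1) n (reluTask (m + 1) L) ν reluF
      (w • (1 : Matrix (Fin (m + 1)) (Fin (m + 1)) ℝ)) = attnRisk m n κ s e (w • e) := by
    intro w
    rw [iclLoss_eq_integral_attnRisk hL h2 h0]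
    have : ∀ᵐ y : 𝔼 ∂sphereUniform (m + 1), attnRisk m n κ s y
        ((w • (1 : Matrix (Fin (m + 1)) (Fin (m + 1)) ℝ)).toEuclideanLin y) =
          attnRisk m n κ s e (w • e) := by
      filter_upwards [ae_norm_eq_one (m + 1)] with y hy
      rw [attnRisk_smul_eq κ s w (he.trans hy.symm)]
      congr 1
      simp
    rw [integral_congr_ae this]
    simp
  have hcM : Continuous M.toEuclideanLin := LinearMap.continuous_of_finiteDimensional _
  set ℓ := iclLoss (m + 1) n (reluTask (m + 1) L) ν reluF M with hℓ
  have hmin : ∀ y : 𝔼, ‖y‖ = 1 → ℓ ≤ attnRisk m n κ s y (M.toEuclideanLin y) := fun y hy =>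
    (hM (‖M.toEuclideanLin y‖ • 1)).trans ((hloss _).trans_le (attnRisk_le hn hκ s hy he))
  have hcr : Continuous fun y => attnRisk m n κ s y (M.toEuclideanLin y) :=
    continuous_attnRisk κ s continuous_id hcM
  have hz : ∫ y, (attnRisk m n κ s y (M.toEuclideanLin y) - ℓ) ∂sphereUniform (m + 1) = 0 := by
    rw [integral_sub hcr.integrable_of_carried (integrable_const _), hℓ,
      iclLoss_eq_integral_attnRisk hL h2 h0]
    simp [κ, s]
  have heig : ∀ y : 𝔼, ‖y‖ = 1 → M.toEuclideanLin y = ‖M.toEuclideanLin y‖ • y := by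
    intro y hy
    by_contra hne
    have h1 := attnRisk_lt hn hκ s hy he hne
    have h3 : 0 < ∫ y, (attnRisk m n κ s y (M.toEuclideanLin y) - ℓ) ∂sphereUniform (m + 1) := by
      refine integral_pos_of_mem_support (by fun_prop)
        (hcr.integrable_of_carried.sub (integrable_const _)) ?_ (mem_support_sphereUniform hy) ?_
      · filter_upwards [ae_norm_eq_one (m + 1)] with y hy
        exact sub_nonneg.2 (hmin y hy)
      · exact sub_pos.2 (((hM (‖M.toEuclideanLin y‖ • 1)).trans_eq (hloss _)).trans_lt h1)
    exact h3.ne' hz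
  obtain ⟨w, hw, hMw⟩ := exists_eq_smul_one_of_forall_apply_eq_norm_smul heig
  refine ⟨w, hw, hMw, fun r _ => ?_⟩
  rw [← hloss, ← hloss, ← hMw]
  exact hM _

/-- The Gaussian kernel with inverse bandwidth `s` centred at `y`. -/
def gaussKer {V : Type*} [Dist V] (s : ℝ) (y x : V) : ℝ := exp (-(s * dist x y) ^ 2 / 2)

lemma gaussKer_pos {V : Type*} [Dist V] (s : ℝ) (y x : V) : 0 < gaussKer s y x := exp_pos _

lemma gaussKer_le_one {V : Type*} [Dist V] (s : ℝ) (y x : V) : gaussKer s y x ≤ 1 := by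
  rw [gaussKer, exp_le_one_iff]
  have := sq_nonneg (s * dist x y)
  linarith

@[fun_prop]
lemma continuous_gaussKer {V : Type*} [PseudoMetricSpace V] (s : ℝ) (y : V) :
    Continuous (gaussKer s y) := by
  unfold gaussKer
  fun_prop

lemma exp_neg_half_le_gaussKer {V : Type*} [PseudoMetricSpace V] {s : ℝ} (hs : 0 < s) {y x : V}
    (h : dist x y ≤ 1 / s) : exp (-(1 / 2)) ≤ gaussKer s y x := by
  rw [le_div_iff₀ hs] at h
  refine exp_le_exp.2 ?_
  have : 0 ≤ dist x y * s := by positivity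
  nlinarith

lemma measurableSet_dist_le (y : 𝔼) (r : ℝ) : MeasurableSet {x : 𝔼 | dist x y ≤ r} :=
  measurableSet_le (by fun_prop) (by fun_prop)

lemma exists_integral_dist_pow_mul_gaussKer_le (m k : ℕ) :
    ∃ C : ℝ, 0 < C ∧ ∀ y : EuclideanSpace ℝ (Fin (m + 1)), ‖y‖ = 1 → ∀ s : ℝ, 0 < s →
      s ^ (m + k) * ∫ x, dist x y ^ k * gaussKer s y x ∂sphereUniform (m + 1) ≤ C := by
  obtain ⟨_, C, _, hC, h⟩ := exists_sphereUniform_cap_bounds m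
  have hsum : Summable fun j : ℕ => (j : ℝ) ^ (m + k) * exp (-j) := by
    simpa using Real.summable_pow_mul_exp_neg_nat_mul (m + k) one_pos
  set S := ∑' j : ℕ, (j : ℝ) ^ (m + k) * exp (-j)
  have hS : 0 ≤ S := tsum_nonneg fun j => by positivity
  refine ⟨C * exp (3 / 2) * (S + 1), by positivity, fun y hy s hs => ?_⟩
  set J := ⌊2 * s⌋₊ + 1
  let a : ℕ → ℝ := fun j => ((j + 1 : ℕ) : ℝ) ^ k * (exp (3 / 2) * exp (-(j + 1 : ℕ)))
  have hpt : ∀ᵐ x ∂sphereUniform (m + 1), s ^ k * (dist x y ^ k * gaussKer s y x) ≤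
      ∑ j ∈ Finset.range J,
        {x : EuclideanSpace ℝ (Fin (m + 1)) | dist x y ≤ (j + 1 : ℕ) / s}.indicator
          (fun _ => a j) x := by
    filter_upwards [ae_norm_eq_one (m + 1)] with x hx
    have hd : dist x y ≤ 2 := by
      rw [dist_eq_norm]
      exact (norm_sub_le _ _).trans (by rw [hx, hy]; norm_num)
    have hρ : 0 ≤ s * dist x y := by positivity
    have hj := Nat.floor_le hρ
    have hj' := (Nat.lt_floor_add_one (s * dist x y)).le
    set j := ⌊s * dist x y⌋₊
    have hjJ : j ∈ Finset.range J :=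
      Finset.mem_range.2 (Nat.lt_succ_of_le (Nat.floor_le_floor (by nlinarith)))
    refine le_trans ?_ (Finset.single_le_sum (f := fun j : ℕ =>
      {x : EuclideanSpace ℝ (Fin (m + 1)) | dist x y ≤ (j + 1 : ℕ) / s}.indicator
        (fun _ => a j) x) (fun i _ => Set.indicator_nonneg (fun _ _ => by positivity) _) hjJ)
    rw [Set.indicator_of_mem (by
      rw [Set.mem_ofPred_eq, le_div_iff₀ hs, mul_comm]; push_cast; exact hj'), ← mul_assoc,
      ← mul_pow]
    refine mul_le_mul (pow_le_pow_left₀ hρ (by push_cast; exact hj') k) ?_ (exp_pos _).le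
      (by positivity)
    rw [← exp_add]
    refine exp_le_exp.2 ?_
    push_cast
    nlinarith [sq_nonneg (s * dist x y - 1)]
  have hint := integral_mono_ae (Continuous.integrable_of_carried (by fun_prop))
    (integrable_finsetSum _ fun j _ => (integrable_const (a j)).indicator
      (measurableSet_dist_le y _)) hpt
  rw [integral_const_mul, integral_finsetSum _ fun j _ => (integrable_const (a j)).indicator
      (measurableSet_dist_le y _)] at hint
  simp_rw [integral_indicator_const _ (measurableSet_dist_le y _), smul_eq_mul] at hint
  rw [pow_add, mul_assoc]
  refine (mul_le_mul_of_nonneg_left hint (by positivity)).trans ?_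
  rw [Finset.mul_sum]
  have hterm : ∀ j ∈ Finset.range J, s ^ m *
      ((sphereUniform (m + 1)).real {x | dist x y ≤ (j + 1 : ℕ) / s} * a j) ≤
        C * exp (3 / 2) * (((j + 1 : ℕ) : ℝ) ^ (m + k) * exp (-(j + 1 : ℕ))) := by
    intro j _
    have h1 := (h y hy).1 ((j + 1 : ℕ) / s) (by positivity)
    have h2 := mul_le_mul_of_nonneg_right h1 (show 0 ≤ a j by positivity)
    refine (mul_le_mul_of_nonneg_left h2 (by positivity)).trans_eq ?_
    simp only [a, div_pow, pow_add]
    field_simp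
  refine (Finset.sum_le_sum hterm).trans ?_
  rw [← Finset.mul_sum]
  refine mul_le_mul_of_nonneg_left ?_ (by positivity)
  have h3 := hsum.sum_le_tsum (Finset.range (J + 1)) fun j _ => by positivity
  rw [Finset.sum_range_succ'] at h3
  have : 0 ≤ ((0 : ℕ) : ℝ) ^ (m + k) * exp (-(0 : ℕ)) := by positivity
  linarith

lemma exists_le_integral_gaussKer (m : ℕ) :
    ∃ c : ℝ, 0 < c ∧ ∀ y : EuclideanSpace ℝ (Fin (m + 1)), ‖y‖ = 1 → ∀ s : ℝ, 1 ≤ s →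
      c ≤ s ^ m * ∫ x, gaussKer s y x ^ 2 ∂sphereUniform (m + 1) := by
  obtain ⟨c, _, hc, _, h⟩ := exists_sphereUniform_cap_bounds m
  refine ⟨c * exp (-(1 / 2)) ^ 2, by positivity, fun y hy s hs => ?_⟩
  have hs0 : 0 < s := one_pos.trans_le hs
  have h1 := (h y hy).2 (1 / s) (by positivity) ((div_le_one hs0).2 hs)
  have h2 : ∫ x, {x : EuclideanSpace ℝ (Fin (m + 1)) | dist x y ≤ 1 / s}.indicator
      (fun _ => exp (-(1 / 2)) ^ 2) x ∂sphereUniform (m + 1) ≤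
        ∫ x, gaussKer s y x ^ 2 ∂sphereUniform (m + 1) := by
    refine integral_mono ((integrable_const _).indicator (measurableSet_dist_le y _))
      (Continuous.integrable_of_carried (by fun_prop)) fun x => ?_
    refine Set.indicator_apply_le' (fun hx => ?_) fun _ => by positivity
    exact pow_le_pow_left₀ (exp_pos _).le (exp_neg_half_le_gaussKer hs0 hx) 2
  rw [integral_indicator_const _ (measurableSet_dist_le y _), smul_eq_mul] at h2
  calc c * exp (-(1 / 2)) ^ 2 = s ^ m * (c * (1 / s) ^ m * exp (-(1 / 2)) ^ 2) := by
        rw [div_pow, one_pow]; field_simp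
    _ ≤ s ^ m * ∫ x, gaussKer s y x ^ 2 ∂sphereUniform (m + 1) := by
        gcongr
        exact (mul_le_mul_of_nonneg_right h1 (by positivity)).trans h2

lemma exists_le_integral_dist_sq_mul_gaussKer (m : ℕ) (hm : 1 ≤ m) :
    ∃ c : ℝ, 0 < c ∧ ∀ y : EuclideanSpace ℝ (Fin (m + 1)), ‖y‖ = 1 → ∀ s : ℝ, 1 ≤ s →
      c ≤ s ^ (m + 2) * ∫ x, dist x y ^ 2 * gaussKer s y x ∂sphereUniform (m + 1) := by
  obtain ⟨c, C, hc, hC, h⟩ := exists_sphereUniform_cap_bounds m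
  set q := exp (-(1 / 2))
  have hq : 0 < q := exp_pos _
  have hq1 : q ≤ 1 := exp_le_one_iff.2 (by norm_num)
  set δ := min 1 (c * q / (2 * C))
  have hδ : 0 < δ := by positivity
  have hδC : C * δ ^ m ≤ c * q / 2 := by
    have h1 : δ ^ m ≤ δ := pow_le_of_le_one hδ.le (min_le_left _ _) (by omega)
    have h2 : δ ≤ c * q / (2 * C) := min_le_right _ _
    rw [le_div_iff₀ (by positivity)] at h2
    nlinarith
  refine ⟨δ ^ 2 * (c * q / 2), by positivity, fun y hy s hs => ?_⟩
  have hs0 : 0 < s := one_pos.trans_le hs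
  have h1 := (h y hy).2 (1 / s) (by positivity) ((div_le_one hs0).2 hs)
  have h1' := (h y hy).1 (δ / s) (by positivity)
  have hi : ∀ r a, Integrable ({x : EuclideanSpace ℝ (Fin (m + 1)) | dist x y ≤ r}.indicator
      (fun _ => (a : ℝ))) (sphereUniform (m + 1)) := fun r a =>
    (integrable_const _).indicator (measurableSet_dist_le y _)
  have h2 : ∫ x, ({x : EuclideanSpace ℝ (Fin (m + 1)) | dist x y ≤ 1 / s}.indicator
      (fun _ => (δ / s) ^ 2 * q) x - {x : EuclideanSpace ℝ (Fin (m + 1)) | dist x y ≤ δ / s}.indicator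
      (fun _ => (δ / s) ^ 2) x) ∂sphereUniform (m + 1) ≤
        ∫ x, dist x y ^ 2 * gaussKer s y x ∂sphereUniform (m + 1) := by
    refine integral_mono ((hi _ _).sub (hi _ _))
      (Continuous.integrable_of_carried (by fun_prop)) fun x => ?_
    have hg := gaussKer_pos s y x
    have hdq : (δ / s) ^ 2 * q ≤ (δ / s) ^ 2 := mul_le_of_le_one_right (by positivity) hq1
    dsimp only
    by_cases hx : x ∈ {x | dist x y ≤ 1 / s}
    · rw [Set.indicator_of_mem hx]
      by_cases hx' : x ∈ {x | dist x y ≤ δ / s}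
      · rw [Set.indicator_of_mem hx']
        have : 0 ≤ dist x y ^ 2 * gaussKer s y x := by positivity
        linarith
      · rw [Set.indicator_of_notMem hx', sub_zero]
        rw [Set.mem_ofPred_eq] at hx hx'
        exact mul_le_mul (pow_le_pow_left₀ (by positivity) (not_le.1 hx').le 2)
          (exp_neg_half_le_gaussKer hs0 hx) hq.le (by positivity)
    · rw [Set.indicator_of_notMem hx, zero_sub]
      refine le_trans (neg_nonpos.2 (Set.indicator_nonneg (fun _ _ => by positivity) _)) ?_
      positivity
  rw [integral_sub (hi _ _) (hi _ _), integral_indicator_const _ (measurableSet_dist_le y _),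
    integral_indicator_const _ (measurableSet_dist_le y _), smul_eq_mul, smul_eq_mul] at h2
  refine le_trans ?_ (mul_le_mul_of_nonneg_left h2 (by positivity))
  have h3 := mul_le_mul_of_nonneg_right h1 (show 0 ≤ (δ / s) ^ 2 * q by positivity)
  have h4 := mul_le_mul_of_nonneg_right h1' (show 0 ≤ (δ / s) ^ 2 by positivity)
  calc δ ^ 2 * (c * q / 2) ≤ δ ^ 2 * (c * q - C * δ ^ m) := by gcongr; linarith
    _ = s ^ (m + 2) * (c * (1 / s) ^ m * ((δ / s) ^ 2 * q) - C * (δ / s) ^ m * (δ / s) ^ 2) := by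
        rw [div_pow, div_pow, div_pow, one_pow]; field_simp; ring
    _ ≤ _ := by gcongr

/-- Replacing the normalization `S` by a lower estimate `M / 2` up to an exponentially small
error. -/
lemma div_sq_le_add_exp {A B S M : ℝ} (hA : 0 ≤ A) (hB : 0 ≤ B) (hS : 0 < S) (hM : 0 < M)
    (h : A ≤ B * S ^ 2) : A / S ^ 2 ≤ 4 * A / M ^ 2 + B * exp (M / 4 - S / 2) := by
  rcases le_total (M / 2) S with h1 | h1
  · have h2 : A / S ^ 2 ≤ 4 * A / M ^ 2 := by
      rw [div_le_div_iff₀ (by positivity) (by positivity)]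
      have : M ^ 2 ≤ 4 * S ^ 2 := by nlinarith
      nlinarith
    have : 0 ≤ B * exp (M / 4 - S / 2) := by positivity
    linarith
  · have h2 : A / S ^ 2 ≤ B := by rwa [div_le_iff₀ (by positivity)]
    have h3 : 1 ≤ exp (M / 4 - S / 2) := one_le_exp (by linarith)
    have h4 : B ≤ B * exp (M / 4 - S / 2) := le_mul_of_one_le_right hB h3
    have : 0 ≤ 4 * A / M ^ 2 := by positivity
    linarith

lemma exp_neg_half_mul_le {t : ℝ} (h0 : 0 ≤ t) (h1 : t ≤ 1) : exp (-(t / 2)) ≤ 1 - 3 / 8 * t := by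
  have h2 := Real.abs_exp_sub_one_sub_id_le (x := -(t / 2)) (by rw [abs_le]; constructor <;> linarith)
  have h3 := (convexOn_exp.2 (Set.mem_univ (-(1 / 2))) (Set.mem_univ 0) h0 (sub_nonneg.2 h1)
    (by ring))
  have h4 : exp (-(1 / 2)) ≤ 5 / 8 := by
    rw [exp_neg, inv_le_comm₀ (exp_pos _) (by norm_num)]
    refine le_trans (by norm_num) (Real.quadratic_le_exp_of_nonneg (x := 1 / 2) (by norm_num))
  simp only [smul_eq_mul, mul_zero, add_zero, exp_zero, mul_one] at h3
  rw [show t * -(1 / 2) = -(t / 2) by ring] at h3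
  nlinarith

lemma ae_forall_norm_eq_one (m n : ℕ) :
    ∀ᵐ x : Fin n → EuclideanSpace ℝ (Fin (m + 1)) ∂(Measure.pi fun _ => sphereUniform (m + 1)),
      ∀ i, ‖x i‖ = 1 := by
  have : SigmaFinite (sphereUniform (m + 1)) := inferInstance
  exact ae_all_iff.2 fun i => (Measure.tendsto_eval_ae_ae (μ := fun _ : Fin n => sphereUniform (m + 1))
      (i := i)).eventually (ae_norm_eq_one (m + 1))

section SelfNormalized

variable {E : EuclideanSpace ℝ (Fin (m + 1)) → ℝ}

lemma integral_exp_neg_sum_le (hE : Continuous E) (h0 : ∀ x, 0 < E x) (h1 : ∀ x, E x ≤ 1) :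
    ∫ x : Fin n → 𝔼, exp (n * (∫ t, E t ∂sphereUniform (m + 1)) / 4 - (∑ i, E (x i)) / 2)
      ∂(Measure.pi fun _ => sphereUniform (m + 1)) ≤
        exp (-(n * (∫ t, E t ∂sphereUniform (m + 1)) / 8)) := by
  set Z := ∫ t, E t ∂sphereUniform (m + 1)
  have e1 : ∀ x : Fin n → 𝔼, exp (n * Z / 4 - (∑ i, E (x i)) / 2) =
      exp (n * Z / 4) * ∏ i, exp (-(E (x i) / 2)) := by
    intro x
    rw [← exp_sum, ← exp_add, Finset.sum_neg_distrib, Finset.sum_div, sub_eq_add_neg]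
  simp_rw [e1]
  rw [integral_const_mul, integral_fintype_prod_eq_pow (fun t => exp (-(E t / 2))),
    Fintype.card_fin]
  have h2 : ∫ t, exp (-(E t / 2)) ∂sphereUniform (m + 1) ≤ exp (-(3 / 8 * Z)) := by
    refine le_trans ?_ (one_sub_le_exp_neg _)
    have : ∫ t, (1 - 3 / 8 * E t) ∂sphereUniform (m + 1) = 1 - 3 / 8 * Z := by
      rw [integral_sub (Continuous.integrable_of_carried (by fun_prop))
        (Continuous.integrable_of_carried (by fun_prop)), integral_const_mul]
      simp [Z]
    rw [← this]
    exact integral_mono (Continuous.integrable_of_carried (by fun_prop))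
      (Continuous.integrable_of_carried (by fun_prop)) fun t => exp_neg_half_mul_le (h0 t).le (h1 t)
  calc exp (n * Z / 4) * (∫ t, exp (-(E t / 2)) ∂sphereUniform (m + 1)) ^ n
      ≤ exp (n * Z / 4) * exp (-(3 / 8 * Z)) ^ n := by
        gcongr
    _ = exp (-(n * Z / 8)) := by
        rw [← exp_nat_mul, ← exp_add]; ring_nf

lemma integral_pos_of_continuous (hE : Continuous E) (h0 : ∀ x, 0 < E x) :
    0 < ∫ t, E t ∂sphereUniform (m + 1) :=
  integral_pos_of_mem_support (a := EuclideanSpace.single 0 1) hE hE.integrable_of_carried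
    (Filter.Eventually.of_forall fun x => (h0 x).le) (mem_support_sphereUniform (by simp)) (h0 _)

/-- Lower bound for the expected sum of squared normalized weights. -/
lemma le_integral_sum_sq_div_sq [NeZero n] (hE : Continuous E) (h0 : ∀ x, 0 < E x)
    (h1 : ∀ x, E x ≤ 1) (hn : 4 ≤ n * ∫ t, E t ∂sphereUniform (m + 1)) :
    (∫ t, E t ^ 2 ∂sphereUniform (m + 1)) / (2 * n * (∫ t, E t ∂sphereUniform (m + 1)) ^ 2) ≤
      ∫ x : Fin n → 𝔼, (∑ i, E (x i) ^ 2) / (∑ i, E (x i)) ^ 2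
        ∂(Measure.pi fun _ => sphereUniform (m + 1)) := by
  have hS : ∀ x : Fin n → 𝔼, 0 < ∑ i, E (x i) := fun x =>
    Finset.sum_pos (fun _ _ => h0 _) Finset.univ_nonempty
  have hZ := integral_pos_of_continuous hE h0
  have hn0 : (0 : ℝ) < n := by exact_mod_cast Nat.pos_of_ne_zero (NeZero.ne n)
  set Z := ∫ t, E t ∂sphereUniform (m + 1)
  set Z2 := ∫ t, E t ^ 2 ∂sphereUniform (m + 1)
  set M := n * Z
  have hM : 0 < M := by positivity
  have hpt : ∀ x : Fin n → 𝔼, (3 * M * (∑ i, E (x i) ^ 2) -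
      2 * ((∑ i, E (x i) ^ 2) * ∑ i, E (x i))) / M ^ 3 ≤
        (∑ i, E (x i) ^ 2) / (∑ i, E (x i)) ^ 2 := by
    intro x
    have hS := hS x
    set S := ∑ i, E (x i)
    have hA : 0 ≤ ∑ i, E (x i) ^ 2 := by positivity
    rw [div_le_div_iff₀ (by positivity) (by positivity)]
    have : 0 ≤ (M - S) ^ 2 * (M + 2 * S) := by positivity
    nlinarith
  have hint := integral_mono (μ := Measure.pi fun _ : Fin n => sphereUniform (m + 1))
    (Continuous.integrable_of_carried (by fun_prop)) (Continuous.integrable_of_carried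
      (Continuous.div (by fun_prop) (by fun_prop) fun x => by have := hS x; positivity)) hpt
  refine le_trans ?_ hint
  rw [integral_div, integral_sub (Continuous.integrable_of_carried (by fun_prop))
    (Continuous.integrable_of_carried (by fun_prop)), integral_const_mul, integral_const_mul,
    integral_pi_sum_mul_sum (g := fun t => E t ^ 2) (h := E) (by fun_prop) (by fun_prop)
    (Continuous.integrable_of_carried (by fun_prop))
    (Continuous.integrable_of_carried (by fun_prop))
    (Continuous.integrable_of_carried (by fun_prop)),
    integral_finsetSum _ fun i _ => (Continuous.integrable_of_carried (by fun_prop))]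
  simp_rw [integral_pi_eval (ρ := sphereUniform (m + 1)) (g := fun t => E t ^ 2)
    (Continuous.integrable_of_carried (by fun_prop))]
  simp only [Finset.sum_const, Finset.card_univ, Fintype.card_fin, nsmul_eq_mul]
  have h3 : ∫ t, E t ^ 2 * E t ∂sphereUniform (m + 1) ≤ Z2 :=
    integral_mono (Continuous.integrable_of_carried (by fun_prop))
      (Continuous.integrable_of_carried (by fun_prop)) fun t =>
        mul_le_of_le_one_right (by positivity) (h1 t)
  have hZ2 : 0 ≤ Z2 := integral_nonneg fun _ => by positivity
  rw [div_le_div_iff₀ (by positivity) (by positivity)]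
  have e : Z2 * M ^ 3 = Z2 * M * Z * n * (n * Z) := by simp only [M]; ring
  rw [e]
  have h4 : Z2 * n * (n * Z) - 2 * (n * Z2) ≤ 3 * M * (n * Z2) - 2 * (n *
      (∫ t, E t ^ 2 * E t ∂sphereUniform (m + 1)) + n * (n - 1) * (Z2 * Z)) := by
    have : n * (∫ t, E t ^ 2 * E t ∂sphereUniform (m + 1)) ≤ n * Z2 := by gcongr
    have : 0 ≤ n * Z2 * Z := by positivity
    simp only [M]
    nlinarith
  refine le_trans ?_ (mul_le_mul_of_nonneg_right h4 (by positivity))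
  have h5 : 0 ≤ n * n * Z2 * Z ^ 2 * (n * Z - 4) := by
    have : 0 ≤ n * Z - 4 := sub_nonneg.2 hn
    positivity
  simp only [M]
  nlinarith

/-- Lower bound for the expected normalized weighted sum of a nonnegative function. -/
lemma le_integral_sum_mul_div [NeZero n] (hE : Continuous E) (h0 : ∀ x, 0 < E x)
    (h1 : ∀ x, E x ≤ 1) {τ : 𝔼 → ℝ} (hτ : Continuous τ) (hτ0 : ∀ x, 0 ≤ τ x)
    (hn : 2 ≤ n * ∫ t, E t ∂sphereUniform (m + 1)) :
    (∫ t, τ t * E t ∂sphereUniform (m + 1)) / (2 * ∫ t, E t ∂sphereUniform (m + 1)) ≤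
      ∫ x : Fin n → 𝔼, (∑ i, τ (x i) * E (x i)) / ∑ i, E (x i)
        ∂(Measure.pi fun _ => sphereUniform (m + 1)) := by
  have hS : ∀ x : Fin n → 𝔼, 0 < ∑ i, E (x i) := fun x =>
    Finset.sum_pos (fun _ _ => h0 _) Finset.univ_nonempty
  have hZ := integral_pos_of_continuous hE h0
  have hn0 : (0 : ℝ) < n := by exact_mod_cast Nat.pos_of_ne_zero (NeZero.ne n)
  set Z := ∫ t, E t ∂sphereUniform (m + 1)
  set z := ∫ t, τ t * E t ∂sphereUniform (m + 1)
  set M := n * Z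
  have hM : 0 < M := by positivity
  have hpt : ∀ x : Fin n → 𝔼, (2 * M * (∑ i, τ (x i) * E (x i)) -
      (∑ i, τ (x i) * E (x i)) * ∑ i, E (x i)) / M ^ 2 ≤
        (∑ i, τ (x i) * E (x i)) / ∑ i, E (x i) := by
    intro x
    have hS := hS x
    set S := ∑ i, E (x i)
    have hA : 0 ≤ ∑ i, τ (x i) * E (x i) :=
      Finset.sum_nonneg fun i _ => mul_nonneg (hτ0 _) (h0 _).le
    rw [div_le_div_iff₀ (by positivity) (by positivity)]
    have : 0 ≤ (M - S) ^ 2 := by positivity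
    nlinarith
  have hint := integral_mono (μ := Measure.pi fun _ : Fin n => sphereUniform (m + 1))
    (Continuous.integrable_of_carried (by fun_prop)) (Continuous.integrable_of_carried
      (Continuous.div (by fun_prop) (by fun_prop) fun x => (hS x).ne')) hpt
  refine le_trans ?_ hint
  rw [integral_div, integral_sub (Continuous.integrable_of_carried (by fun_prop))
    (Continuous.integrable_of_carried (by fun_prop)), integral_const_mul,
    integral_pi_sum_mul_sum (g := fun t => τ t * E t) (h := E) (by fun_prop) (by fun_prop)
    (Continuous.integrable_of_carried (by fun_prop))
    (Continuous.integrable_of_carried (by fun_prop))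
    (Continuous.integrable_of_carried (by fun_prop)),
    integral_finsetSum _ fun i _ => (Continuous.integrable_of_carried (by fun_prop))]
  simp_rw [integral_pi_eval (ρ := sphereUniform (m + 1)) (g := fun t => τ t * E t)
    (Continuous.integrable_of_carried (by fun_prop))]
  simp only [Finset.sum_const, Finset.card_univ, Fintype.card_fin, nsmul_eq_mul]
  have h3 : ∫ t, τ t * E t * E t ∂sphereUniform (m + 1) ≤ z :=
    integral_mono (Continuous.integrable_of_carried (by fun_prop))
      (Continuous.integrable_of_carried (by fun_prop)) fun t =>
        mul_le_of_le_one_right (mul_nonneg (hτ0 t) (h0 t).le) (h1 t)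
  have hz : 0 ≤ z := integral_nonneg fun t => mul_nonneg (hτ0 t) (h0 t).le
  have h4 : n * z * (n * Z) - n * z ≤ 2 * M * (n * z) - (n *
      (∫ t, τ t * E t * E t ∂sphereUniform (m + 1)) + n * (n - 1) * (z * Z)) := by
    have : n * (∫ t, τ t * E t * E t ∂sphereUniform (m + 1)) ≤ n * z := by gcongr
    have : 0 ≤ n * z * Z := by positivity
    simp only [M]
    nlinarith
  rw [div_le_div_iff₀ (by positivity) (by positivity)]
  refine le_trans ?_ (mul_le_mul_of_nonneg_right h4 (by positivity))
  have h5 : 0 ≤ n * z * Z * (n * Z - 2) := by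
    have : 0 ≤ n * Z - 2 := sub_nonneg.2 hn
    positivity
  simp only [M]
  nlinarith

/-- Upper bound for the second moment of a normalized weighted sum. -/
lemma integral_sum_mul_div_sq_le [NeZero n] (hE : Continuous E) (h0 : ∀ x, 0 < E x)
    (h1 : ∀ x, E x ≤ 1) {g : 𝔼 → ℝ} (hg : Continuous g) {G : ℝ} (hG : ∀ x, ‖x‖ = 1 → |g x| ≤ G) :
    ∫ x : Fin n → 𝔼, ((∑ i, g (x i) * E (x i)) / ∑ i, E (x i)) ^ 2
        ∂(Measure.pi fun _ => sphereUniform (m + 1)) ≤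
      4 * ((∫ t, g t ^ 2 * E t ∂sphereUniform (m + 1)) /
          (n * (∫ t, E t ∂sphereUniform (m + 1)) ^ 2) +
        ((∫ t, g t * E t ∂sphereUniform (m + 1)) / ∫ t, E t ∂sphereUniform (m + 1)) ^ 2) +
        G ^ 2 * exp (-(n * (∫ t, E t ∂sphereUniform (m + 1)) / 8)) := by
  have hS : ∀ x : Fin n → 𝔼, 0 < ∑ i, E (x i) := fun x =>
    Finset.sum_pos (fun _ _ => h0 _) Finset.univ_nonempty
  have hZ := integral_pos_of_continuous hE h0
  have hn0 : (0 : ℝ) < n := by exact_mod_cast Nat.pos_of_ne_zero (NeZero.ne n)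
  have hexp := integral_exp_neg_sum_le (n := n) hE h0 h1
  set Z := ∫ t, E t ∂sphereUniform (m + 1)
  set M := n * Z
  have hM : 0 < M := by positivity
  have hpt : ∀ᵐ x : Fin n → 𝔼 ∂(Measure.pi fun _ => sphereUniform (m + 1)),
      ((∑ i, g (x i) * E (x i)) / ∑ i, E (x i)) ^ 2 ≤
        4 * ((∑ i, g (x i) * E (x i)) * ∑ i, g (x i) * E (x i)) / M ^ 2 +
          G ^ 2 * exp (M / 4 - (∑ i, E (x i)) / 2) := by
    filter_upwards [ae_forall_norm_eq_one m n] with x hx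
    rw [div_pow, ← sq]
    refine div_sq_le_add_exp (sq_nonneg _) (sq_nonneg _) (hS x) hM ?_
    rw [← mul_pow]
    refine sq_le_sq' ?_ ?_
    · rw [Finset.mul_sum, ← Finset.sum_neg_distrib]
      exact Finset.sum_le_sum fun i _ => by
        have := mul_le_mul_of_nonneg_right (neg_le_of_abs_le (hG _ (hx i))) (h0 (x i)).le
        linarith
    · rw [Finset.mul_sum]
      exact Finset.sum_le_sum fun i _ =>
        mul_le_mul_of_nonneg_right (le_of_abs_le (hG _ (hx i))) (h0 (x i)).le
  have hint := integral_mono_ae (μ := Measure.pi fun _ : Fin n => sphereUniform (m + 1))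
    (Continuous.integrable_of_carried
      ((Continuous.div (by fun_prop) (by fun_prop) fun x => (hS x).ne').pow 2))
    (Continuous.integrable_of_carried (by fun_prop)) hpt
  refine hint.trans ?_
  rw [integral_add (Continuous.integrable_of_carried (by fun_prop))
    (Continuous.integrable_of_carried (by fun_prop)), integral_div, integral_const_mul,
    integral_const_mul,
    integral_pi_sum_mul_sum (g := fun t => g t * E t) (h := fun t => g t * E t) (by fun_prop)
    (by fun_prop) (Continuous.integrable_of_carried (by fun_prop))
    (Continuous.integrable_of_carried (by fun_prop))
    (Continuous.integrable_of_carried (by fun_prop)), Fintype.card_fin]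
  have h3 : ∫ t, g t * E t * (g t * E t) ∂sphereUniform (m + 1) ≤
      ∫ t, g t ^ 2 * E t ∂sphereUniform (m + 1) :=
    integral_mono (Continuous.integrable_of_carried (by fun_prop))
      (Continuous.integrable_of_carried (by fun_prop)) fun t => by
        have : g t ^ 2 * E t * E t ≤ g t ^ 2 * E t :=
          mul_le_of_le_one_right (mul_nonneg (sq_nonneg _) (h0 t).le) (h1 t)
        calc g t * E t * (g t * E t) = g t ^ 2 * E t * E t := by ring
          _ ≤ _ := this
  set a := ∫ t, g t * E t * (g t * E t) ∂sphereUniform (m + 1)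
  set b := ∫ t, g t ^ 2 * E t ∂sphereUniform (m + 1)
  set z := ∫ t, g t * E t ∂sphereUniform (m + 1)
  gcongr
  rw [mul_div_assoc]
  gcongr
  calc (n * a + n * (n - 1) * (z * z)) / M ^ 2 ≤ (n * b + n * n * z ^ 2) / M ^ 2 := by
        rw [← sq]
        gcongr
        linarith
    _ = b / (n * Z ^ 2) + (z / Z) ^ 2 := by simp only [M]; field_simp

lemma integral_sum_sq_div_sq_le [NeZero n] (hE : Continuous E) (h0 : ∀ x, 0 < E x)
    (h1 : ∀ x, E x ≤ 1) :
    ∫ x : Fin n → 𝔼, (∑ i, E (x i) ^ 2) / (∑ i, E (x i)) ^ 2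
        ∂(Measure.pi fun _ => sphereUniform (m + 1)) ≤
      4 / (n * ∫ t, E t ∂sphereUniform (m + 1)) +
        exp (-(n * (∫ t, E t ∂sphereUniform (m + 1)) / 8)) := by
  have hS : ∀ x : Fin n → 𝔼, 0 < ∑ i, E (x i) := fun x =>
    Finset.sum_pos (fun _ _ => h0 _) Finset.univ_nonempty
  have hZ := integral_pos_of_continuous hE h0
  have hn0 : (0 : ℝ) < n := by exact_mod_cast Nat.pos_of_ne_zero (NeZero.ne n)
  have hexp := integral_exp_neg_sum_le (n := n) hE h0 h1
  have hZE : ∑ i : Fin n, ∫ x : Fin n → 𝔼, E (x i) ∂(Measure.pi fun _ => sphereUniform (m + 1)) =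
      n * ∫ t, E t ∂sphereUniform (m + 1) := by
    simp_rw [integral_pi_eval (ρ := sphereUniform (m + 1)) hE.integrable_of_carried]
    simp
  set Z := ∫ t, E t ∂sphereUniform (m + 1)
  set M := n * Z
  have hM : 0 < M := by positivity
  have hpt : ∀ x : Fin n → 𝔼, (∑ i, E (x i) ^ 2) / (∑ i, E (x i)) ^ 2 ≤
      4 * (∑ i, E (x i)) / M ^ 2 + 1 * exp (M / 4 - (∑ i, E (x i)) / 2) := by
    intro x
    refine (div_sq_le_add_exp (by positivity) zero_le_one (hS x) hM ?_).trans ?_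
    · rw [one_mul]
      exact Finset.sum_sq_le_sq_sum_of_nonneg fun i _ => (h0 _).le
    · gcongr with i
      rw [sq]
      exact mul_le_of_le_one_right (h0 _).le (h1 _)
  have hint := integral_mono (μ := Measure.pi fun _ : Fin n => sphereUniform (m + 1))
    (Continuous.integrable_of_carried
      (Continuous.div (by fun_prop) (by fun_prop) fun x => (pow_pos (hS x) 2).ne'))
    (Continuous.integrable_of_carried (by fun_prop)) hpt
  refine hint.trans ?_
  rw [integral_add (Continuous.integrable_of_carried (by fun_prop))
    (Continuous.integrable_of_carried (by fun_prop)), integral_div, integral_const_mul,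
    integral_const_mul, one_mul,
    integral_finsetSum _ fun i _ => (Continuous.integrable_of_carried (by fun_prop)), hZE]
  refine add_le_add (le_of_eq ?_) hexp
  field_simp

end SelfNormalized

lemma dist_sq_eq_of_norm_eq_one {V : Type*} [NormedAddCommGroup V] [InnerProductSpace ℝ V]
    {x y : V} (hx : ‖x‖ = 1) (hy : ‖y‖ = 1) : dist x y ^ 2 = 2 * (1 - inner ℝ x y) := by
  rw [dist_eq_norm, norm_sub_sq_real, hx, hy]
  ring

lemma softmaxWeight_eq_gaussKer {V ι : Type*} [NormedAddCommGroup V] [InnerProductSpace ℝ V]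
    [Fintype ι] (s : ℝ) {y : V} (hy : ‖y‖ = 1) {x : ι → V} (hx : ∀ i, ‖x i‖ = 1) (i : ι) :
    softmaxWeight (s ^ 2 • y) x i = gaussKer s y (x i) / ∑ j, gaussKer s y (x j) := by
  have h : ∀ j, exp (inner ℝ (x j) (s ^ 2 • y)) = exp (s ^ 2) * gaussKer s y (x j) := by
    intro j
    rw [gaussKer, ← exp_add, inner_smul_right, mul_pow, dist_sq_eq_of_norm_eq_one (hx j) hy]
    ring_nf
  rw [softmaxWeight]
  simp_rw [h]
  rw [← Finset.mul_sum, mul_div_mul_left _ _ (exp_pos _).ne']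

lemma attnNoise_eq_gaussKer (s : ℝ) {y : 𝔼} (hy : ‖y‖ = 1) :
    attnNoise m n (s ^ 2 • y) = ∫ x : Fin n → 𝔼, (∑ i, gaussKer s y (x i) ^ 2) /
      (∑ i, gaussKer s y (x i)) ^ 2 ∂(Measure.pi fun _ => sphereUniform (m + 1)) := by
  refine integral_congr_ae ?_
  filter_upwards [ae_forall_norm_eq_one m n] with x hx
  simp_rw [softmaxWeight_eq_gaussKer s hy hx, div_pow, ← Finset.sum_div]

/-- Chebyshev's sum inequality with weights `a`. -/
lemma sum_mul_sum_le_of_comonotone {ι : Type*} [Fintype ι] {a q f : ι → ℝ} (ha : ∀ i, 0 ≤ a i)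
    (h : ∀ i j, 0 ≤ (q i - q j) * (f i - f j)) :
    (∑ i, a i * q i) * (∑ i, a i * f i) ≤ (∑ i, a i * (q i * f i)) * ∑ i, a i := by
  have h1 : 0 ≤ ∑ i, ∑ j, a i * a j * ((q i - q j) * (f i - f j)) :=
    Finset.sum_nonneg fun i _ => Finset.sum_nonneg fun j _ =>
      mul_nonneg (mul_nonneg (ha i) (ha j)) (h i j)
  have h2 : ∑ i, ∑ j, a i * a j * ((q i - q j) * (f i - f j)) =
      ∑ i, ∑ j, (a i * (q i * f i) * a j + a i * (a j * (q j * f j)) -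
        a i * q i * (a j * f j) - a i * f i * (a j * q j)) :=
    Finset.sum_congr rfl fun i _ => Finset.sum_congr rfl fun j _ => by ring
  rw [h2] at h1
  simp only [Finset.sum_sub_distrib, Finset.sum_add_distrib, ← Finset.sum_mul_sum] at h1
  nlinarith

lemma sum_softmaxWeight_sq_mono {V ι : Type*} [NormedAddCommGroup V] [InnerProductSpace ℝ V]
    [Fintype ι] [Nonempty ι] {r w : ℝ} (hr : 0 ≤ r) (hrw : r ≤ w) (y : V) (x : ι → V) :
    ∑ i, softmaxWeight (r • y) x i ^ 2 ≤ ∑ i, softmaxWeight (w • y) x i ^ 2 := by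
  set t : ι → ℝ := fun i => inner ℝ (x i) y
  set p := softmaxWeight (r • y) x
  set p' := softmaxWeight (w • y) x
  have hmono : ∀ k : ℝ, 0 ≤ k → ∀ i j, t i ≤ t j → exp (k * t i) ≤ exp (k * t j) :=
    fun k hk i j h => exp_le_exp.2 (mul_le_mul_of_nonneg_left h hk)
  have hq : ∀ f : ι → ℝ, (∀ i j, t i ≤ t j → f i ≤ f j) → ∀ i j,
      0 ≤ (exp ((w - r) * t i) - exp ((w - r) * t j)) * (f i - f j) := by
    intro f hf i j
    rcases le_total (t i) (t j) with h | h
    · exact mul_nonneg_of_nonpos_of_nonpos (sub_nonpos.2 (hmono _ (sub_nonneg.2 hrw) i j h))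
        (sub_nonpos.2 (hf i j h))
    · exact mul_nonneg (sub_nonneg.2 (hmono _ (sub_nonneg.2 hrw) j i h)) (sub_nonneg.2 (hf j i h))
  have hA : 0 < ∑ i, exp (r * t i) := sum_exp_pos _
  have hA' : 0 < ∑ i, exp (w * t i) := sum_exp_pos _
  have hp : ∀ i, p i = exp (r * t i) / ∑ i, exp (r * t i) := fun i => by
    simp only [p, softmaxWeight, inner_smul_right, t]
  have hp' : ∀ i, p' i = exp (w * t i) / ∑ i, exp (w * t i) := fun i => by
    simp only [p', softmaxWeight, inner_smul_right, t]
  have key : ∀ f : ι → ℝ, (∀ i j, t i ≤ t j → f i ≤ f j) → ∑ i, p i * f i ≤ ∑ i, p' i * f i := by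
    intro f hf
    have h1 := sum_mul_sum_le_of_comonotone (a := fun i => exp (r * t i)) (fun i => (exp_pos _).le)
      (hq f hf)
    have h2 : ∀ i, exp (r * t i) * exp ((w - r) * t i) = exp (w * t i) := fun i => by
      rw [← exp_add]; ring_nf
    simp only [← mul_assoc, h2] at h1
    simp_rw [hp, hp', div_mul_eq_mul_div, ← Finset.sum_div]
    rw [div_le_div_iff₀ hA hA']
    linarith
  have k1 := key p fun i j h => by
    rw [hp, hp]; exact div_le_div_of_nonneg_right (hmono r hr i j h) hA.le
  have k2 := key p' fun i j h => by
    rw [hp', hp']; exact div_le_div_of_nonneg_right (hmono w (hr.trans hrw) i j h) hA'.le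
  calc ∑ i, p i ^ 2 = ∑ i, p i * p i := by simp_rw [sq]
    _ ≤ ∑ i, p' i * p i := k1
    _ = ∑ i, p i * p' i := by simp_rw [mul_comm]
    _ ≤ ∑ i, p' i * p' i := k2
    _ = ∑ i, p' i ^ 2 := by simp_rw [sq]

lemma attnNoise_mono [NeZero n] {r w : ℝ} (hr : 0 ≤ r) (hrw : r ≤ w) (y : 𝔼) :
    attnNoise m n (r • y) ≤ attnNoise m n (w • y) := by
  have hc : ∀ r : ℝ, Continuous fun x : Fin n → 𝔼 => ∑ i, softmaxWeight (r • y) x i ^ 2 := fun r =>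
    continuous_finsetSum _ fun i _ =>
      (continuous_softmaxWeight (by fun_prop) (by fun_prop) i).pow 2
  exact integral_mono (hc r).integrable_of_carried (hc w).integrable_of_carried fun x =>
    sum_softmaxWeight_sq_mono hr hrw y x

lemma attnNoise_nonneg (u : 𝔼) : 0 ≤ attnNoise m n u :=
  integral_nonneg fun _ => Finset.sum_nonneg fun _ _ => sq_nonneg _

lemma attnBias_nonneg (y u : 𝔼) : 0 ≤ attnBias m n y u :=
  integral_nonneg fun _ => integral_nonneg fun _ => reluGap_nonneg _ _ _ _

lemma integral_gaussKer_sq_le (s : ℝ) (y : 𝔼) :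
    ∫ x, gaussKer s y x ^ 2 ∂sphereUniform (m + 1) ≤ ∫ x, gaussKer s y x ∂sphereUniform (m + 1) :=
  integral_mono (Continuous.integrable_of_carried (by fun_prop))
    (Continuous.integrable_of_carried (by fun_prop)) fun x => by
      have := gaussKer_pos s y x
      have := gaussKer_le_one s y x
      dsimp only
      nlinarith

lemma exists_le_attnNoise (m : ℕ) :
    ∃ c c' : ℝ, 0 < c ∧ 0 < c' ∧ ∀ (n : ℕ) (y : EuclideanSpace ℝ (Fin (m + 1))) (s : ℝ), ‖y‖ = 1 →
      1 ≤ s → s ^ m ≤ c' * n → c * s ^ m / n ≤ attnNoise m n (s ^ 2 • y) := by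
  obtain ⟨C, hC, hZ⟩ := exists_integral_dist_pow_mul_gaussKer_le m 0
  obtain ⟨c, hc, hZ2⟩ := exists_le_integral_gaussKer m
  refine ⟨c / (2 * C ^ 2), c / 4, by positivity, by positivity, fun n y s hy hs hn => ?_⟩
  have hs0 : 0 < s := one_pos.trans_le hs
  have hn0 : (0 : ℝ) < n := by
    have : 0 < s ^ m := by positivity
    nlinarith
  have : NeZero n := ⟨by rintro rfl; simp at hn0⟩
  have hZ := hZ y hy s hs0
  have hZ2 := hZ2 y hy s hs
  have hle := integral_gaussKer_sq_le s y
  simp only [add_zero, pow_zero, one_mul] at hZ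
  set Z := ∫ x, gaussKer s y x ∂sphereUniform (m + 1)
  set Z2 := ∫ x, gaussKer s y x ^ 2 ∂sphereUniform (m + 1)
  have hsm : 0 < s ^ m := by positivity
  have hcZ : c ≤ s ^ m * Z := hZ2.trans (mul_le_mul_of_nonneg_left hle hsm.le)
  have hZ0 : 0 < Z := by
    by_contra h
    nlinarith
  rw [attnNoise_eq_gaussKer s hy]
  refine le_trans ?_ (le_integral_sum_sq_div_sq (continuous_gaussKer s y) (gaussKer_pos s y)
    (gaussKer_le_one s y) ?_)
  · rw [div_le_div_iff₀ (by positivity) (by positivity), ← sub_nonneg]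
    have e1 : (s ^ m * Z) ^ 2 ≤ C ^ 2 := pow_le_pow_left₀ (by positivity) hZ 2
    have : c / (2 * C ^ 2) * s ^ m * (2 * n * Z ^ 2) ≤ Z2 * n := by
      calc c / (2 * C ^ 2) * s ^ m * (2 * n * Z ^ 2) =
          c * n * ((s ^ m * Z) ^ 2) / (C ^ 2 * s ^ m) := by field_simp
        _ ≤ c * n * C ^ 2 / (C ^ 2 * s ^ m) := by gcongr
        _ = c / s ^ m * n := by field_simp
        _ ≤ Z2 * n := by
          gcongr
          rw [div_le_iff₀ hsm]
          linarith
    exact sub_nonneg.2 this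
  · have : 4 * s ^ m ≤ s ^ m * (n * Z) := by nlinarith
    exact le_of_mul_le_mul_left (by linarith) hsm

lemma sq_integral_mul_le {X : Type*} [TopologicalSpace X] [MeasurableSpace X]
    [OpensMeasurableSpace X] [T2Space X] [TopologicalSpace.PseudoMetrizableSpace X] {μ : Measure X}
    [IsFiniteMeasure μ] [IsCompactlyCarried μ] {f E : X → ℝ} (hf : Continuous f)
    (hE : Continuous E) (h0 : ∀ x, 0 ≤ E x) (hZ : 0 < ∫ x, E x ∂μ) :
    (∫ x, f x * E x ∂μ) ^ 2 ≤ (∫ x, E x ∂μ) * ∫ x, f x ^ 2 * E x ∂μ := by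
  set Z := ∫ x, E x ∂μ
  set a := ∫ x, f x * E x ∂μ
  have h1 : 0 ≤ ∫ x, (Z ^ 2 * (f x ^ 2 * E x) - 2 * Z * a * (f x * E x) + a ^ 2 * E x) ∂μ :=
    integral_nonneg fun x => by
      have : 0 ≤ (Z * f x - a) ^ 2 * E x := mul_nonneg (sq_nonneg _) (h0 x)
      simp only [Pi.zero_apply]
      nlinarith
  rw [integral_add (Continuous.integrable_of_carried (by fun_prop))
    (Continuous.integrable_of_carried (by fun_prop)),
    integral_sub (Continuous.integrable_of_carried (by fun_prop))
    (Continuous.integrable_of_carried (by fun_prop)), integral_const_mul, integral_const_mul,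
    integral_const_mul] at h1
  have h2 : 0 ≤ Z * (Z * (∫ x, f x ^ 2 * E x ∂μ) - a ^ 2) := by
    change 0 ≤ Z ^ 2 * _ - 2 * Z * a * a + a ^ 2 * Z at h1
    linarith
  have := nonneg_of_mul_nonneg_right h2 hZ
  linarith

lemma exists_integral_inner_sq_eq (m : ℕ) :
    ∃ c : ℝ, 0 < c ∧ ∀ q : EuclideanSpace ℝ (Fin (m + 1)),
      ∫ v, (inner ℝ v q) ^ 2 ∂sphereUniform (m + 1) = c * ‖q‖ ^ 2 := by
  have he : ‖(EuclideanSpace.single 0 1 : EuclideanSpace ℝ (Fin (m + 1)))‖ = 1 := by simp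
  set e : EuclideanSpace ℝ (Fin (m + 1)) := EuclideanSpace.single 0 1
  refine ⟨∫ v, (inner ℝ v e) ^ 2 ∂sphereUniform (m + 1), ?_, fun q => ?_⟩
  · refine integral_pos_of_mem_support (a := e) (by fun_prop)
      (Continuous.integrable_of_carried (by fun_prop))
      (Filter.Eventually.of_forall fun x => sq_nonneg _) (mem_support_sphereUniform he) ?_
    rw [real_inner_self_eq_norm_sq, he]
    norm_num
  · rw [integral_inner_sq_eq (z := ‖q‖ • e) (by rw [norm_smul, he, norm_norm, mul_one])]
    simp_rw [inner_smul_right, mul_pow]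
    rw [integral_const_mul, mul_comm]

lemma inner_sq_le_two_mul_reluGap {V ι : Type*} [NormedAddCommGroup V] [InnerProductSpace ℝ V]
    [Fintype ι] [Nonempty ι] (y u : V) (x : ι → V) (v : V) :
    (inner ℝ v (∑ i, softmaxWeight u x i • (x i - y))) ^ 2 ≤ 2 * reluGap y u x v := by
  have h1 : ∀ t : ℝ, max t 0 - max (-t) 0 = t := fun t => by
    rcases le_total t 0 with h | h
    · rw [max_eq_right h, max_eq_left (by linarith)]; ring
    · rw [max_eq_left h, max_eq_right (by linarith)]; ring
  have h2 : inner ℝ v (∑ i, softmaxWeight u x i • (x i - y)) =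
      softmaxGap (fun t => max t 0) y u x v - softmaxGap (fun t => max (-t) 0) y u x v := by
    simp_rw [inner_sum, inner_smul_right, inner_sub_right, mul_sub, Finset.sum_sub_distrib]
    rw [← Finset.sum_mul, sum_softmaxWeight, one_mul, softmaxGap, softmaxGap, sub_sub_sub_comm,
      h1, ← Finset.sum_sub_distrib]
    simp_rw [← mul_sub, h1]
  rw [h2, reluGap]
  nlinarith [sq_nonneg (softmaxGap (fun t => max t 0) y u x v +
    softmaxGap (fun t => max (-t) 0) y u x v)]

/-- The bias is controlled from below by the mean squared distance of the attended point. -/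
lemma exists_mul_sq_le_attnBias (m : ℕ) :
    ∃ c : ℝ, 0 < c ∧ ∀ (n : ℕ) [NeZero n] (y : EuclideanSpace ℝ (Fin (m + 1))) (s : ℝ), ‖y‖ = 1 →
      c * (∫ x : Fin n → EuclideanSpace ℝ (Fin (m + 1)),
        (∑ i, dist (x i) y ^ 2 * gaussKer s y (x i)) / ∑ i, gaussKer s y (x i)
          ∂(Measure.pi fun _ => sphereUniform (m + 1))) ^ 2 ≤ attnBias m n y (s ^ 2 • y) := by
  obtain ⟨c, hc, hcq⟩ := exists_integral_inner_sq_eq m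
  refine ⟨c / 8, by positivity, fun n _ y s hy => ?_⟩
  have hS : ∀ x : Fin n → EuclideanSpace ℝ (Fin (m + 1)), 0 < ∑ i, gaussKer s y (x i) := fun x =>
    Finset.sum_pos (fun _ _ => gaussKer_pos _ _ _) Finset.univ_nonempty
  have hcont : Continuous fun x : Fin n → EuclideanSpace ℝ (Fin (m + 1)) =>
      (∑ i, dist (x i) y ^ 2 * gaussKer s y (x i)) / ∑ i, gaussKer s y (x i) :=
    Continuous.div (by fun_prop) (by fun_prop) fun x => (hS x).ne'
  have h1 := sq_integral_mul_le (μ := Measure.pi fun _ : Fin n => sphereUniform (m + 1)) hcont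
    (continuous_const (y := (1 : ℝ))) (fun _ => zero_le_one) (by simp)
  simp only [mul_one, integral_const, probReal_univ, smul_eq_mul, one_mul] at h1
  refine (mul_le_mul_of_nonneg_left h1 (by positivity)).trans ?_
  rw [← integral_const_mul]
  refine integral_mono_ae (hcont.pow 2 |>.const_mul _).integrable_of_carried
    (Continuous.integral_of_carried (f := fun x v => reluGap y (s ^ 2 • y) x v)
      (continuous_reluGap (by fun_prop) (by fun_prop) (by fun_prop)
        (by fun_prop))).integrable_of_carried ?_
  filter_upwards [ae_forall_norm_eq_one m n] with x hx
  set q := ∑ i, softmaxWeight (s ^ 2 • y) x i • (x i - y) with hq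
  have h2 : ∫ v, (inner ℝ v q) ^ 2 ∂sphereUniform (m + 1) ≤
      ∫ v, 2 * reluGap y (s ^ 2 • y) x v ∂sphereUniform (m + 1) :=
    integral_mono (Continuous.integrable_of_carried (by fun_prop))
      ((continuous_reluGap (by fun_prop) (by fun_prop) (by fun_prop)
        (by fun_prop)).const_mul _).integrable_of_carried fun v =>
          inner_sq_le_two_mul_reluGap y (s ^ 2 • y) x v
  rw [hcq, integral_const_mul] at h2
  have h3 : inner ℝ q y = -(1 / 2) * ((∑ i, dist (x i) y ^ 2 * gaussKer s y (x i)) /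
      ∑ i, gaussKer s y (x i)) := by
    rw [hq, sum_inner, Finset.sum_div, Finset.mul_sum]
    refine Finset.sum_congr rfl fun i _ => ?_
    rw [real_inner_smul_left, inner_sub_left, real_inner_self_eq_norm_sq, hy,
      softmaxWeight_eq_gaussKer s hy hx, dist_sq_eq_of_norm_eq_one (hx i) hy]
    ring
  have h4 : (inner ℝ q y) ^ 2 ≤ ‖q‖ ^ 2 := by
    have := abs_real_inner_le_norm q y
    rw [hy, mul_one] at this
    rw [← sq_abs]
    exact pow_le_pow_left₀ (abs_nonneg _) this 2
  rw [h3] at h4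
  nlinarith [mul_le_mul_of_nonneg_left h4 hc.le]

lemma div_sq_le_div_of_le_pow_mul {m : ℕ} {c c₂ K r t k Z z : ℝ} (hr1 : 1 ≤ r) (hrt : r ≤ t)
    (hc : 0 < c) (hc₂ : 0 < c₂) (hK : 0 < K) (hZ : Z ≤ K / r ^ m) (hcZ : c ≤ r ^ m * Z)
    (hcz : c₂ ≤ r ^ (m + 2) * z) (hk : t ^ m ≤ c / 2 * k) :
    2 ≤ k * Z ∧ c₂ / (2 * K) / t ^ 2 ≤ z / (2 * Z) := by
  have hr0 : 0 < r := one_pos.trans_le hr1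
  have ht0 : 0 < t := hr0.trans_le hrt
  have hrm : r ^ m ≤ t ^ m := pow_le_pow_left₀ hr0.le hrt m
  have hZ0 : 0 < Z := pos_of_mul_pos_right (hc.trans_le hcZ) (by positivity)
  constructor
  · have h6 : c ≤ t ^ m * Z := hcZ.trans (mul_le_mul_of_nonneg_right hrm hZ0.le)
    have hk0 : 0 < k := pos_of_mul_pos_right ((pow_pos ht0 m).trans_le hk) (by positivity)
    have : t ^ m * 2 ≤ t ^ m * (k * Z) := by
      linarith [mul_le_mul_of_nonneg_left h6 hk0.le]
    exact le_of_mul_le_mul_left this (by positivity)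
  · calc c₂ / (2 * K) / t ^ 2 ≤ c₂ / (2 * K) / r ^ 2 :=
          div_le_div_of_nonneg_left (by positivity) (by positivity)
            (pow_le_pow_left₀ hr0.le hrt 2)
      _ = c₂ / r ^ (m + 2) / (2 * (K / r ^ m)) := by rw [pow_add]; field_simp
      _ ≤ z / (2 * Z) := by
        have h1 : c₂ / r ^ (m + 2) ≤ z := by
          rw [div_le_iff₀ (by positivity)]
          linarith
        exact div_le_div₀ ((div_pos hc₂ (by positivity)).le.trans h1) h1 (by positivity)
          (by linarith)

lemma exists_div_sq_le_integral_ratio (m : ℕ) (hm : 1 ≤ m) :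
    ∃ c c' : ℝ, 0 < c ∧ 0 < c' ∧ ∀ (k : ℝ) (y : EuclideanSpace ℝ (Fin (m + 1))) (s t : ℝ),
      ‖y‖ = 1 → 0 ≤ s → s ≤ t → 1 ≤ t → t ^ m ≤ c' * k →
      2 ≤ k * (∫ x, gaussKer s y x ∂sphereUniform (m + 1)) ∧
      c / t ^ 2 ≤ (∫ x, dist x y ^ 2 * gaussKer s y x ∂sphereUniform (m + 1)) /
        (2 * ∫ x, gaussKer s y x ∂sphereUniform (m + 1)) := by
  obtain ⟨C, hC, hZ⟩ := exists_integral_dist_pow_mul_gaussKer_le m 0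
  obtain ⟨c, hc, hZ2⟩ := exists_le_integral_gaussKer m
  obtain ⟨c₂, hc₂, hz⟩ := exists_le_integral_dist_sq_mul_gaussKer m hm
  refine ⟨c₂ / (2 * max C 1), c / 2, by positivity, by positivity,
    fun k y s t hy hs0 hst ht hk => ?_⟩
  have hsr : s ≤ max s 1 := le_max_left _ _
  have hmono : ∀ x, gaussKer (max s 1) y x ≤ gaussKer s y x := fun x =>
    exp_le_exp.2 (by gcongr)
  have hr1 : 1 ≤ max s 1 := le_max_right _ _
  have hZle : ∫ x, gaussKer s y x ∂sphereUniform (m + 1) ≤ max C 1 / (max s 1) ^ m := by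
    rcases le_total s 1 with h | h
    · rw [max_eq_right h, one_pow, div_one]
      refine le_trans ?_ (le_max_right _ _)
      have := integral_mono (μ := sphereUniform (m + 1))
        (continuous_gaussKer s y).integrable_of_carried
        (integrable_const 1) fun x => gaussKer_le_one s y x
      simpa using this
    · rw [max_eq_left h, le_div_iff₀ (by positivity)]
      have := hZ y hy s (by linarith)
      simp only [add_zero, pow_zero, one_mul] at this
      refine le_trans ?_ (this.trans (le_max_left _ _))
      rw [mul_comm]
  have h4 : ∫ x, gaussKer (max s 1) y x ∂sphereUniform (m + 1) ≤
      ∫ x, gaussKer s y x ∂sphereUniform (m + 1) :=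
    integral_mono (continuous_gaussKer _ y).integrable_of_carried
      (continuous_gaussKer _ y).integrable_of_carried hmono
  have h5 : ∫ x, dist x y ^ 2 * gaussKer (max s 1) y x ∂sphereUniform (m + 1) ≤
      ∫ x, dist x y ^ 2 * gaussKer s y x ∂sphereUniform (m + 1) :=
    integral_mono (Continuous.integrable_of_carried (by fun_prop))
      (Continuous.integrable_of_carried (by fun_prop)) fun x =>
        mul_le_mul_of_nonneg_left (hmono x) (by positivity)
  exact div_sq_le_div_of_le_pow_mul hr1 (max_le hst ht) hc hc₂ (by positivity) hZle
    ((hZ2 y hy _ hr1).trans (mul_le_mul_of_nonneg_left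
      ((integral_gaussKer_sq_le _ y).trans h4) (by positivity)))
    ((hz y hy _ hr1).trans (mul_le_mul_of_nonneg_left h5 (by positivity))) hk

lemma exists_le_attnBias (m : ℕ) (hm : 1 ≤ m) :
    ∃ c c' : ℝ, 0 < c ∧ 0 < c' ∧ ∀ (n : ℕ) (y : EuclideanSpace ℝ (Fin (m + 1))) (s t : ℝ),
      ‖y‖ = 1 → 0 ≤ s → s ≤ t → 1 ≤ t → t ^ m ≤ c' * n →
        c / t ^ 4 ≤ attnBias m n y (s ^ 2 • y) := by
  obtain ⟨b, hb, hbias⟩ := exists_mul_sq_le_attnBias m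
  obtain ⟨c, c', hc, hc', key⟩ := exists_div_sq_le_integral_ratio m hm
  refine ⟨b * c ^ 2, c', by positivity, hc', fun n y s t hy hs0 hst ht hn => ?_⟩
  have ht0 : 0 < t := one_pos.trans_le ht
  obtain ⟨hnZ, h⟩ := key n y s t hy hs0 hst ht hn
  have : NeZero n := ⟨by rintro rfl; norm_num at hnZ⟩
  have h1 := h.trans (le_integral_sum_mul_div (n := n) (continuous_gaussKer s y) (gaussKer_pos s y)
    (gaussKer_le_one s y) (τ := fun x => dist x y ^ 2) (by fun_prop) (fun _ => sq_nonneg _) hnZ)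
  refine le_trans ?_ (hbias n y s hy)
  calc b * c ^ 2 / t ^ 4 = b * (c / t ^ 2) ^ 2 := by rw [div_pow _ (t ^ 2)]; ring
    _ ≤ _ := mul_le_mul_of_nonneg_left (pow_le_pow_left₀ (by positivity) h1 2) hb.le

/-- The ReLU function agrees with one of its linear branches up to an error that is only present
if the two points lie on different sides of the kink. -/
lemma exists_sq_max_sub_max_sub_le (a b r : ℝ) (h : |b - a| ≤ r) :
    (max b 0 - max a 0 - (if 0 < a then 1 else 0) * (b - a)) ^ 2 ≤ max (r - |a|) 0 ^ 2 := by
  refine sq_le_sq' ?_ ?_ <;> split_ifs with ha <;> have h1 := le_max_left (r - |a|) 0 <;>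
    have h2 := le_max_right (r - |a|) 0 <;> rcases abs_le.1 h with ⟨h3, h4⟩ <;>
    rcases max_cases b 0 with ⟨h5, _⟩ | ⟨h5, _⟩ <;> rcases max_cases a 0 with ⟨h6, _⟩ | ⟨h6, _⟩ <;>
    rcases abs_cases a with ⟨h7, _⟩ | ⟨h7, _⟩ <;> rw [h5, h6] <;> linarith

/-- By reflection symmetry the mean displacement of a Gaussian weight is radial. -/
lemma integral_inner_sub_mul_gaussKer (s : ℝ) {y : 𝔼} (hy : ‖y‖ = 1) (v : 𝔼) :
    ∫ x, (inner ℝ v x - inner ℝ v y) * gaussKer s y x ∂sphereUniform (m + 1) =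
      -(inner ℝ v y / 2) * ∫ x, dist x y ^ 2 * gaussKer s y x ∂sphereUniform (m + 1) := by
  set T : 𝔼 ≃ₗᵢ[ℝ] 𝔼 := (Submodule.span ℝ {y}).reflection
  have hTa : ∀ x, T x = (2 * inner ℝ y x : ℝ) • y - x := fun x => by
    simp only [T, Submodule.reflection_singleton_apply, hy]
    simp [two_smul, two_mul, add_smul]
  have hTy : T y = y := by
    rw [hTa, real_inner_self_eq_norm_sq, hy]
    module
  have hker : ∀ x, gaussKer s y (T x) = gaussKer s y x := fun x => by
    have : dist (T x) y = dist x y := by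
      conv_lhs => rw [← hTy]
      exact T.dist_map x y
    rw [gaussKer, gaussKer, this]
  have h1 := (measurePreserving_sphereUniform T).integral_comp
    T.toHomeomorph.measurableEmbedding
      fun x => (inner ℝ v x - inner ℝ v y) * gaussKer s y x
  have h2 : ∫ x, (inner ℝ v (T x) - inner ℝ v y) * gaussKer s y (T x) ∂sphereUniform (m + 1) +
      ∫ x, (inner ℝ v x - inner ℝ v y) * gaussKer s y x ∂sphereUniform (m + 1) =
      -inner ℝ v y * ∫ x, dist x y ^ 2 * gaussKer s y x ∂sphereUniform (m + 1) := by
    simp_rw [hker, hTa]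
    rw [← integral_add (Continuous.integrable_of_carried (by fun_prop))
      (Continuous.integrable_of_carried (by fun_prop)), ← integral_const_mul]
    refine integral_congr_ae ?_
    filter_upwards [ae_norm_eq_one (m + 1)] with x hx
    rw [dist_sq_eq_of_norm_eq_one hx hy, inner_sub_right, real_inner_smul_right,
      real_inner_comm y x]
    ring
  have h3 : ∫ x, (inner ℝ v (T x) - inner ℝ v y) * gaussKer s y (T x) ∂sphereUniform (m + 1) =
      ∫ x, (inner ℝ v x - inner ℝ v y) * gaussKer s y x ∂sphereUniform (m + 1) := h1
  linarith

/-- The squared mean displacement of a ReLU under a Gaussian weight. -/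
lemma sq_integral_relu_sub_mul_gaussKer_le (s : ℝ) {y v : 𝔼} (hy : ‖y‖ = 1) (hv : ‖v‖ = 1) :
    (∫ x, (max (inner ℝ v x) 0 - max (inner ℝ v y) 0) * gaussKer s y x ∂sphereUniform (m + 1)) ^ 2 ≤
      2 * ((∫ x, dist x y ^ 2 * gaussKer s y x ∂sphereUniform (m + 1)) ^ 2 +
        (∫ x, gaussKer s y x ∂sphereUniform (m + 1)) *
          ∫ x, max (dist x y - |inner ℝ v y|) 0 ^ 2 * gaussKer s y x ∂sphereUniform (m + 1)) := by
  set a : ℝ := inner ℝ v y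
  set c : ℝ := if 0 < a then 1 else 0
  have hc0 : |c| ≤ 1 := by simp only [c]; split_ifs <;> simp
  have ha : |a| ≤ 1 := by simpa [hv, hy] using abs_real_inner_le_norm v y
  have h1 : ∫ x, (max (inner ℝ v x) 0 - max a 0) * gaussKer s y x ∂sphereUniform (m + 1) =
      c * ∫ x, (inner ℝ v x - a) * gaussKer s y x ∂sphereUniform (m + 1) +
        ∫ x, (max (inner ℝ v x) 0 - max a 0 - c * (inner ℝ v x - a)) * gaussKer s y x
          ∂sphereUniform (m + 1) := by
    rw [← integral_const_mul, ← integral_add (Continuous.integrable_of_carried (by fun_prop))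
      (Continuous.integrable_of_carried (by fun_prop))]
    exact integral_congr_ae (.of_forall fun x => by ring)
  have h2 := sq_integral_mul_le (μ := sphereUniform (m + 1))
    (f := fun x => max (inner ℝ v x) 0 - max a 0 - c * (inner ℝ v x - a)) (by fun_prop)
    (continuous_gaussKer s y) (fun x => (gaussKer_pos s y x).le)
    (integral_pos_of_continuous (continuous_gaussKer s y) (gaussKer_pos s y))
  have h3 : ∫ x, (max (inner ℝ v x) 0 - max a 0 - c * (inner ℝ v x - a)) ^ 2 * gaussKer s y x
        ∂sphereUniform (m + 1) ≤
      ∫ x, max (dist x y - |a|) 0 ^ 2 * gaussKer s y x ∂sphereUniform (m + 1) := by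
    refine integral_mono (Continuous.integrable_of_carried (by fun_prop))
      (Continuous.integrable_of_carried (by fun_prop)) fun x =>
        mul_le_mul_of_nonneg_right (exists_sq_max_sub_max_sub_le _ _ _ ?_) (gaussKer_pos s y x).le
    rw [← inner_sub_right, dist_eq_norm]
    simpa [hv] using abs_real_inner_le_norm v (x - y)
  have hZ := (integral_pos_of_continuous (continuous_gaussKer s y) (gaussKer_pos s y)).le
  rw [h1, integral_inner_sub_mul_gaussKer s hy]
  have h4 := h2.trans (mul_le_mul_of_nonneg_left h3 hZ)
  refine (add_sq_le (R := ℝ)).trans (mul_le_mul_of_nonneg_left (add_le_add ?_ h4) two_pos.le)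
  rw [← mul_assoc, mul_pow]
  have h5 : (c * -(a / 2)) ^ 2 ≤ 1 := by
    rw [sq_le_one_iff_abs_le_one, abs_mul, abs_neg, abs_div, abs_two]
    nlinarith [abs_nonneg c, abs_nonneg a]
  exact mul_le_of_le_one_left (sq_nonneg _) h5

lemma softmaxGap_eq_sum_div {ι : Type*} [Fintype ι] [Nonempty ι] (g : ℝ → ℝ) (s : ℝ) {y : 𝔼}
    (hy : ‖y‖ = 1) {x : ι → 𝔼} (hx : ∀ i, ‖x i‖ = 1) (v : 𝔼) :
    softmaxGap g y (s ^ 2 • y) x v =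
      (∑ i, (g (inner ℝ v (x i)) - g (inner ℝ v y)) * gaussKer s y (x i)) /
        ∑ i, gaussKer s y (x i) := by
  have h1 : g (inner ℝ v y) = ∑ i, softmaxWeight (s ^ 2 • y) x i * g (inner ℝ v y) := by
    rw [← Finset.sum_mul, sum_softmaxWeight, one_mul]
  rw [softmaxGap, h1, ← Finset.sum_sub_distrib, Finset.sum_div]
  refine Finset.sum_congr rfl fun i _ => ?_
  rw [softmaxWeight_eq_gaussKer s hy hx, ← h1]
  ring

lemma softmaxGap_neg_branch {V ι : Type*} [NormedAddCommGroup V] [InnerProductSpace ℝ V]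
    [Fintype ι] (y u : V) (x : ι → V) (v : V) :
    softmaxGap (fun t => max (-t) 0) y u x v = softmaxGap (fun t => max t 0) y u x (-v) := by
  simp [softmaxGap]

/-- The mean squared prediction error on one ReLU. -/
lemma integral_softmaxGap_sq_le [NeZero n] (s : ℝ) {y v : 𝔼} (hy : ‖y‖ = 1) (hv : ‖v‖ = 1) :
    ∫ x : Fin n → 𝔼, softmaxGap (fun t => max t 0) y (s ^ 2 • y) x v ^ 2
        ∂(Measure.pi fun _ => sphereUniform (m + 1)) ≤
      4 * ((∫ x, dist x y ^ 2 * gaussKer s y x ∂sphereUniform (m + 1)) /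
          (n * (∫ x, gaussKer s y x ∂sphereUniform (m + 1)) ^ 2) +
        2 * ((∫ x, dist x y ^ 2 * gaussKer s y x ∂sphereUniform (m + 1)) ^ 2 +
        (∫ x, gaussKer s y x ∂sphereUniform (m + 1)) *
          ∫ x, max (dist x y - |inner ℝ v y|) 0 ^ 2 * gaussKer s y x ∂sphereUniform (m + 1)) /
        (∫ x, gaussKer s y x ∂sphereUniform (m + 1)) ^ 2) +
      2 ^ 2 * exp (-(n * (∫ x, gaussKer s y x ∂sphereUniform (m + 1)) / 8)) := by
  have hg : ∀ x, |max (inner ℝ v x) 0 - max (inner ℝ v y) 0| ≤ dist x y := fun x => by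
    refine (abs_max_sub_max_le_abs _ _ _).trans ?_
    rw [← inner_sub_right, dist_eq_norm]
    simpa [hv] using abs_real_inner_le_norm v (x - y)
  have h1 := integral_sum_mul_div_sq_le (n := n) (continuous_gaussKer s y) (gaussKer_pos s y)
    (gaussKer_le_one s y) (g := fun x => max (inner ℝ v x) 0 - max (inner ℝ v y) 0) (by fun_prop)
    (G := 2) fun x hx => (hg x).trans ((dist_le_norm_add_norm x y).trans (by rw [hx, hy]; norm_num))
  have h2 : ∫ x, (max (inner ℝ v x) 0 - max (inner ℝ v y) 0) ^ 2 * gaussKer s y x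
      ∂sphereUniform (m + 1) ≤ ∫ x, dist x y ^ 2 * gaussKer s y x ∂sphereUniform (m + 1) :=
    integral_mono (Continuous.integrable_of_carried (by fun_prop))
      (Continuous.integrable_of_carried (by fun_prop)) fun x =>
        mul_le_mul_of_nonneg_right (sq_le_sq' (abs_le.1 (hg x)).1 (abs_le.1 (hg x)).2)
          (gaussKer_pos s y x).le
  have h3 := sq_integral_relu_sub_mul_gaussKer_le s hy hv
  have h4 : ∫ x : Fin n → 𝔼, softmaxGap (fun t => max t 0) y (s ^ 2 • y) x v ^ 2
        ∂(Measure.pi fun _ => sphereUniform (m + 1)) =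
      ∫ x : Fin n → 𝔼, ((∑ i, (max (inner ℝ v (x i)) 0 - max (inner ℝ v y) 0) *
        gaussKer s y (x i)) / ∑ i, gaussKer s y (x i)) ^ 2
          ∂(Measure.pi fun _ => sphereUniform (m + 1)) := by
    refine integral_congr_ae ?_
    filter_upwards [ae_forall_norm_eq_one m n] with x hx
    rw [softmaxGap_eq_sum_div _ s hy hx]
  rw [h4]
  refine h1.trans (add_le_add_left (mul_le_mul_of_nonneg_left (add_le_add ?_ ?_) (by norm_num)) _)
  · exact div_le_div_of_nonneg_right h2 (by positivity)
  · rw [div_pow]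
    exact div_le_div_of_nonneg_right h3 (sq_nonneg _)

/-- Averaging over the direction of the kink. -/
lemma exists_integral_kink_le (m : ℕ) (hm : 1 ≤ m) :
    ∃ C : ℝ, 0 < C ∧ ∀ (y : EuclideanSpace ℝ (Fin (m + 1))) (s : ℝ), ‖y‖ = 1 →
      ∫ v, ∫ x, max (dist x y - |inner ℝ v y|) 0 ^ 2 * gaussKer s y x
          ∂sphereUniform (m + 1) ∂sphereUniform (m + 1) ≤
        C * ∫ x, dist x y ^ 3 * gaussKer s y x ∂sphereUniform (m + 1) := by
  obtain ⟨C, hC, hslab⟩ := exists_sphereUniform_slab_le m hm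
  refine ⟨C, hC, fun y s hy => ?_⟩
  have hr : ∀ r : ℝ, 0 ≤ r →
      ∫ v, max (r - |inner ℝ v y|) 0 ^ 2 ∂sphereUniform (m + 1) ≤ C * r ^ 3 := fun r hr => by
    have hms : MeasurableSet {v : EuclideanSpace ℝ (Fin (m + 1)) | |inner ℝ v y| ≤ r} :=
      (isClosed_le (by fun_prop) (by fun_prop)).measurableSet
    calc ∫ v, max (r - |inner ℝ v y|) 0 ^ 2 ∂sphereUniform (m + 1)
        ≤ ∫ v, Set.indicator {v | |inner ℝ v y| ≤ r} (fun _ => r ^ 2) v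
            ∂sphereUniform (m + 1) := by
          refine integral_mono (Continuous.integrable_of_carried (by fun_prop))
            ((integrable_const _).indicator hms) fun v => ?_
          by_cases hx : v ∈ {v | |inner ℝ v y| ≤ r}
          · rw [Set.indicator_of_mem hx]
            exact pow_le_pow_left₀ (le_max_right _ _)
              (max_le (by linarith [abs_nonneg (inner ℝ v y)]) hr) 2
          · rw [Set.indicator_of_notMem hx]
            rw [Set.mem_ofPred_eq, not_le] at hx
            simp only
            rw [max_eq_right (by linarith)]
            norm_num
      _ = (sphereUniform (m + 1)).real {v | |inner ℝ v y| ≤ r} * r ^ 2 := by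
          rw [integral_indicator_const _ hms, smul_eq_mul]
      _ ≤ C * r * r ^ 2 := mul_le_mul_of_nonneg_right (hslab y hy r hr) (sq_nonneg _)
      _ = C * r ^ 3 := by ring
  rw [integral_integral_swap (f := fun v x => max (dist x y - |inner ℝ v y|) 0 ^ 2 *
    gaussKer s y x) (Continuous.integrable_of_carried (by fun_prop)), ← integral_const_mul]
  refine integral_mono (Continuous.integral_of_carried (f := fun x v =>
    max (dist x y - |inner ℝ v y|) 0 ^ 2 * gaussKer s y x) (by fun_prop)).integrable_of_carried
    (Continuous.integrable_of_carried (by fun_prop)) fun x => ?_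
  simp only
  rw [integral_mul_const, ← mul_assoc]
  exact mul_le_mul_of_nonneg_right (hr _ dist_nonneg) (gaussKer_pos s y x).le

/-- The bias for a fixed direction of the kink. -/
lemma integral_reluGap_le [NeZero n] (s : ℝ) {y v : 𝔼} (hy : ‖y‖ = 1) (hv : ‖v‖ = 1) :
    ∫ x : Fin n → 𝔼, reluGap y (s ^ 2 • y) x v ∂(Measure.pi fun _ => sphereUniform (m + 1)) ≤
      16 * ((∫ x, dist x y ^ 2 * gaussKer s y x ∂sphereUniform (m + 1)) /
          (n * (∫ x, gaussKer s y x ∂sphereUniform (m + 1)) ^ 2) +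
        (∫ x, dist x y ^ 2 * gaussKer s y x ∂sphereUniform (m + 1)) ^ 2 /
          (∫ x, gaussKer s y x ∂sphereUniform (m + 1)) ^ 2 +
        exp (-(n * (∫ x, gaussKer s y x ∂sphereUniform (m + 1)) / 8))) +
      16 / (∫ x, gaussKer s y x ∂sphereUniform (m + 1)) *
        ∫ x, max (dist x y - |inner ℝ v y|) 0 ^ 2 * gaussKer s y x ∂sphereUniform (m + 1) := by
  have hZ := integral_pos_of_continuous (continuous_gaussKer s y) (gaussKer_pos s y)
  have hz : 0 ≤ ∫ x, dist x y ^ 2 * gaussKer s y x ∂sphereUniform (m + 1) :=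
    integral_nonneg fun x => mul_nonneg (sq_nonneg _) (gaussKer_pos s y x).le
  have h1 := integral_softmaxGap_sq_le (n := n) s hy hv
  have h2 := integral_softmaxGap_sq_le (n := n) s hy (v := -v) (by rwa [norm_neg])
  simp only [inner_neg_left, abs_neg] at h2
  have hcont : ∀ w : 𝔼, Continuous fun x : Fin n → 𝔼 =>
      softmaxGap (fun t => max t 0) y (s ^ 2 • y) x w := fun w =>
    continuous_softmaxGap (by fun_prop) (by fun_prop) (by fun_prop) (by fun_prop) (by fun_prop)
  have h3 : ∫ x : Fin n → 𝔼, reluGap y (s ^ 2 • y) x v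
        ∂(Measure.pi fun _ => sphereUniform (m + 1)) =
      ∫ x : Fin n → 𝔼, softmaxGap (fun t => max t 0) y (s ^ 2 • y) x v ^ 2
        ∂(Measure.pi fun _ => sphereUniform (m + 1)) +
      ∫ x : Fin n → 𝔼, softmaxGap (fun t => max t 0) y (s ^ 2 • y) x (-v) ^ 2
        ∂(Measure.pi fun _ => sphereUniform (m + 1)) := by
    simp only [reluGap, softmaxGap_neg_branch]
    exact integral_add ((hcont v).pow 2).integrable_of_carried
      ((hcont (-v)).pow 2).integrable_of_carried
  rw [h3]
  refine (add_le_add h1 h2).trans ?_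
  generalize ∫ x, gaussKer s y x ∂sphereUniform (m + 1) = Z at hZ ⊢
  generalize ∫ x, dist x y ^ 2 * gaussKer s y x ∂sphereUniform (m + 1) = z at hz ⊢
  generalize ∫ x, max (dist x y - |inner ℝ v y|) 0 ^ 2 * gaussKer s y x
    ∂sphereUniform (m + 1) = k
  have h5 : 2 * (z ^ 2 + Z * k) / Z ^ 2 = 2 * (z ^ 2 / Z ^ 2) + 2 / Z * k := by field_simp
  have h6 : 16 / Z * k = 8 * (2 / Z * k) := by ring
  have h7 : 0 ≤ z ^ 2 / Z ^ 2 := by positivity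
  have h8 := exp_pos (-(n * Z / 8))
  rw [h5, h6]
  have h9 : 0 ≤ z / (n * Z ^ 2) := by positivity
  linarith

lemma exists_attnBias_le_integral (m : ℕ) (hm : 1 ≤ m) :
    ∃ C : ℝ, 0 < C ∧ ∀ (n : ℕ) [NeZero n] (y : EuclideanSpace ℝ (Fin (m + 1))) (s : ℝ), ‖y‖ = 1 →
      attnBias m n y (s ^ 2 • y) ≤
        16 * ((∫ x, dist x y ^ 2 * gaussKer s y x ∂sphereUniform (m + 1)) /
          (n * (∫ x, gaussKer s y x ∂sphereUniform (m + 1)) ^ 2) +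
        (∫ x, dist x y ^ 2 * gaussKer s y x ∂sphereUniform (m + 1)) ^ 2 /
          (∫ x, gaussKer s y x ∂sphereUniform (m + 1)) ^ 2 +
        exp (-(n * (∫ x, gaussKer s y x ∂sphereUniform (m + 1)) / 8))) +
      16 / (∫ x, gaussKer s y x ∂sphereUniform (m + 1)) *
        (C * ∫ x, dist x y ^ 3 * gaussKer s y x ∂sphereUniform (m + 1)) := by
  obtain ⟨C, hC, hk⟩ := exists_integral_kink_le m hm
  refine ⟨C, hC, fun n _ y s hy => ?_⟩
  have hZ := integral_pos_of_continuous (continuous_gaussKer s y) (gaussKer_pos s y)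
  have hcont : Continuous (Function.uncurry fun (x : Fin n → EuclideanSpace ℝ (Fin (m + 1)))
      (v : EuclideanSpace ℝ (Fin (m + 1))) => reluGap y (s ^ 2 • y) x v) :=
    continuous_reluGap (by fun_prop) (by fun_prop) (by fun_prop) (by fun_prop)
  have hcont' : Continuous (Function.uncurry fun (v : EuclideanSpace ℝ (Fin (m + 1)))
      (x : Fin n → EuclideanSpace ℝ (Fin (m + 1))) => reluGap y (s ^ 2 • y) x v) :=
    continuous_reluGap (by fun_prop) (by fun_prop) (by fun_prop) (by fun_prop)
  rw [attnBias, integral_integral_swap hcont.integrable_of_carried]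
  have hkc : Continuous fun v : EuclideanSpace ℝ (Fin (m + 1)) =>
      ∫ x, max (dist x y - |inner ℝ v y|) 0 ^ 2 * gaussKer s y x ∂sphereUniform (m + 1) :=
    Continuous.integral_of_carried (f := fun v x =>
      max (dist x y - |inner ℝ v y|) 0 ^ 2 * gaussKer s y x) (by fun_prop)
  have hi := (hkc.const_mul (16 / ∫ x, gaussKer s y x ∂sphereUniform (m + 1))).integrable_of_carried
    (μ := sphereUniform (m + 1))
  refine (integral_mono_ae (Continuous.integral_of_carried hcont').integrable_of_carried
    ((integrable_const _).add hi)
    (by filter_upwards [ae_norm_eq_one (m + 1)] with v hv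
        using integral_reluGap_le s hy hv)).trans ?_
  simp only [Pi.add_apply]
  rw [integral_add (integrable_const _) hi, integral_const_mul, integral_const, probReal_univ,
    one_smul]
  rw [integral_const_mul]
  exact add_le_add_right (mul_le_mul_of_nonneg_left (hk y s hy) (by positivity)) _

/-- The real-number estimate behind the upper bound for the bias. -/
lemma exists_rate_le (m : ℕ) {c C C₂ C₃ : ℝ} (hc : 0 < c) (hC : 0 < C) (hC₂ : 0 < C₂)
    (hC₃ : 0 < C₃) :
    ∃ K : ℝ, 0 < K ∧ ∀ k s Z z₂ z₃ : ℝ, 1 ≤ s → s ^ (m + 1) ≤ k → c ≤ s ^ m * Z → 0 ≤ z₂ →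
      s ^ (m + 2) * z₂ ≤ C₂ → s ^ (m + 3) * z₃ ≤ C₃ →
      16 * (z₂ / (k * Z ^ 2) + z₂ ^ 2 / Z ^ 2 + exp (-(k * Z / 8))) + 16 / Z * (C * z₃) ≤
        K / s ^ 3 := by
  refine ⟨16 * (C₂ / c ^ 2 + (C₂ / c) ^ 2 + 3072 / c ^ 3) + 16 * (C * C₃ / c), by positivity,
    fun k s Z z₂ z₃ hs hk hZ hz₂ h2 h3 => ?_⟩
  have hs0 : 0 < s := one_pos.trans_le hs
  have hsm : 0 < s ^ m := by positivity
  have hZ0 : 0 < Z := pos_of_mul_pos_right (hc.trans_le hZ) hsm.le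
  have hk0 : 0 < k := lt_of_lt_of_le (by positivity) hk
  have hZi : 1 / Z ≤ s ^ m / c := by
    rw [div_le_div_iff₀ hZ0 hc]; linarith
  have hq2 : z₂ ≤ C₂ / s ^ (m + 2) := by
    rw [le_div_iff₀ (by positivity)]; linarith
  have hq3 : z₃ ≤ C₃ / s ^ (m + 3) := by
    rw [le_div_iff₀ (by positivity)]; linarith
  have hki : 1 / k ≤ 1 / s ^ (m + 1) := one_div_le_one_div_of_le (by positivity) hk
  have e1 : z₂ / (k * Z ^ 2) ≤ C₂ / c ^ 2 / s ^ 3 := by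
    calc z₂ / (k * Z ^ 2) = z₂ * (1 / k) * (1 / Z) ^ 2 := by field_simp
      _ ≤ C₂ / s ^ (m + 2) * (1 / s ^ (m + 1)) * (s ^ m / c) ^ 2 := by gcongr
      _ = C₂ / c ^ 2 / s ^ 3 := by field_simp; ring
  have e2 : z₂ ^ 2 / Z ^ 2 ≤ (C₂ / c) ^ 2 / s ^ 3 := by
    calc z₂ ^ 2 / Z ^ 2 = z₂ ^ 2 * (1 / Z) ^ 2 := by field_simp
      _ ≤ (C₂ / s ^ (m + 2)) ^ 2 * (s ^ m / c) ^ 2 := by gcongr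
      _ = (C₂ / c) ^ 2 / s ^ 4 := by field_simp; ring
      _ ≤ (C₂ / c) ^ 2 / s ^ 3 := by gcongr; norm_num
  have e3 : exp (-(k * Z / 8)) ≤ 3072 / c ^ 3 / s ^ 3 := by
    have h4 : c * s ≤ k * Z := by
      calc c * s ≤ s ^ m * Z * s := by gcongr
        _ = s ^ (m + 1) * Z := by ring
        _ ≤ k * Z := by gcongr
    have h5 := pow_div_factorial_le_exp (k * Z / 8) (by positivity) 3
    rw [exp_neg, inv_eq_one_div, div_div, div_le_div_iff₀ (exp_pos _) (by positivity)]
    have h6 : (c * s) ^ 3 ≤ (k * Z) ^ 3 := by gcongr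
    norm_num [Nat.factorial] at h5
    nlinarith
  have e4 : 16 / Z * (C * z₃) ≤ 16 * (C * C₃ / c) / s ^ 3 := by
    calc 16 / Z * (C * z₃) = 16 * C * (1 / Z) * z₃ := by ring
      _ ≤ 16 * C * (1 / Z) * (C₃ / s ^ (m + 3)) := by gcongr
      _ ≤ 16 * C * (s ^ m / c) * (C₃ / s ^ (m + 3)) := by gcongr
      _ = 16 * (C * C₃ / c) / s ^ 3 := by field_simp; ring
  calc _ ≤ 16 * (C₂ / c ^ 2 / s ^ 3 + (C₂ / c) ^ 2 / s ^ 3 + 3072 / c ^ 3 / s ^ 3) +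
        16 * (C * C₃ / c) / s ^ 3 := by linarith
    _ = _ := by ring

/-- The bias decays like the cube of the bandwidth. -/
lemma exists_attnBias_le (m : ℕ) (hm : 1 ≤ m) :
    ∃ C : ℝ, 0 < C ∧ ∀ (n : ℕ) (y : EuclideanSpace ℝ (Fin (m + 1))) (s : ℝ), ‖y‖ = 1 → 1 ≤ s →
      s ^ (m + 1) ≤ n → attnBias m n y (s ^ 2 • y) ≤ C / s ^ 3 := by
  obtain ⟨c, hc, hZ2⟩ := exists_le_integral_gaussKer m
  obtain ⟨C, hC, hb⟩ := exists_attnBias_le_integral m hm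
  obtain ⟨C₂, hC₂, h2⟩ := exists_integral_dist_pow_mul_gaussKer_le m 2
  obtain ⟨C₃, hC₃, h3⟩ := exists_integral_dist_pow_mul_gaussKer_le m 3
  obtain ⟨K, hK, h⟩ := exists_rate_le m hc hC hC₂ hC₃
  refine ⟨K, hK, fun n y s hy hs hn => ?_⟩
  have hs0 : 0 < s := one_pos.trans_le hs
  have : NeZero n := ⟨by rintro rfl; have := pow_pos hs0 (m + 1); norm_num at hn; linarith⟩
  exact (hb n y s hy).trans (h n s _ _ _ hs hn
    ((hZ2 y hy s hs).trans (mul_le_mul_of_nonneg_left (integral_gaussKer_sq_le s y)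
      (by positivity)))
    (integral_nonneg fun x => mul_nonneg (sq_nonneg _) (gaussKer_pos s y x).le)
    (h2 y hy s hs0) (h3 y hy s hs0))

lemma exists_attnNoise_le (m : ℕ) :
    ∃ C : ℝ, 0 < C ∧ ∀ (n : ℕ) (y : EuclideanSpace ℝ (Fin (m + 1))) (s : ℝ), ‖y‖ = 1 → 1 ≤ s →
      0 < n → attnNoise m n (s ^ 2 • y) ≤ C * s ^ m / n := by
  obtain ⟨c, hc, hZ2⟩ := exists_le_integral_gaussKer m
  refine ⟨12 / c, by positivity, fun n y s hy hs hn => ?_⟩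
  have : NeZero n := ⟨hn.ne'⟩
  have hs0 : 0 < s := one_pos.trans_le hs
  have hn0 : (0 : ℝ) < n := by exact_mod_cast hn
  have h1 := integral_sum_sq_div_sq_le (n := n) (continuous_gaussKer s y) (gaussKer_pos s y)
    (gaussKer_le_one s y)
  have hZ := (hZ2 y hy s hs).trans (mul_le_mul_of_nonneg_left (integral_gaussKer_sq_le s y)
      (by positivity))
  have hZ0 := integral_pos_of_continuous (continuous_gaussKer s y) (gaussKer_pos s y)
  rw [attnNoise_eq_gaussKer s hy]
  refine h1.trans ?_
  generalize ∫ x, gaussKer s y x ∂sphereUniform (m + 1) = Z at hZ hZ0 ⊢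
  have h2 : exp (-(n * Z / 8)) ≤ 8 / (n * Z) := by
    have h3 := add_one_le_exp (n * Z / 8)
    have hnZ : 0 < n * Z := by positivity
    rw [exp_neg, inv_eq_one_div, div_le_div_iff₀ (exp_pos _) hnZ]
    linarith
  calc 4 / (n * Z) + exp (-(n * Z / 8)) ≤ 4 / (n * Z) + 8 / (n * Z) := by gcongr
    _ = 12 / (n * Z) := by ring
    _ ≤ 12 / c * s ^ m / n := by
      rw [div_mul_eq_mul_div, div_div, div_le_div_iff₀ (by positivity) (by positivity)]
      nlinarith

/-- At the balanced bandwidth both bias and noise are of order `L ^ 2 / s ^ 3`. -/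
lemma exists_attnRisk_le (m : ℕ) (hm : 1 ≤ m) :
    ∃ Q : ℝ, 0 < Q ∧ ∀ (n : ℕ) (y : EuclideanSpace ℝ (Fin (m + 1))) (L v s : ℝ), ‖y‖ = 1 →
      0 < v → s ^ (m + 3) = n * L ^ 2 / v → 1 ≤ s → s ^ (m + 1) ≤ n →
        attnRisk m n (L ^ 2 / 3) v y (s ^ 2 • y) ≤ Q * (L ^ 2 / s ^ 3) := by
  obtain ⟨C, hC, hbias⟩ := exists_attnBias_le m hm
  obtain ⟨D, hD, hnoise⟩ := exists_attnNoise_le m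
  refine ⟨C / 3 + D, by positivity, fun n y L v s hy hv hs h1 hn => ?_⟩
  have hs0 : 0 < s := one_pos.trans_le h1
  have hn0 : (0 : ℝ) < n := (pow_pos hs0 _).trans_le hn
  have hb := mul_le_mul_of_nonneg_left (hbias n y s hy h1 hn) (by positivity : 0 ≤ L ^ 2 / 3)
  have he := mul_le_mul_of_nonneg_left (hnoise n y s hy h1 (by exact_mod_cast hn0)) hv.le
  have hL : L ^ 2 = s ^ (m + 3) * v / n := by rw [hs]; field_simp
  have h2 : v * (D * s ^ m / n) = D * (L ^ 2 / s ^ 3) := by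
    rw [hL, pow_add]; field_simp
  rw [attnRisk]
  calc _ ≤ L ^ 2 / 3 * (C / s ^ 3) + v * (D * s ^ m / n) := add_le_add hb he
    _ = _ := by rw [h2]; ring

/-- Any minimizer of the conditional risk has an attention strength between the balanced inverse
bandwidth and its square. -/
lemma exists_minimizer_bounds (m : ℕ) (hm : 1 ≤ m) :
    ∃ c K N B : ℝ, 0 < c ∧ 1 ≤ K ∧ 1 ≤ N ∧ 0 < B ∧
      ∀ (n : ℕ) (y : EuclideanSpace ℝ (Fin (m + 1))) (L v s w : ℝ), ‖y‖ = 1 → 0 < L → 0 < v →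
      0 ≤ w → s ^ (m + 3) = n * L ^ 2 / v → K ≤ s → N * s ^ (m + 1) ≤ n →
      (∀ r : ℝ, 0 ≤ r →
        attnRisk m n (L ^ 2 / 3) v y (w • y) ≤ attnRisk m n (L ^ 2 / 3) v y (r • y)) →
      c * s ≤ w ∧ w ≤ B * s ^ 2 := by
  obtain ⟨Q, hQ, hrisk⟩ := exists_attnRisk_le m hm
  obtain ⟨a, a', ha, ha', hnoise⟩ := exists_le_attnNoise m
  obtain ⟨b, b', hb, hb', hbias⟩ := exists_le_attnBias m hm
  set B := 1 + Q / a
  set c := min 1 (b / (6 * Q))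
  have hB : 1 ≤ B := le_add_of_nonneg_right (by positivity)
  have hc : 0 < c := lt_min one_pos (by positivity)
  have hc1 : c ≤ 1 := min_le_left _ _
  refine ⟨c, 1 / c, max 1 (max (B ^ m / a') (1 / b')), B ^ 2, hc, (one_le_div hc).2 hc1,
    le_max_left _ _, by positivity, fun n y L v s w hy hL hv hw hs hK hN hmin => ?_⟩
  have hs1 : 1 ≤ s := ((one_le_div hc).2 hc1).trans hK
  have hs0 : 0 < s := one_pos.trans_le hs1
  have hpow : s ^ m ≤ s ^ (m + 1) := pow_le_pow_right₀ hs1 (by omega)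
  have hn1 : s ^ (m + 1) ≤ n := (le_mul_of_one_le_left (by positivity) (le_max_left _ _)).trans hN
  have hn2 : B ^ m / a' * s ^ m ≤ n :=
    (mul_le_mul ((le_max_left _ _).trans (le_max_right _ _)) hpow (by positivity)
      (by positivity)).trans hN
  have hn3 : 1 / b' * s ^ m ≤ n :=
    (mul_le_mul ((le_max_right _ _).trans (le_max_right _ _)) hpow (by positivity)
      (by positivity)).trans hN
  have hn0 : (0 : ℝ) < n := (pow_pos hs0 _).trans_le hn1
  have : NeZero n := ⟨by rintro rfl; simp at hn0⟩
  have hup := (hmin (s ^ 2) (by positivity)).trans (hrisk n y L v s hy hv hs hs1 hn1)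
  rw [attnRisk] at hup
  have hbn := mul_nonneg (by positivity : 0 ≤ L ^ 2 / 3) (attnBias_nonneg (m := m) (n := n) y (w • y))
  have hen := mul_nonneg hv.le (attnNoise_nonneg (m := m) (n := n) (w • y))
  have hLs : 0 < L ^ 2 / s ^ 3 := by positivity
  constructor
  · by_contra! hlt
    have ht1 : 1 ≤ c * s := by rwa [div_le_iff₀' hc] at hK
    have h1 := hbias n y (√w) (√(c * s)) hy (sqrt_nonneg _) (sqrt_le_sqrt hlt.le)
      (one_le_sqrt.2 ht1) (by
        have h2 : √(c * s) ≤ s := sqrt_le_iff.2 ⟨hs0.le, by nlinarith⟩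
        rw [one_div, inv_mul_le_iff₀ hb'] at hn3
        exact (pow_le_pow_left₀ (sqrt_nonneg _) h2 m).trans hn3)
    rw [sq_sqrt hw, show √(c * s) ^ 4 = (√(c * s) ^ 2) ^ 2 by ring, sq_sqrt (by positivity)] at h1
    have h3 := (mul_le_mul_of_nonneg_left h1 (by positivity : 0 ≤ L ^ 2 / 3)).trans
      ((le_add_of_nonneg_right hen).trans hup)
    have h4 : L ^ 2 / 3 * (b / (c * s) ^ 2) = b * s / (3 * c ^ 2) * (L ^ 2 / s ^ 3) := by
      field_simp
    rw [h4] at h3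
    have h5 := le_of_mul_le_mul_right h3 hLs
    rw [div_le_iff₀ (by positivity)] at h5
    have h6 : c * (6 * Q) ≤ b := (le_div_iff₀ (by positivity)).1 (min_le_right _ _)
    have h7 : c ^ 2 ≤ c := by nlinarith
    nlinarith [mul_le_mul_of_nonneg_left h7 hQ.le]
  · by_contra! hlt
    have h1 := hnoise n y (B * s) hy (one_le_mul_of_one_le_of_one_le hB hs1) (by
      rw [mul_pow]
      rw [div_mul_eq_mul_div, div_le_iff₀' ha'] at hn2
      exact hn2)
    rw [← mul_pow] at hlt
    have h2 := attnNoise_mono (n := n) (by positivity) hlt.le y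
    have h3 := (mul_le_mul_of_nonneg_left (h1.trans h2) hv.le).trans
      ((le_add_of_nonneg_left hbn).trans hup)
    have hL2 : L ^ 2 = s ^ (m + 3) * v / n := by rw [hs]; field_simp
    have h4 : v * (a * (B * s) ^ m / n) = a * B ^ m * (L ^ 2 / s ^ 3) := by
      rw [hL2, pow_add, mul_pow]; field_simp
    rw [h4] at h3
    have h5 := le_of_mul_le_mul_right h3 hLs
    have h6 : B ≤ B ^ m := le_self_pow₀ hB (by omega)
    have h7 : a * B = a + Q := by simp only [B]; field_simp
    nlinarith [mul_le_mul_of_nonneg_left h6 ha.le]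

/-- The sample size condition bounds the number of cells of the balanced bandwidth. -/
lemma mul_pow_le_of_log_le {d n : ℕ} {N₀ N L σ s : ℝ} (hL : 0 < L) (hσ : 0 < σ)
    (h3 : 3 ≤ N₀) (hN₀ : N ^ (d + 2) ≤ N₀) (hsΛ : s ^ (d + 2) = n * L ^ 2 / σ ^ 2)
    (hn : N₀ ≤ n) (h : N₀ * (L * log n / σ) ^ d ≤ n) : N * s ^ d ≤ n := by
  have hn0 : (0 : ℝ) < n := by linarith
  have hlog : 1 ≤ log n := by
    rw [le_log_iff_exp_le hn0]
    linarith [exp_one_lt_d9]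
  have h1 : N₀ * (L / σ) ^ d ≤ n := by
    refine le_trans ?_ h
    gcongr
    exact le_mul_of_one_le_right hL.le hlog
  refine le_of_pow_le_pow_left₀ (n := d + 2) (by omega) hn0.le ?_
  have h2 : (s ^ d) ^ (d + 2) = n ^ d * ((L / σ) ^ d) ^ 2 := by
    rw [← pow_mul, mul_comm, pow_mul, hsΛ, mul_div_assoc, mul_pow, ← div_pow, ← pow_mul,
      ← pow_mul, mul_comm 2]
  rw [mul_pow, h2]
  calc N ^ (d + 2) * ((n : ℝ) ^ d * ((L / σ) ^ d) ^ 2)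
      ≤ N₀ ^ 2 * ((n : ℝ) ^ d * ((L / σ) ^ d) ^ 2) := by
        gcongr
        nlinarith
    _ = n ^ d * (N₀ * (L / σ) ^ d) ^ 2 := by ring
    _ ≤ n ^ d * n ^ 2 := by gcongr
    _ = n ^ (d + 2) := by ring

end Attention

/-- Theorem 4 (Case 2, ReLU tasks): there are constants depending only on `d` such that,
under the stated conditions on `n, L, σ`, every global minimizer over `ℝ^{d×d}` of the
softmax-attention ICL pretraining loss with tasks drawn from `D(F^+_L)` equals `w • I_d`
with `c₁ Λ^{1/(d+2)} ≤ |w| ≤ c₂ Λ^{2/(d+2)}`, where `Λ = n L² / σ²`. -/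
theorem relu_pretraining_minimizer_scaling (d : ℕ) (hd : 2 ≤ d) :
    ∃ N0 a1 a2 c1 c2 : ℝ,
      0 < N0 ∧ 0 < a1 ∧ 0 < a2 ∧ 0 < c1 ∧ 0 < c2 ∧
      ∀ (n : ℕ) (L σ : ℝ) (ν : Measure ℝ),
        0 < L → 0 < σ →
        IsProbabilityMeasure ν →
        Integrable (fun t : ℝ => t ^ 2) ν →
        (∫ t, t ∂ν) = 0 →
        (∫ t, t ^ 2 ∂ν) = σ ^ 2 →
        a1 * (n : ℝ) ^ (-(d : ℝ) / 2) ≤ σ ^ 2 →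
        σ ^ 2 ≤ a2 * n * L ^ 2 →
        N0 ≤ (n : ℝ) →
        N0 * (L * Real.log n / σ) ^ d ≤ (n : ℝ) →
        ∀ Mstar : Matrix (Fin d) (Fin d) ℝ,
          (∀ M : Matrix (Fin d) (Fin d) ℝ,
            iclLoss d n (reluTask d L) ν reluF Mstar ≤
              iclLoss d n (reluTask d L) ν reluF M) →
          ∃ w : ℝ,
            Mstar = w • (1 : Matrix (Fin d) (Fin d) ℝ) ∧
            c1 * ((n : ℝ) * L ^ 2 / σ ^ 2) ^ ((1 : ℝ) / ((d : ℝ) + 2)) ≤ |w| ∧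
            |w| ≤ c2 * ((n : ℝ) * L ^ 2 / σ ^ 2) ^ ((2 : ℝ) / ((d : ℝ) + 2)) := by
  obtain ⟨m, rfl⟩ : ∃ m, d = m + 1 := ⟨d - 1, by omega⟩
  obtain ⟨c, K, N, B, hc, hK, hN, hB, hbounds⟩ := exists_minimizer_bounds m (by omega)
  refine ⟨max 3 (N ^ (m + 1 + 2)), 1, (K ^ (m + 3))⁻¹, c, B, by positivity, one_pos,
    by positivity, hc, hB, fun n L σ ν hL hσ hν h2 h0 hσν _ ha2 hn hlog M hM => ?_⟩
  have hn3 : (3 : ℝ) ≤ n := (le_max_left _ _).trans hn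
  have hn2 : 2 ≤ n := by
    have : (2 : ℝ) ≤ n := by linarith
    exact_mod_cast this
  have he : ‖EuclideanSpace.single (0 : Fin (m + 1)) (1 : ℝ)‖ = 1 := by simp
  obtain ⟨w, hw, hMw, hmin⟩ := exists_eq_smul_one_of_forall_iclLoss_le hn2 hL h2 h0 hM he
  rw [hσν] at hmin
  set Λ := (n : ℝ) * L ^ 2 / σ ^ 2 with hΛdef
  have hΛ : 0 ≤ Λ := by positivity
  have hd0 : (((m + 1 : ℕ) : ℝ) + 2) ≠ 0 := by positivity
  set s := Λ ^ ((1 : ℝ) / (((m + 1 : ℕ) : ℝ) + 2)) with hsdef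
  have hs0 : 0 ≤ s := by positivity
  have hsΛ : s ^ (m + 3) = Λ := by
    rw [hsdef, ← rpow_natCast, ← rpow_mul hΛ]
    convert rpow_one Λ using 2
    push_cast
    field_simp
    ring
  have hs2 : Λ ^ ((2 : ℝ) / (((m + 1 : ℕ) : ℝ) + 2)) = s ^ 2 := by
    rw [hsdef, ← rpow_natCast, ← rpow_mul hΛ]
    congr 1
    push_cast
    ring
  have hKs : K ≤ s := by
    refine le_of_pow_le_pow_left₀ (n := m + 3) (by omega) hs0 ?_
    rw [hsΛ, hΛdef, le_div_iff₀ (by positivity)]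
    rwa [mul_assoc, inv_mul_eq_div, le_div_iff₀' (by positivity)] at ha2
  have hNs := mul_pow_le_of_log_le hL hσ (le_max_left _ _) (le_max_right _ _) hsΛ hn hlog
  rw [hs2]
  obtain ⟨h1, h2⟩ := hbounds n _ L (σ ^ 2) s w he hL (by positivity) hw hsΛ hKs hNs hmin
  exact ⟨w, hMw, by rwa [abs_of_nonneg hw], by rwa [abs_of_nonneg hw]⟩
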